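/- The partial order of the C-degrees of computably enumerable sets and the partial order of the K-degrees of computably enumerable sets are not elementarily equivalent: the C-degrees of c.e. sets contain a minimal pair, while the K-degrees of c.e. sets do not. -/

import Mathlib

open Part Filter

open scoped Classical

namespace KPaper

/-- Binary strings. -/
abbrev Str := List Bool

/-! ### Oracle (Turing) reducibility -/

/-- The functions `ℕ →. ℕ` that are partial recursive relative to an oracle `O : ℕ →. ℕ`.
This mirrors Mathlib's `Nat.Partrec`, with an extra base case for the oracle. -/
inductive RecursiveIn (O : ℕ →. ℕ) : (ℕ →. ℕ) → Prop
  | oracle : RecursiveIn O O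
  | zero : RecursiveIn O (pure 0)
  | succ : RecursiveIn O ↑Nat.succ
  | left : RecursiveIn O ↑fun n : ℕ => n.unpair.1
  | right : RecursiveIn O ↑fun n : ℕ => n.unpair.2
  | pair {f g} : RecursiveIn O f → RecursiveIn O g →
      RecursiveIn O fun n => Nat.pair <$> f n <*> g n
  | comp {f g} : RecursiveIn O f → RecursiveIn O g → RecursiveIn O fun n => g n >>= f
  | prec {f g} : RecursiveIn O f → RecursiveIn O g → RecursiveIn O (Nat.unpaired fun a n =>
      n.rec (f a) fun y IH => do let i ← IH; g (Nat.pair a (Nat.pair y i)))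
  | rfind {f} : RecursiveIn O f →
      RecursiveIn O fun a => Nat.rfind fun n => (fun m => m = 0) <$> f (Nat.pair a n)

/-- The characteristic (partial) function of a set of naturals, used as a Turing oracle. -/
noncomputable def chi (A : Set ℕ) : ℕ →. ℕ := fun n => Part.some (if n ∈ A then 1 else 0)

/-- The characteristic function of an infinite binary sequence, used as a Turing oracle. -/
def chiSeq (X : ℕ → Bool) : ℕ →. ℕ := fun n => Part.some (cond (X n) 1 0)

/-- `A` is Turing reducible to `B`. -/
noncomputable def TuringLeSet (A B : Set ℕ) : Prop := RecursiveIn (chi B) (chi A)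

/-- `A` is Turing equivalent to `B`. -/
noncomputable def TuringEquivSet (A B : Set ℕ) : Prop := TuringLeSet A B ∧ TuringLeSet B A

/-- Turing equivalence between a set and an infinite binary sequence. -/
noncomputable def TuringEquivSetSeq (A : Set ℕ) (X : ℕ → Bool) : Prop :=
  RecursiveIn (chiSeq X) (chi A) ∧ RecursiveIn (chi A) (chiSeq X)

/-- The halting problem `∅'`. -/
def haltingSet : Set ℕ := {n | ((Denumerable.ofNat Nat.Partrec.Code n).eval n).Dom}

/-- A set of naturals is computably enumerable iff it is the domain of a
partial computable function. -/
def CESet (A : Set ℕ) : Prop := ∃ f : ℕ →. ℕ, Nat.Partrec f ∧ ∀ n, n ∈ A ↔ (f n).Dom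

/-! ### Machines and Kolmogorov complexity -/

/-- A (plain) machine is a partial computable map from binary strings to binary strings. -/
def PlainMachine (M : Str →. Str) : Prop := Partrec M

/-- A prefix-free machine: a partial computable map on binary strings whose
domain is an antichain under the prefix relation. -/
def PFMachine (M : Str →. Str) : Prop :=
  Partrec M ∧ ∀ ρ₁ ρ₂ : Str, (M ρ₁).Dom → (M ρ₂).Dom → ρ₁ <+: ρ₂ → ρ₁ = ρ₂

/-- The Kolmogorov complexity of a string `σ` with respect to a machine `M`:
the least length of an `M`-description of `σ` (`⊤` if there is none). -/
noncomputable def KC (M : Str →. Str) (σ : Str) : ℕ∞ :=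
  ⨅ ρ : {ρ : Str // σ ∈ M ρ}, ((ρ : Str).length : ℕ∞)

/-- An optimal prefix-free machine: a prefix-free machine whose associated complexity
is minimal, up to an additive constant, among all prefix-free machines. -/
def OptimalPF (U : Str →. Str) : Prop :=
  PFMachine U ∧ ∀ M : Str →. Str, PFMachine M → ∃ c : ℕ, ∀ σ : Str, KC U σ ≤ KC M σ + c

/-- An optimal plain machine. -/
def OptimalPlain (V : Str →. Str) : Prop :=
  PlainMachine V ∧ ∀ M : Str →. Str, PlainMachine M → ∃ c : ℕ, ∀ σ : Str, KC V σ ≤ KC M σ + c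

/-! ### Initial segments -/

/-- The first `n` bits of the characteristic sequence of a set of naturals. -/
noncomputable def restrSet (A : Set ℕ) (n : ℕ) : Str :=
  (List.range n).map fun i => decide (i ∈ A)

/-- The first `n` bits of an infinite binary sequence. -/
def restrSeq (X : ℕ → Bool) (n : ℕ) : Str := (List.range n).map X

/-- The string `0^n`; `K(n)` is identified with `K(0^n)`. -/
def zeroStr (n : ℕ) : Str := List.replicate n false

/-! ### `≤_K`, `<_K`, `K`-triviality (and the `≤_C` analogues) -/

def KLeSet (U : Str →. Str) (A B : Set ℕ) : Prop :=
  ∃ c : ℕ, ∀ n, KC U (restrSet A n) ≤ KC U (restrSet B n) + c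

def KLtSet (U : Str →. Str) (A B : Set ℕ) : Prop := KLeSet U A B ∧ ¬ KLeSet U B A

def KTrivialSet (U : Str →. Str) (A : Set ℕ) : Prop :=
  ∃ c : ℕ, ∀ n, KC U (restrSet A n) ≤ KC U (zeroStr n) + c

def KLeSeq (U : Str →. Str) (X Y : ℕ → Bool) : Prop :=
  ∃ c : ℕ, ∀ n, KC U (restrSeq X n) ≤ KC U (restrSeq Y n) + c

def KLtSeq (U : Str →. Str) (X Y : ℕ → Bool) : Prop := KLeSeq U X Y ∧ ¬ KLeSeq U Y X

def KTrivialSeq (U : Str →. Str) (X : ℕ → Bool) : Prop :=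
  ∃ c : ℕ, ∀ n, KC U (restrSeq X n) ≤ KC U (zeroStr n) + c

/-! ### Computably enumerable reals -/

/-- The real number in `[0,1]` whose binary expansion is the sequence `X`. -/
noncomputable def realOfSeq (X : ℕ → Bool) : ℝ := ∑' i : ℕ, cond (X i) ((2 : ℝ) ^ (i + 1))⁻¹ 0

/-- `X` (identified with the real it is the binary expansion of) is a computably
enumerable real: it is the limit of a nondecreasing computable sequence of
(dyadic) rationals. -/
def CEReal (X : ℕ → Bool) : Prop :=
  ∃ f : ℕ → ℤ, Computable f ∧
    (∀ s, (f s : ℝ) / 2 ^ s ≤ (f (s + 1) : ℝ) / 2 ^ (s + 1)) ∧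
    Tendsto (fun s => (f s : ℝ) / 2 ^ s) atTop (nhds (realOfSeq X))

/-- The characteristic sequence of a set of naturals. -/
noncomputable def seqOfSet (A : Set ℕ) : ℕ → Bool := fun i => decide (i ∈ A)

/-! ### Solovay reducibility -/

/-- Solovay reducibility on c.e. reals: `X ≤_S Y` iff there are nondecreasing computable
rational approximations to `X` and `Y` and a constant `c` such that at each stage the
distance to `X` is bounded by `c` times the distance to `Y`. -/
def SolovayLe (X Y : ℕ → Bool) : Prop :=
  ∃ (c : ℕ) (f g : ℕ → ℤ), Computable f ∧ Computable g ∧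
    (∀ s, (f s : ℝ) / 2 ^ s ≤ (f (s + 1) : ℝ) / 2 ^ (s + 1)) ∧
    (∀ s, (g s : ℝ) / 2 ^ s ≤ (g (s + 1) : ℝ) / 2 ^ (s + 1)) ∧
    Tendsto (fun s => (f s : ℝ) / 2 ^ s) atTop (nhds (realOfSeq X)) ∧
    Tendsto (fun s => (g s : ℝ) / 2 ^ s) atTop (nhds (realOfSeq Y)) ∧
    ∀ s, realOfSeq X - (f s : ℝ) / 2 ^ s ≤ (c : ℝ) * (realOfSeq Y - (g s : ℝ) / 2 ^ s)


/-- `≤_C` on sets of naturals, with respect to a plain machine `V`. -/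
noncomputable def CLeSet (V : Str →. Str) (A B : Set ℕ) : Prop :=
  ∃ d : ℕ, ∀ n, KC V (restrSet A n) ≤ KC V (restrSet B n) + d

/-- `C`-triviality for sets (membership in the least `C`-degree). -/
noncomputable def CTrivialSet (V : Str →. Str) (A : Set ℕ) : Prop :=
  ∃ d : ℕ, ∀ n, KC V (restrSet A n) ≤ KC V (zeroStr n) + d

section PartP1
/-! ### Primitive recursion toolkit -/
attribute [fun_prop] Primrec

section PrToolkit
variable {α β γ δ : Type*} [Primcodable α] [Primcodable β] [Primcodable γ] [Primcodable δ]

@[fun_prop] theorem Pr.id : Primrec (fun a : α => a) := Primrec.id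
@[fun_prop] theorem Pr.const (b : β) : Primrec (fun _ : α => b) := Primrec.const b
@[fun_prop] theorem Pr.comp {f : β → γ} {g : α → β} (hf : Primrec f) (hg : Primrec g) :
    Primrec (fun a : α => f (g a)) := hf.comp hg
@[fun_prop] theorem Pr.fst {g : α → β × γ} (hg : Primrec g) : Primrec (fun a : α => (g a).1) :=
  Primrec.fst.comp hg
@[fun_prop] theorem Pr.snd {g : α → β × γ} (hg : Primrec g) : Primrec (fun a : α => (g a).2) :=
  Primrec.snd.comp hg
@[fun_prop] theorem Pr.mk {f : α → β} {g : α → γ} (hf : Primrec f) (hg : Primrec g) :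
    Primrec (fun a : α => (f a, g a)) := hf.pair hg

-- naturals
@[fun_prop] theorem Pr.add {f g : α → ℕ} (hf : Primrec f) (hg : Primrec g) :
    Primrec (fun a : α => f a + g a) := Primrec.nat_add.comp hf hg
@[fun_prop] theorem Pr.mul {f g : α → ℕ} (hf : Primrec f) (hg : Primrec g) :
    Primrec (fun a : α => f a * g a) := Primrec.nat_mul.comp hf hg
@[fun_prop] theorem Pr.sub {f g : α → ℕ} (hf : Primrec f) (hg : Primrec g) :
    Primrec (fun a : α => f a - g a) := Primrec.nat_sub.comp hf hg
@[fun_prop] theorem Pr.div {f g : α → ℕ} (hf : Primrec f) (hg : Primrec g) :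
    Primrec (fun a : α => f a / g a) := Primrec.nat_div.comp hf hg
@[fun_prop] theorem Pr.mod {f g : α → ℕ} (hf : Primrec f) (hg : Primrec g) :
    Primrec (fun a : α => f a % g a) := Primrec.nat_mod.comp hf hg
@[fun_prop] theorem Pr.max {f g : α → ℕ} (hf : Primrec f) (hg : Primrec g) :
    Primrec (fun a : α => max (f a) (g a)) := Primrec.nat_max.comp hf hg
@[fun_prop] theorem Pr.min {f g : α → ℕ} (hf : Primrec f) (hg : Primrec g) :
    Primrec (fun a : α => min (f a) (g a)) := Primrec.nat_min.comp hf hg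
@[fun_prop] theorem Pr.pow {f g : α → ℕ} (hf : Primrec f) (hg : Primrec g) :
    Primrec (fun a : α => f a ^ g a) :=
  (Primrec₂.unpaired'.1 Nat.Primrec.pow).comp hf hg
@[fun_prop] theorem Pr.pair {f g : α → ℕ} (hf : Primrec f) (hg : Primrec g) :
    Primrec (fun a : α => Nat.pair (f a) (g a)) := Primrec₂.natPair.comp hf hg
@[fun_prop] theorem Pr.unpair {f : α → ℕ} (hf : Primrec f) :
    Primrec (fun a : α => Nat.unpair (f a)) := Primrec.unpair.comp hf
@[fun_prop] theorem Pr.succ {f : α → ℕ} (hf : Primrec f) :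
    Primrec (fun a : α => Nat.succ (f a)) := Primrec.succ.comp hf

-- booleans
@[fun_prop] theorem Pr.lt {f g : α → ℕ} (hf : Primrec f) (hg : Primrec g) :
    Primrec (fun a : α => decide (f a < g a)) :=
  (Primrec.nat_lt.decide.comp hf hg).of_eq (by simp)
@[fun_prop] theorem Pr.le {f g : α → ℕ} (hf : Primrec f) (hg : Primrec g) :
    Primrec (fun a : α => decide (f a ≤ g a)) :=
  (Primrec.nat_le.decide.comp hf hg).of_eq (by simp)
@[fun_prop] theorem Pr.deq {f g : α → β} [DecidableEq β] (hf : Primrec f) (hg : Primrec g) :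
    Primrec (fun a : α => decide (f a = g a)) :=
  (Primrec.eq.decide.comp hf hg).of_eq (by simp)
@[fun_prop] theorem Pr.and {f g : α → Bool} (hf : Primrec f) (hg : Primrec g) :
    Primrec (fun a : α => f a && g a) := Primrec.and.comp hf hg
@[fun_prop] theorem Pr.or {f g : α → Bool} (hf : Primrec f) (hg : Primrec g) :
    Primrec (fun a : α => f a || g a) := Primrec.or.comp hf hg
@[fun_prop] theorem Pr.not {f : α → Bool} (hf : Primrec f) :
    Primrec (fun a : α => !(f a)) := Primrec.not.comp hf
@[fun_prop] theorem Pr.cond {c : α → Bool} {f g : α → β} (hc : Primrec c) (hf : Primrec f)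
    (hg : Primrec g) : Primrec (fun a : α => bif c a then f a else g a) := Primrec.cond hc hf hg
@[fun_prop] theorem Pr.ite {c : α → Bool} {f g : α → β} (hc : Primrec c) (hf : Primrec f)
    (hg : Primrec g) : Primrec (fun a : α => if c a = true then f a else g a) :=
  (Primrec.cond hc hf hg).of_eq (fun a => by cases h : c a <;> simp)

-- options
@[fun_prop] theorem Pr.osome {f : α → β} (hf : Primrec f) :
    Primrec (fun a : α => Option.some (f a)) := Primrec.option_some.comp hf
@[fun_prop] theorem Pr.isSome {f : α → Option β} (hf : Primrec f) :
    Primrec (fun a : α => (f a).isSome) := Primrec.option_isSome.comp hf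
@[fun_prop] theorem Pr.isNone {f : α → Option β} (hf : Primrec f) :
    Primrec (fun a : α => (f a).isNone) :=
  (Primrec.not.comp (Primrec.option_isSome.comp hf)).of_eq (fun a => by simp)
@[fun_prop] theorem Pr.obind {f : α → β → Option γ} {g : α → Option β}
    (hf : Primrec (fun p : α × β => f p.1 p.2)) (hg : Primrec g) :
    Primrec (fun a : α => (g a).bind (f a)) := Primrec.option_bind hg hf
@[fun_prop] theorem Pr.omap {f : α → β → γ} {g : α → Option β}
    (hf : Primrec (fun p : α × β => f p.1 p.2)) (hg : Primrec g) :
    Primrec (fun a : α => (g a).map (f a)) := Primrec.option_map hg hf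
@[fun_prop] theorem Pr.ogetD {f : α → Option β} {g : α → β} (hf : Primrec f) (hg : Primrec g) :
    Primrec (fun a : α => (f a).getD (g a)) := Primrec.option_getD.comp hf hg
@[fun_prop] theorem Pr.oelim {f : α → β → γ} {g : α → Option β} {h : α → γ}
    (hf : Primrec (fun p : α × β => f p.1 p.2)) (hg : Primrec g) (hh : Primrec h) :
    Primrec (fun a : α => (g a).elim (h a) (f a)) :=
  (Primrec.option_casesOn hg hh hf).of_eq (fun a => by cases g a <;> rfl)

-- lists
@[fun_prop] theorem Pr.cons {f : α → β} {g : α → List β} (hf : Primrec f) (hg : Primrec g) :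
    Primrec (fun a : α => f a :: g a) := Primrec.list_cons.comp hf hg
@[fun_prop] theorem Pr.append {f g : α → List β} (hf : Primrec f) (hg : Primrec g) :
    Primrec (fun a : α => f a ++ g a) := Primrec.list_append.comp hf hg
@[fun_prop] theorem Pr.map {f : α → β → γ} {g : α → List β}
    (hf : Primrec (fun p : α × β => f p.1 p.2)) (hg : Primrec g) :
    Primrec (fun a : α => (g a).map (f a)) := Primrec.list_map hg hf
@[fun_prop] theorem Pr.filterMap {f : α → β → Option γ} {g : α → List β}
    (hf : Primrec (fun p : α × β => f p.1 p.2)) (hg : Primrec g) :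
    Primrec (fun a : α => (g a).filterMap (f a)) := Primrec.listFilterMap hg hf
@[fun_prop] theorem Pr.filter {f : α → β → Bool} {g : α → List β}
    (hf : Primrec (fun p : α × β => f p.1 p.2)) (hg : Primrec g) :
    Primrec (fun a : α => (g a).filter (f a)) := by
  have : Primrec (fun a : α => (g a).filterMap
      (fun b => bif f a b then Option.some b else Option.none)) := by fun_prop
  refine this.of_eq fun a => ?_
  induction g a with
  | nil => rfl
  | cons b l ih =>
    simp only [List.filterMap_cons, List.filter_cons]
    cases f a b <;> simp [ih]
@[fun_prop] theorem Pr.flatMap {f : α → β → List γ} {g : α → List β}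
    (hf : Primrec (fun p : α × β => f p.1 p.2)) (hg : Primrec g) :
    Primrec (fun a : α => (g a).flatMap (f a)) := Primrec.list_flatMap hg hf
@[fun_prop] theorem Pr.range {f : α → ℕ} (hf : Primrec f) :
    Primrec (fun a : α => List.range (f a)) := Primrec.list_range.comp hf
@[fun_prop] theorem Pr.length {f : α → List β} (hf : Primrec f) :
    Primrec (fun a : α => (f a).length) := Primrec.list_length.comp hf
@[fun_prop] theorem Pr.reverse {f : α → List β} (hf : Primrec f) :
    Primrec (fun a : α => (f a).reverse) := Primrec.list_reverse.comp hf
@[fun_prop] theorem Pr.tail {f : α → List β} (hf : Primrec f) :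
    Primrec (fun a : α => (f a).tail) := Primrec.list_tail.comp hf
@[fun_prop] theorem Pr.head? {f : α → List β} (hf : Primrec f) :
    Primrec (fun a : α => (f a).head?) := Primrec.list_head?.comp hf
@[fun_prop] theorem Pr.take {f : α → ℕ} {g : α → List β} (hf : Primrec f) (hg : Primrec g) :
    Primrec (fun a : α => (g a).take (f a)) := Primrec.list_take.comp hf hg
@[fun_prop] theorem Pr.drop {f : α → ℕ} {g : α → List β} (hf : Primrec f) (hg : Primrec g) :
    Primrec (fun a : α => (g a).drop (f a)) := Primrec.list_drop.comp hf hg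
@[fun_prop] theorem Pr.getElem? {f : α → ℕ} {g : α → List β} (hf : Primrec f) (hg : Primrec g) :
    Primrec (fun a : α => (g a)[f a]?) := Primrec.list_getElem?.comp hg hf
@[fun_prop] theorem Pr.getD {f : α → ℕ} {g : α → List β} {h : α → β} (hf : Primrec f)
    (hg : Primrec g) (hh : Primrec h) :
    Primrec (fun a : α => (g a).getD (f a) (h a)) := by
  have : Primrec (fun a : α => ((g a)[f a]?).getD (h a)) := by fun_prop
  exact this.of_eq fun a => by simp
@[fun_prop] theorem Pr.foldl {f : α → γ → β → γ} {g : α → List β} {h : α → γ}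
    (hf : Primrec (fun p : α × γ × β => f p.1 p.2.1 p.2.2)) (hg : Primrec g) (hh : Primrec h) :
    Primrec (fun a : α => (g a).foldl (f a) (h a)) :=
  (Primrec.list_foldl (h := fun a p => f a p.1 p.2) hg hh hf)
@[fun_prop] theorem Pr.foldr {f : α → β → γ → γ} {g : α → List β} {h : α → γ}
    (hf : Primrec (fun p : α × β × γ => f p.1 p.2.1 p.2.2)) (hg : Primrec g) (hh : Primrec h) :
    Primrec (fun a : α => (g a).foldr (f a) (h a)) :=
  (Primrec.list_foldr (h := fun a p => f a p.1 p.2) hg hh hf)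
@[fun_prop] theorem Pr.sum {g : α → List ℕ} (hg : Primrec g) :
    Primrec (fun a : α => (g a).sum) := by
  have : Primrec (fun a : α => (g a).foldr (fun x y => x + y) 0) := by fun_prop
  exact this.of_eq fun a => by rw [List.sum_eq_foldr]
@[fun_prop] theorem Pr.any {f : α → β → Bool} {g : α → List β}
    (hf : Primrec (fun p : α × β => f p.1 p.2)) (hg : Primrec g) :
    Primrec (fun a : α => (g a).any (f a)) := by
  have : Primrec (fun a : α => (g a).foldr (fun x y => f a x || y) false) := by fun_prop
  exact this.of_eq fun a => by induction g a <;> simp_all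
@[fun_prop] theorem Pr.all {f : α → β → Bool} {g : α → List β}
    (hf : Primrec (fun p : α × β => f p.1 p.2)) (hg : Primrec g) :
    Primrec (fun a : α => (g a).all (f a)) := by
  have : Primrec (fun a : α => (g a).foldr (fun x y => f a x && y) true) := by fun_prop
  exact this.of_eq fun a => by induction g a <;> simp_all
@[fun_prop] theorem Pr.find? {f : α → β → Bool} {g : α → List β}
    (hf : Primrec (fun p : α × β => f p.1 p.2)) (hg : Primrec g) :
    Primrec (fun a : α => (g a).find? (f a)) := by
  have : Primrec (fun a : α => (g a).foldr
    (fun x y => bif f a x then Option.some x else y) Option.none) := by fun_prop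
  refine this.of_eq fun a => ?_
  induction g a with
  | nil => rfl
  | cons b l ih => simp only [List.foldr_cons, List.find?_cons, ih]; cases f a b <;> rfl
@[fun_prop] theorem Pr.mem {f : α → β} {g : α → List β} [DecidableEq β] (hf : Primrec f)
    (hg : Primrec g) : Primrec (fun a : α => decide (f a ∈ g a)) := by
  have : Primrec (fun a : α => (g a).any (fun x => decide (f a = x))) := by fun_prop
  exact this.of_eq fun a => by induction g a <;> simp_all
@[fun_prop] theorem Pr.replicate {f : α → ℕ} {g : α → β} (hf : Primrec f) (hg : Primrec g) :
    Primrec (fun a : α => List.replicate (f a) (g a)) := by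
  have : Primrec (fun a : α => (List.range (f a)).map (fun _ => g a)) := by fun_prop
  exact this.of_eq fun a => by simp
theorem Pr.natRec {f : α → β} {g : α → ℕ → β → β} {h : α → ℕ}
    (hf : Primrec f) (hg : Primrec (fun p : α × ℕ × β => g p.1 p.2.1 p.2.2)) (hh : Primrec h) :
    Primrec (fun a : α => Nat.rec (motive := fun _ => β) (f a) (g a) (h a)) :=
  Primrec.nat_rec' (h := fun a p => g a p.1 p.2) hh hf hg

-- codes
open Nat.Partrec in
@[fun_prop] theorem Pr.evaln {f : α → ℕ} {g : α → Code} {h : α → ℕ}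
    (hf : Primrec f) (hg : Primrec g) (hh : Primrec h) :
    Primrec (fun a : α => Code.evaln (f a) (g a) (h a)) :=
  Code.primrec_evaln.comp ((hf.pair hg).pair hh)
@[fun_prop] theorem Pr.ofNat {f : α → ℕ} (hf : Primrec f) :
    Primrec (fun a : α => Denumerable.ofNat Nat.Partrec.Code (f a)) :=
  (Primrec.ofNat Nat.Partrec.Code).comp hf
@[fun_prop] theorem Pr.encode {f : α → β} (hf : Primrec f) :
    Primrec (fun a : α => Encodable.encode (f a)) := Primrec.encode.comp hf
@[fun_prop] theorem Pr.decode {f : α → ℕ} (hf : Primrec f) :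
    Primrec (fun a : α => (Encodable.decode (f a) : Option β)) := Primrec.decode.comp hf
end PrToolkit

end PartP1

section PartP2
/-! ### Weights -/

/-- real weight of a list of exponents -/
noncomputable def lw (l : List ℕ) : ℝ := (l.map fun x => ((2 : ℝ) ^ x)⁻¹).sum

@[simp] theorem lw_nil : lw [] = 0 := rfl
@[simp] theorem lw_cons (a : ℕ) (l : List ℕ) : lw (a :: l) = ((2 : ℝ) ^ a)⁻¹ + lw l := by simp [lw]
@[simp] theorem lw_append (l m : List ℕ) : lw (l ++ m) = lw l + lw m := by simp [lw]
theorem lw_nonneg (l : List ℕ) : 0 ≤ lw l := by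
  induction l with
  | nil => simp
  | cons a l ih => rw [lw_cons]; positivity
theorem lw_map_add (l : List ℕ) (b : ℕ) : lw (l.map (· + b)) = ((2 : ℝ) ^ b)⁻¹ * lw l := by
  induction l with
  | nil => simp
  | cons a l ih => simp only [List.map_cons, lw_cons, ih, pow_add, mul_inv]; ring

/-- integer version -/
def nw (M : ℕ) (l : List ℕ) : ℕ := (l.map fun x => 2 ^ (M - x)).sum

@[fun_prop] theorem nw_pr : Primrec (fun p : ℕ × List ℕ => nw p.1 p.2) := by unfold nw; fun_prop

theorem nw_eq (M : ℕ) (l : List ℕ) (h : ∀ x ∈ l, x ≤ M) : (nw M l : ℝ) = 2 ^ M * lw l := by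
  induction l with
  | nil => simp [nw]
  | cons a l ih =>
    have h1 : a ≤ M := h a (by simp)
    have h2 := ih (fun x hx => h x (by simp [hx]))
    have : nw M (a :: l) = 2 ^ (M - a) + nw M l := by simp [nw]
    rw [this, lw_cons]
    push_cast
    rw [h2, mul_add]
    congr 1
    rw [pow_sub₀ _ (by norm_num) h1]

/-- `lw l₁ ≤ lw l₂`, computably -/
def lwle (l₁ l₂ : List ℕ) : Bool := decide (nw (l₁.sum + l₂.sum) l₁ ≤ nw (l₁.sum + l₂.sum) l₂)

@[fun_prop] theorem lwle_pr : Primrec (fun p : List ℕ × List ℕ => lwle p.1 p.2) := by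
  unfold lwle; fun_prop

theorem lwle_iff (l₁ l₂ : List ℕ) : lwle l₁ l₂ = true ↔ lw l₁ ≤ lw l₂ := by
  have h1 := nw_eq (l₁.sum + l₂.sum) l₁ (fun x hx => by have := List.le_sum_of_mem hx; omega)
  have h2 := nw_eq (l₁.sum + l₂.sum) l₂ (fun x hx => by have := List.le_sum_of_mem hx; omega)
  simp only [lwle, decide_eq_true_eq]
  rw [← Nat.cast_le (α := ℝ), h1, h2]
  exact mul_le_mul_iff_right₀ (by positivity)

/-! ### Streams of weighted strings -/

/-- exponents of the requests for `σ` before stage `T` -/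
def plist (u : ℕ → Option (Str × ℕ)) (T : ℕ) (σ : Str) : List ℕ :=
  (List.range T).filterMap fun i => (u i).bind fun q =>
    bif decide (q.1 = σ) then Option.some q.2 else Option.none

/-- all exponents before stage `T` -/
def tlist (u : ℕ → Option (Str × ℕ)) (T : ℕ) : List ℕ :=
  (List.range T).filterMap fun i => (u i).map fun q => q.2

/-- mass given to `σ` before `T` -/
noncomputable def pm (u : ℕ → Option (Str × ℕ)) (T : ℕ) (σ : Str) : ℝ := lw (plist u T σ)
/-- total mass before `T` -/
noncomputable def tm (u : ℕ → Option (Str × ℕ)) (T : ℕ) : ℝ := lw (tlist u T)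

/-- weight of a request -/
noncomputable def rw' (o : Option (Str × ℕ)) : ℝ := o.elim 0 fun q => ((2 : ℝ) ^ q.2)⁻¹
/-- weight of a request at `σ` -/
noncomputable def rws (o : Option (Str × ℕ)) (σ : Str) : ℝ :=
  o.elim 0 fun q => if q.1 = σ then ((2 : ℝ) ^ q.2)⁻¹ else 0

theorem rw'_nonneg (o) : 0 ≤ rw' o := by cases o <;> simp [rw']
theorem rws_nonneg (o σ) : 0 ≤ rws o σ := by
  cases o with
  | none => simp [rws]
  | some q => simp only [rws, Option.elim]; split_ifs <;> positivity

theorem pm_eq_sum (u : ℕ → Option (Str × ℕ)) (T : ℕ) (σ : Str) : pm u T σ = ∑ i ∈ Finset.range T, rws (u i) σ := by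
  induction T with
  | zero => simp [pm, plist]
  | succ n ih =>
    rw [Finset.sum_range_succ, ← ih, pm, pm, plist, List.range_succ, List.filterMap_append, lw_append]
    congr 1
    rcases h : u n with _ | q
    · simp [rws, h]
    · by_cases h2 : q.1 = σ <;> simp [rws, h, h2]

theorem tm_eq_sum (u : ℕ → Option (Str × ℕ)) (T : ℕ) : tm u T = ∑ i ∈ Finset.range T, rw' (u i) := by
  induction T with
  | zero => simp [tm, tlist]
  | succ n ih =>
    rw [Finset.sum_range_succ, ← ih, tm, tm, tlist, List.range_succ, List.filterMap_append, lw_append]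
    congr 1
    rcases h : u n with _ | q <;> simp [rw', h]

theorem pm_mono (u : ℕ → Option (Str × ℕ)) {T T' : ℕ} (h : T ≤ T') (σ : Str) : pm u T σ ≤ pm u T' σ := by
  rw [pm_eq_sum, pm_eq_sum]
  exact Finset.sum_le_sum_of_subset_of_nonneg (by simpa using h) (fun _ _ _ => rws_nonneg _ _)

theorem tm_mono (u : ℕ → Option (Str × ℕ)) {T T' : ℕ} (h : T ≤ T') : tm u T ≤ tm u T' := by
  rw [tm_eq_sum, tm_eq_sum]
  exact Finset.sum_le_sum_of_subset_of_nonneg (by simpa using h) (fun _ _ _ => rw'_nonneg _)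

theorem pm_nonneg (u T σ) : 0 ≤ pm u T σ := lw_nonneg _

theorem sum_pm_le_tm (u : ℕ → Option (Str × ℕ)) (T : ℕ) (S : Finset Str) : ∑ σ ∈ S, pm u T σ ≤ tm u T := by
  simp only [pm_eq_sum]
  rw [Finset.sum_comm, tm_eq_sum]
  refine Finset.sum_le_sum fun i _ => ?_
  rcases h : u i with _ | q
  · simp [rws, rw']
  · simp only [rws, rw', Option.elim]
    rw [Finset.sum_ite_eq]
    split_ifs
    · exact le_rfl
    · positivity

theorem plist_pr {u : ℕ → Option (Str × ℕ)} (hu : Primrec u) : Primrec (fun p : ℕ × Str => plist u p.1 p.2) := by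
  unfold plist; fun_prop

theorem tlist_pr {u : ℕ → Option (Str × ℕ)} (hu : Primrec u) : Primrec (fun T : ℕ => tlist u T) := by
  unfold tlist; fun_prop

end PartP2

section PartP3
/-! ### Kraft–Chaitin -/

/-- binary expansion of `v` with `L` digits -/
def bits (L v : ℕ) : Str := (List.range L).map fun i => decide ((v / 2 ^ (L - 1 - i)) % 2 = 1)

@[fun_prop] theorem bits_pr : Primrec (fun p : ℕ × ℕ => bits p.1 p.2) := by unfold bits; fun_prop

@[simp] theorem bits_length (L v : ℕ) : (bits L v).length = L := by simp [bits]

theorem bits_inj {L v w : ℕ} (hv : v < 2 ^ L) (hw : w < 2 ^ L) (h : bits L v = bits L w) : v = w := by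
  apply Nat.eq_of_testBit_eq
  intro i
  by_cases hi : i < L
  · have := congrArg (fun l => l[L - 1 - i]?) h
    have h3 : L - 1 - i < L := by omega
    have h4 : L - 1 - (L - 1 - i) = i := by omega
    simp only [bits, List.getElem?_map, List.getElem?_range h3, h4, Option.map_some,
      Option.some.injEq] at this
    rw [Nat.testBit_eq_decide_div_mod_eq, Nat.testBit_eq_decide_div_mod_eq]
    simpa using this
  · rw [Nat.testBit_lt_two_pow (lt_of_lt_of_le hv (Nat.pow_le_pow_right (by norm_num) (by omega))),
      Nat.testBit_lt_two_pow (lt_of_lt_of_le hw (Nat.pow_le_pow_right (by norm_num) (by omega)))]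

theorem bits_take {L L' w : ℕ} (h : L ≤ L') : (bits L' w).take L = bits L (w / 2 ^ (L' - L)) := by
  rw [bits, bits, ← List.map_take, List.take_range, min_eq_left h]
  apply List.map_congr_left
  intro i hi
  have hi := List.mem_range.1 hi
  rw [Nat.div_div_eq_div_mul, ← pow_add]
  have : L' - L + (L - 1 - i) = L' - 1 - i := by omega
  rw [this]

/-- numerator of the Kraft–Chaitin code -/
def kcNum (u : ℕ → Option (Str × ℕ)) (n ℓ : ℕ) : ℕ :=
  (nw (tlist u n).sum (tlist u n) * 2 ^ (ℓ + 1) + (2 ^ (tlist u n).sum - 1)) / 2 ^ (tlist u n).sum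

theorem kcNum_spec (u : ℕ → Option (Str × ℕ)) (n ℓ : ℕ) :
    tm u n * 2 ^ (ℓ + 1) ≤ kcNum u n ℓ ∧ (kcNum u n ℓ : ℝ) < tm u n * 2 ^ (ℓ + 1) + 1 := by
  set M := (tlist u n).sum with hM
  have h1 : (nw M (tlist u n) : ℝ) = 2 ^ M * tm u n :=
    nw_eq M _ (fun x hx => List.le_sum_of_mem hx)
  set N := nw M (tlist u n) * 2 ^ (ℓ + 1) with hN
  have hk : kcNum u n ℓ = (N + (2 ^ M - 1)) / 2 ^ M := rfl
  have hpos : 0 < 2 ^ M := by positivity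
  have e1 := Nat.div_add_mod (N + (2 ^ M - 1)) (2 ^ M)
  have e2 := Nat.mod_lt (N + (2 ^ M - 1)) hpos
  rw [← hk] at e1
  have e3 : N ≤ 2 ^ M * kcNum u n ℓ := by omega
  have e4 : 2 ^ M * kcNum u n ℓ < N + 2 ^ M := by omega
  have hNr : (N : ℝ) = 2 ^ M * (tm u n * 2 ^ (ℓ + 1)) := by
    rw [hN]; push_cast; rw [h1]; ring
  have p2 : (0:ℝ) < 2 ^ M := by positivity
  constructor
  · have : (N : ℝ) ≤ 2 ^ M * kcNum u n ℓ := by exact_mod_cast e3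
    rw [hNr] at this
    exact le_of_mul_le_mul_left this p2
  · have : (2 ^ M * kcNum u n ℓ : ℝ) < N + 2 ^ M := by exact_mod_cast e4
    rw [hNr] at this
    have h5 : (2:ℝ) ^ M * kcNum u n ℓ < 2 ^ M * (tm u n * 2 ^ (ℓ + 1) + 1) := by
      rw [mul_add]; simpa using this
    exact lt_of_mul_lt_mul_left h5 p2.le

/-- The code word of request `n`. -/
def kcCode (u : ℕ → Option (Str × ℕ)) (n : ℕ) : Option (Str × Str) :=
  (u n).map fun q => (bits (q.2 + 1) (kcNum u n q.2), q.1)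

theorem kcCode_pr {u : ℕ → Option (Str × ℕ)} (hu : Primrec u) : Primrec (kcCode u) := by
  have := tlist_pr hu
  unfold kcCode kcNum; fun_prop

theorem tm_succ (u : ℕ → Option (Str × ℕ)) (n : ℕ) : tm u (n + 1) = tm u n + rw' (u n) := by
  rw [tm_eq_sum, tm_eq_sum, Finset.sum_range_succ]

theorem kc_antichain {u : ℕ → Option (Str × ℕ)} (hB : ∀ T, tm u T ≤ 1) {n m : ℕ} {ρ₁ ρ₂ σ₁ σ₂ : Str}
    (hn : kcCode u n = Option.some (ρ₁, σ₁)) (hm : kcCode u m = Option.some (ρ₂, σ₂))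
    (h : ρ₁ <+: ρ₂) : n = m := by
  rcases hu : u n with _ | ⟨τ₁, ℓ₁⟩
  · simp [kcCode, hu] at hn
  rcases hu' : u m with _ | ⟨τ₂, ℓ₂⟩
  · simp [kcCode, hu'] at hm
  simp only [kcCode, hu, Option.map_some, Option.some.injEq, Prod.mk.injEq] at hn
  simp only [kcCode, hu', Option.map_some, Option.some.injEq, Prod.mk.injEq] at hm
  obtain ⟨rfl, -⟩ := hn
  obtain ⟨rfl, -⟩ := hm
  have hlen : ℓ₁ + 1 ≤ ℓ₂ + 1 := by simpa using h.length_le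
  have h2 := List.prefix_iff_eq_take.1 h
  rw [bits_length, bits_take hlen] at h2
  obtain ⟨a1, a2⟩ := kcNum_spec u n ℓ₁
  obtain ⟨b1, b2⟩ := kcNum_spec u m ℓ₂
  set v := kcNum u n ℓ₁
  set w := kcNum u m ℓ₂
  have c1 := hB (n + 1)
  have c2 := hB (m + 1)
  rw [tm_succ, hu] at c1
  rw [tm_succ, hu'] at c2
  simp only [rw', Option.elim] at c1 c2
  have key : ∀ (t : ℝ) (ℓ x : ℕ), (x : ℝ) < t * 2 ^ (ℓ + 1) + 1 → t * 2 ^ (ℓ + 1) ≤ x →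
      t + ((2:ℝ) ^ ℓ)⁻¹ ≤ 1 → x < 2 ^ (ℓ + 1) ∧ t ≤ x / 2 ^ (ℓ + 1) ∧
      ((x : ℝ) + 1) / 2 ^ (ℓ + 1) < t + ((2:ℝ) ^ ℓ)⁻¹ := by
    intro t ℓ x hx hx2 ht
    have p : (0:ℝ) < 2 ^ (ℓ + 1) := by positivity
    have p' : (0:ℝ) < 2 ^ ℓ := by positivity
    have h3 : ((x : ℝ) + 1) / 2 ^ (ℓ + 1) < t + ((2:ℝ) ^ ℓ)⁻¹ := by
      rw [div_lt_iff₀ p, add_mul]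
      have : ((2:ℝ) ^ ℓ)⁻¹ * 2 ^ (ℓ + 1) = 2 := by
        rw [pow_succ]; field_simp
      rw [this]; linarith
    refine ⟨?_, by rwa [le_div_iff₀ p], h3⟩
    have h4 : ((x : ℝ) + 1) / 2 ^ (ℓ + 1) < 1 := lt_of_lt_of_le h3 ht
    rw [div_lt_one p] at h4
    have : (x : ℝ) < ((2 ^ (ℓ + 1) : ℕ) : ℝ) := by push_cast; linarith
    exact_mod_cast this
  obtain ⟨d1, d2, d3⟩ := key _ _ _ a2 a1 c1
  obtain ⟨e1, e2, e3⟩ := key _ _ _ b2 b1 c2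
  set D := (ℓ₂ + 1) - (ℓ₁ + 1) with hD
  have hw : w / 2 ^ D < 2 ^ (ℓ₁ + 1) := by
    rw [Nat.div_lt_iff_lt_mul (by positivity), ← pow_add]
    have : ℓ₁ + 1 + D = ℓ₂ + 1 := by omega
    rwa [this]
  have hv := bits_inj d1 hw h2
  -- v * 2^D ≤ w < (v+1) * 2^D
  have f1 : v * 2 ^ D ≤ w := by rw [hv]; exact Nat.div_mul_le_self _ _
  have f2 : w + 1 ≤ (v + 1) * 2 ^ D := by
    have h5 := Nat.div_add_mod w (2 ^ D)
    have h6 := Nat.mod_lt w (show 0 < 2 ^ D by positivity)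
    rw [hv, add_mul, mul_comm]; linarith
  have pw : (2:ℝ) ^ (ℓ₂ + 1) = 2 ^ (ℓ₁ + 1) * 2 ^ D := by
    rw [← pow_add]; congr 1; omega
  have f1' : (v : ℝ) * 2 ^ D ≤ w := by exact_mod_cast f1
  have f2' : (w : ℝ) + 1 ≤ (v + 1) * 2 ^ D := by exact_mod_cast f2
  have p1 : (0:ℝ) < 2 ^ (ℓ₁ + 1) := by positivity
  have p2 : (0:ℝ) < 2 ^ D := by positivity
  have g1 : (v : ℝ) / 2 ^ (ℓ₁ + 1) ≤ w / 2 ^ (ℓ₂ + 1) := by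
    rw [pw, div_le_div_iff₀ p1 (by positivity)]; nlinarith
  have g2 : ((w : ℝ) + 1) / 2 ^ (ℓ₂ + 1) ≤ (v + 1) / 2 ^ (ℓ₁ + 1) := by
    rw [pw, div_le_div_iff₀ (by positivity) p1]; nlinarith
  have g3 : (w : ℝ) / 2 ^ (ℓ₂ + 1) < (w + 1) / 2 ^ (ℓ₂ + 1) := by
    apply div_lt_div_of_pos_right _ (by positivity); linarith
  have t1 : tm u (n + 1) = tm u n + ((2:ℝ) ^ ℓ₁)⁻¹ := by rw [tm_succ, hu]; rfl
  have t2 : tm u (m + 1) = tm u m + ((2:ℝ) ^ ℓ₂)⁻¹ := by rw [tm_succ, hu']; rfl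
  rcases lt_trichotomy n m with hlt | heq | hgt
  · have := tm_mono u (show n + 1 ≤ m from hlt)
    rw [t1] at this
    linarith
  · exact heq
  · have := tm_mono u (show m + 1 ≤ n from hgt)
    rw [t2] at this
    linarith

theorem KC_le_of_mem {M : Str →. Str} {ρ σ : Str} (h : σ ∈ M ρ) : KC M σ ≤ ρ.length :=
  iInf_le (fun ρ : {ρ : Str // σ ∈ M ρ} => ((ρ : Str).length : ℕ∞)) ⟨ρ, h⟩

/-- Partial computable functions by search through a primitive recursive enumeration of the graph. -/
theorem exists_search {g : ℕ → Option (Str × Str)} (hg : Primrec g)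
    (huniq : ∀ n m ρ σ τ, g n = Option.some (ρ, σ) → g m = Option.some (ρ, τ) → σ = τ) :
    ∃ M : Str →. Str, Partrec M ∧ (∀ ρ σ, σ ∈ M ρ ↔ ∃ n, g n = Option.some (ρ, σ)) := by
  let f : Str → ℕ → Option Str := fun ρ n => (g n).bind fun q =>
    bif decide (q.1 = ρ) then Option.some q.2 else Option.none
  have hf : Primrec (fun p : Str × ℕ => f p.1 p.2) := by
    simp only [f]; fun_prop
  have hf' : ∀ ρ n σ, f ρ n = Option.some σ ↔ g n = Option.some (ρ, σ) := by
    intro ρ n σ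
    rcases h : g n with _ | ⟨a, b⟩
    · simp [f, h]
    · by_cases h2 : a = ρ <;> simp [f, h, h2]
  have hf2 : Computable₂ f := Primrec.to_comp hf
  refine ⟨fun ρ => Nat.rfindOpt (f ρ), Partrec.rfindOpt hf2, ?_⟩
  intro ρ σ
  constructor
  · intro h
    obtain ⟨n, hn⟩ := Nat.rfindOpt_spec h
    exact ⟨n, (hf' _ _ _).1 hn⟩
  · rintro ⟨n, hn⟩
    have hd : (Nat.rfindOpt (f ρ)).Dom := Nat.rfindOpt_dom.2 ⟨n, σ, (hf' _ _ _).2 hn⟩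
    obtain ⟨m, hm⟩ := Nat.rfindOpt_spec (Part.get_mem hd)
    have := huniq _ _ _ _ _ ((hf' _ _ _).1 hm) hn
    rw [← this]
    exact Part.get_mem hd

theorem kraft_chaitin {U : Str →. Str} (hU : OptimalPF U) {u : ℕ → Option (Str × ℕ)} (hu : Primrec u)
    (hB : ∀ T, tm u T ≤ 1) :
    ∃ c : ℕ, ∀ i σ (ℓ : ℕ), u i = Option.some (σ, ℓ) → KC U σ ≤ ℓ + c := by
  obtain ⟨M, hM, hspec⟩ := exists_search (kcCode_pr hu) (by
    intro n m ρ σ τ hn hm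
    have := kc_antichain hB hn hm (List.prefix_refl _)
    subst this
    rw [hn] at hm
    simpa using hm)
  have hpf : PFMachine M := by
    refine ⟨hM, ?_⟩
    intro ρ₁ ρ₂ h1 h2 h
    obtain ⟨n, hn⟩ := (hspec _ _).1 (Part.get_mem h1)
    obtain ⟨m, hm⟩ := (hspec _ _).1 (Part.get_mem h2)
    have := kc_antichain hB hn hm h
    subst this
    rw [hn] at hm
    simp only [Option.some.injEq, Prod.mk.injEq] at hm
    exact hm.1
  obtain ⟨c, hc⟩ := hU.2 M hpf
  refine ⟨c + 1, ?_⟩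
  intro i σ ℓ hi
  have h1 : σ ∈ M (bits (ℓ + 1) (kcNum u i ℓ)) := (hspec _ _).2 ⟨i, by simp [kcCode, hi]⟩
  refine (hc σ).trans ?_
  have := KC_le_of_mem h1
  rw [bits_length] at this
  calc KC M σ + c ≤ ((ℓ + 1 : ℕ) : ℕ∞) + c := by gcongr
    _ = ℓ + ((c + 1 : ℕ) : ℕ∞) := by push_cast; ring

end PartP3

section PartP4
/-! ### Coding theorem -/

/-- grouped requests; index `pair T (pair j (code of σ))` -/
def grp (u : ℕ → Option (Str × ℕ)) (b : ℕ) (n : ℕ) : Option (Str × ℕ) :=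
  (Encodable.decode n.unpair.2.unpair.2 : Option Str).bind fun σ =>
    bif (lwle [n.unpair.2.unpair.1] (plist u (n.unpair.1 + 1) σ) &&
      !(lwle [n.unpair.2.unpair.1] (plist u n.unpair.1 σ))) &&
      decide (n.unpair.2.unpair.2 = Encodable.encode σ) then
      Option.some (σ, n.unpair.2.unpair.1 + b) else Option.none

theorem grp_pr {u : ℕ → Option (Str × ℕ)} (hu : Primrec u) (b : ℕ) : Primrec (grp u b) := by
  have := plist_pr hu
  unfold grp; fun_prop

theorem grp_some {u : ℕ → Option (Str × ℕ)} {b n : ℕ} {σ : Str} {ℓ : ℕ}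
    (h : grp u b n = Option.some (σ, ℓ)) :
    ∃ T j, n = Nat.pair T (Nat.pair j (Encodable.encode σ)) ∧ ℓ = j + b ∧
      ((2:ℝ) ^ j)⁻¹ ≤ pm u (T + 1) σ ∧ ¬ ((2:ℝ) ^ j)⁻¹ ≤ pm u T σ := by
  unfold grp at h
  rw [Option.bind_eq_some_iff] at h
  obtain ⟨τ, h1, h2⟩ := h
  rw [Bool.cond_eq_ite] at h2
  split_ifs at h2 with h3
  simp only [Option.some.injEq, Prod.mk.injEq] at h2
  obtain ⟨rfl, rfl⟩ := h2
  simp only [Bool.and_eq_true, Bool.not_eq_true', ← Bool.not_eq_true, lwle_iff, decide_eq_true_eq] at h3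
  refine ⟨n.unpair.1, n.unpair.2.unpair.1, ?_, rfl, ?_, ?_⟩
  · rw [← h3.2]; simp
  · simpa [pm] using h3.1.1
  · simpa [pm] using h3.1.2

theorem geom_le (J : Finset ℕ) (q : ℝ) (hq : 0 ≤ q) (h : ∀ j ∈ J, ((2:ℝ) ^ j)⁻¹ ≤ q) :
    ∑ j ∈ J, ((2:ℝ) ^ j)⁻¹ ≤ 2 * q := by
  rcases J.eq_empty_or_nonempty with rfl | hne
  · simpa using hq
  · set m := J.min' hne
    have h1 : ∀ N, ∑ j ∈ Finset.range N, ((2:ℝ) ^ (m + j))⁻¹ = 2 * ((2:ℝ) ^ m)⁻¹ - 2 * ((2:ℝ) ^ (m + N))⁻¹ := by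
      intro N
      induction N with
      | zero => simp
      | succ N ih => rw [Finset.sum_range_succ, ih, ← add_assoc, pow_succ]; field_simp; ring
    have h2 : J ⊆ (Finset.range (J.max' hne + 1)).image (fun j => m + j) := by
      intro j hj
      have a := J.min'_le j hj
      have b := J.le_max' j hj
      rw [Finset.mem_image]
      exact ⟨j - m, by simp; omega, by omega⟩
    calc ∑ j ∈ J, ((2:ℝ) ^ j)⁻¹
        ≤ ∑ j ∈ (Finset.range (J.max' hne + 1)).image (fun j => m + j), ((2:ℝ) ^ j)⁻¹ :=
          Finset.sum_le_sum_of_subset_of_nonneg h2 (fun _ _ _ => by positivity)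
      _ = ∑ j ∈ Finset.range (J.max' hne + 1), ((2:ℝ) ^ (m + j))⁻¹ := by
          rw [Finset.sum_image]; intro a _ b _ hab; simpa using hab
      _ ≤ 2 * ((2:ℝ) ^ m)⁻¹ := by
          rw [h1]; have : (0:ℝ) ≤ 2 * ((2:ℝ) ^ (m + (J.max' hne + 1)))⁻¹ := by positivity
          linarith
      _ ≤ 2 * q := by have := h m (J.min'_mem hne); linarith

theorem grp_mass {u : ℕ → Option (Str × ℕ)} {b : ℕ} (hB : ∀ T, 2 * tm u T ≤ 2 ^ b) (N : ℕ) :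
    tm (grp u b) N ≤ 1 := by
  set I := (Finset.range N).filter (fun n => (grp u b n).isSome)
  -- the map to (σ, j)
  let f : ℕ → Str × ℕ := fun n => ((grp u b n).getD ([], 0)).map (fun s => s) (fun ℓ => ℓ - b)
  have hf : ∀ n ∈ I, ∃ T j σ, n = Nat.pair T (Nat.pair j (Encodable.encode σ)) ∧
      grp u b n = Option.some (σ, j + b) ∧ f n = (σ, j) ∧
      ((2:ℝ) ^ j)⁻¹ ≤ pm u (T + 1) σ ∧ ¬ ((2:ℝ) ^ j)⁻¹ ≤ pm u T σ := by
    intro n hn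
    obtain ⟨⟨σ, ℓ⟩, hq⟩ := Option.isSome_iff_exists.1 (Finset.mem_filter.1 hn).2
    obtain ⟨T, j, h1, rfl, h2, h3⟩ := grp_some hq
    exact ⟨T, j, σ, h1, hq, by simp [f, hq], h2, h3⟩
  have hinj : Set.InjOn f I := by
    intro n hn m hm hnm
    obtain ⟨T, j, σ, h1, -, h2, h3, h4⟩ := hf n hn
    obtain ⟨T', j', σ', h1', -, h2', h3', h4'⟩ := hf m hm
    rw [h2, h2'] at hnm
    simp only [Prod.mk.injEq] at hnm
    obtain ⟨rfl, rfl⟩ := hnm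
    have : T = T' := by
      rcases lt_trichotomy T T' with h | h | h
      · exact absurd (h3.trans (pm_mono u h σ)) h4'
      · exact h
      · exact absurd (h3'.trans (pm_mono u h σ)) h4
    rw [h1, h1', this]
  have e1 : tm (grp u b) N = ∑ n ∈ I, ((2:ℝ) ^ b)⁻¹ * ((2:ℝ) ^ (f n).2)⁻¹ := by
    rw [tm_eq_sum, Finset.sum_filter]
    refine Finset.sum_congr rfl fun n hn => ?_
    by_cases h : (grp u b n).isSome
    · rw [if_pos h]
      obtain ⟨T, j, σ, h1, h2, h3, -⟩ := hf n (by simp only [I, Finset.mem_filter]; exact ⟨hn, h⟩)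
      rw [h2, h3]
      simp only [rw', Option.elim, pow_add, mul_inv]; ring
    · rw [if_neg h]
      simp only [Bool.not_eq_true, Option.isSome_eq_false_iff, Option.isNone_iff_eq_none] at h
      simp [rw', h]
  have e2 : ∑ n ∈ I, ((2:ℝ) ^ (f n).2)⁻¹ = ∑ p ∈ I.image f, ((2:ℝ) ^ p.2)⁻¹ := by
    rw [Finset.sum_image hinj]
  have hN : ∀ n ∈ I, ∀ T j x, n = Nat.pair T (Nat.pair j x) → T < N := by
    intro n hn T j x h
    have := Finset.mem_range.1 (Finset.mem_filter.1 hn).1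
    have := Nat.left_le_pair T (Nat.pair j x)
    omega
  have e3 : ∑ p ∈ I.image f, ((2:ℝ) ^ p.2)⁻¹ ≤ ∑ σ ∈ (I.image f).image Prod.fst, 2 * pm u N σ := by
    rw [← Finset.sum_fiberwise_of_maps_to (t := (I.image f).image Prod.fst) (g := Prod.fst)
      (fun x hx => Finset.mem_image_of_mem _ hx)]
    refine Finset.sum_le_sum fun σ _ => ?_
    set S := (I.image f).filter (fun p => p.1 = σ)
    have e4 : ∑ p ∈ S, ((2:ℝ) ^ p.2)⁻¹ = ∑ j ∈ S.image Prod.snd, ((2:ℝ) ^ j)⁻¹ := by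
      rw [Finset.sum_image]
      intro x hx y hy hxy
      have h1 := (Finset.mem_filter.1 hx).2
      have h2 := (Finset.mem_filter.1 hy).2
      exact Prod.ext (h1.trans h2.symm) hxy
    rw [e4]
    apply geom_le _ _ (pm_nonneg _ _ _)
    intro j hj
    obtain ⟨p, hp, rfl⟩ := Finset.mem_image.1 hj
    obtain ⟨hp1, hp2⟩ := Finset.mem_filter.1 hp
    obtain ⟨n, hn, rfl⟩ := Finset.mem_image.1 hp1
    obtain ⟨T, j, σ', h1, -, h2, h3, h4⟩ := hf n hn
    rw [h2] at hp2 ⊢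
    simp only at hp2
    subst hp2
    exact h3.trans (pm_mono u (hN n hn T _ _ h1) _)
  have e5 : ∑ σ ∈ (I.image f).image Prod.fst, 2 * pm u N σ ≤ 2 * tm u N := by
    rw [← Finset.mul_sum]
    have := sum_pm_le_tm u N ((I.image f).image Prod.fst)
    linarith
  rw [e1, ← Finset.mul_sum, e2]
  have p : (0:ℝ) < 2 ^ b := by positivity
  rw [inv_mul_le_iff₀ p, mul_one]
  exact e3.trans (e5.trans (hB N))

theorem coding {U : Str →. Str} (hU : OptimalPF U) {u : ℕ → Option (Str × ℕ)} (hu : Primrec u)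
    (B : ℕ) (hB : ∀ T, tm u T ≤ B) :
    ∃ c : ℕ, ∀ σ T (k : ℕ), ((2:ℝ) ^ k)⁻¹ ≤ pm u T σ → KC U σ ≤ k + c := by
  have hb : ∀ T, 2 * tm u T ≤ 2 ^ (B + 1) := by
    intro T
    have h1 := hB T
    have h2 : (B : ℝ) ≤ 2 ^ B := by exact_mod_cast (Nat.lt_two_pow_self (n := B)).le
    rw [pow_succ]; linarith
  obtain ⟨c, hc⟩ := kraft_chaitin hU (grp_pr hu (B + 1)) (grp_mass hb)
  refine ⟨B + 1 + c, ?_⟩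
  intro σ T k hk
  have hex : ∃ T, ((2:ℝ) ^ k)⁻¹ ≤ pm u T σ := ⟨T, hk⟩
  have h1 := Nat.find_spec hex
  set T0 := Nat.find hex with hT0
  have h0 : T0 ≠ 0 := by
    intro h; rw [h] at h1
    simp only [pm_eq_sum, Finset.range_zero, Finset.sum_empty] at h1
    have : (0:ℝ) < ((2:ℝ) ^ k)⁻¹ := by positivity
    linarith
  obtain ⟨T1, hT1⟩ := Nat.exists_eq_succ_of_ne_zero h0
  have h2 : ¬ ((2:ℝ) ^ k)⁻¹ ≤ pm u T1 σ := Nat.find_min hex (by omega)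
  rw [hT1] at h1
  have := hc (Nat.pair T1 (Nat.pair k (Encodable.encode σ))) σ (k + (B + 1)) (by
    unfold grp
    simp only [Nat.unpair_pair, Encodable.encodek, Option.bind_some]
    have a1 : lwle [k] (plist u (T1 + 1) σ) = true := (lwle_iff _ _).2 (by simpa [pm] using h1)
    have a2 : lwle [k] (plist u T1 σ) = false := by
      rw [← Bool.not_eq_true, lwle_iff]; simpa [pm] using h2
    simp [a1, a2])
  refine this.trans (le_of_eq ?_)
  push_cast; ring

end PartP4

section PartP5
/-! ### Enumerating machines and c.e. sets -/

theorem events {M : Str →. Str} (hM : Partrec M) :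
    ∃ (ev : ℕ → Option (Str × ℕ)) (d : ℕ → Str), Primrec ev ∧
      (∀ i σ ℓ, ev i = Option.some (σ, ℓ) → (d i).length = ℓ ∧ σ ∈ M (d i) ∧ σ.length ≤ i) ∧
      (∀ ρ σ, σ ∈ M ρ → ∃ i, ev i = Option.some (σ, ρ.length)) ∧
      (∀ i j, (ev i).isSome → (ev j).isSome → d i = d j → i = j) := by
  obtain ⟨c, hc⟩ := Nat.Partrec.Code.exists_code.1 hM
  have hc' : ∀ ρ : Str, c.eval (Encodable.encode ρ) = (M ρ).map Encodable.encode := by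
    intro ρ; rw [hc]; simp
  let ev : ℕ → Option (Str × ℕ) := fun i =>
    (Encodable.decode i.unpair.1 : Option Str).bind fun ρ =>
      (Encodable.decode i.unpair.2.unpair.2 : Option Str).bind fun σ =>
        bif decide (c.evaln (i.unpair.2.unpair.1 + 1) (Encodable.encode ρ) =
            Option.some (Encodable.encode σ)) &&
          (decide (c.evaln i.unpair.2.unpair.1 (Encodable.encode ρ) = Option.none) &&
          (decide (i.unpair.1 = Encodable.encode ρ) &&
            decide (i.unpair.2.unpair.2 = Encodable.encode σ)))
        then Option.some (σ, ρ.length) else Option.none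
  let d : ℕ → Str := fun i => ((Encodable.decode i.unpair.1 : Option Str)).getD []
  have hev : ∀ i σ ℓ, ev i = Option.some (σ, ℓ) → ∃ ρ k, i = Nat.pair (Encodable.encode ρ)
      (Nat.pair k (Encodable.encode σ)) ∧ d i = ρ ∧ ρ.length = ℓ ∧
      c.evaln (k + 1) (Encodable.encode ρ) = Option.some (Encodable.encode σ) ∧
      c.evaln k (Encodable.encode ρ) = Option.none := by
    intro i σ ℓ h
    simp only [ev] at h
    rw [Option.bind_eq_some_iff] at h
    obtain ⟨ρ, h1, h⟩ := h
    rw [Option.bind_eq_some_iff] at h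
    obtain ⟨τ, h2, h⟩ := h
    rw [Bool.cond_eq_ite] at h
    split_ifs at h with h3
    simp only [Bool.and_eq_true, decide_eq_true_eq] at h3
    simp only [Option.some.injEq, Prod.mk.injEq] at h
    obtain ⟨rfl, rfl⟩ := h
    refine ⟨ρ, i.unpair.2.unpair.1, ?_, ?_, rfl, h3.1, h3.2.1⟩
    · rw [← h3.2.2.1, ← h3.2.2.2]; simp
    · simp [d, h1]
  refine ⟨ev, d, ?_, ?_, ?_, ?_⟩
  · simp only [ev]; fun_prop
  · intro i σ ℓ h
    obtain ⟨ρ, k, h1, h2, h3, h4, h5⟩ := hev i σ ℓ h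
    refine ⟨by rw [h2, h3], ?_, ?_⟩
    · rw [h2]
      have := Nat.Partrec.Code.evaln_sound (c := c) (k := k + 1) (Option.mem_def.2 h4)
      rw [hc'] at this
      obtain ⟨τ, t1, t2⟩ := (Part.mem_map_iff _).1 this
      rwa [← Encodable.encode_injective t2]
    · have a1 := Encodable.length_le_encode σ
      have a2 := Nat.right_le_pair k (Encodable.encode σ)
      have a3 := Nat.right_le_pair (Encodable.encode ρ) (Nat.pair k (Encodable.encode σ))
      omega
  · intro ρ σ h
    have h1 : Encodable.encode σ ∈ c.eval (Encodable.encode ρ) := by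
      rw [hc']; exact Part.mem_map _ h
    rw [Nat.Partrec.Code.evaln_complete] at h1
    have h2 := Nat.find_spec h1
    set k := Nat.find h1 with hk
    have h0 : k ≠ 0 := by
      intro h; rw [h] at h2; simp [Nat.Partrec.Code.evaln] at h2
    obtain ⟨k', hk'⟩ := Nat.exists_eq_succ_of_ne_zero h0
    have h3 : c.evaln k' (Encodable.encode ρ) = Option.none := by
      rcases h : c.evaln k' (Encodable.encode ρ) with _ | x
      · rfl
      · exfalso
        have h4 := Nat.Partrec.Code.evaln_mono (show k' ≤ k by omega) (Option.mem_def.2 h)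
        have h5 : x = Encodable.encode σ := Option.mem_unique h4 h2
        exact Nat.find_min h1 (show k' < k by omega) (by rw [h5] at h; exact h)
    rw [hk'] at h2
    refine ⟨Nat.pair (Encodable.encode ρ) (Nat.pair k' (Encodable.encode σ)), ?_⟩
    simp only [ev, Nat.unpair_pair, Encodable.encodek, Option.bind_some]
    have h2' : c.evaln (k' + 1) (Encodable.encode ρ) = Option.some (Encodable.encode σ) := h2
    simp [h2', h3]
  · intro i j hi hj hij
    obtain ⟨⟨σ, ℓ⟩, hi⟩ := Option.isSome_iff_exists.1 hi
    obtain ⟨⟨σ', ℓ'⟩, hj⟩ := Option.isSome_iff_exists.1 hj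
    obtain ⟨ρ, k, h1, h2, h3, h4, h5⟩ := hev i σ ℓ hi
    obtain ⟨ρ', k', h1', h2', h3', h4', h5'⟩ := hev j σ' ℓ' hj
    have e : ρ = ρ' := by rw [← h2, ← h2', hij]
    subst e
    have ek : k = k' := by
      rcases lt_trichotomy k k' with h | h | h
      · have := Nat.Partrec.Code.evaln_mono (show k + 1 ≤ k' from h) (Option.mem_def.2 h4)
        rw [h5'] at this; simp at this
      · exact h
      · have := Nat.Partrec.Code.evaln_mono (show k' + 1 ≤ k from h) (Option.mem_def.2 h4')
        rw [h5] at this; simp at this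
    subst ek
    rw [h4] at h4'
    have es : Encodable.encode σ = Encodable.encode σ' := by simpa using h4'
    rw [h1, h1', es]

theorem prefix_free_ud {S : Set Str} (h : ∀ x ∈ S, ∀ y ∈ S, x <+: y → x = y) (h0 : [] ∉ S) :
    InformationTheory.UniquelyDecodable S := by
  intro L₁
  induction L₁ with
  | nil =>
    intro L₂ _ h2 h3
    cases L₂ with
    | nil => rfl
    | cons a l =>
      exfalso
      have : a = [] := by
        have := h3.symm; simp at this; exact this.1
      exact h0 (this ▸ h2 a (by simp))
  | cons a l ih =>
    intro L₂ h1 h2 h3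
    cases L₂ with
    | nil =>
      exfalso
      have : a = [] := by simp at h3; exact h3.1
      exact h0 (this ▸ h1 a (by simp))
    | cons b m =>
      simp only [List.flatten_cons] at h3
      have hab : a = b := by
        rcases le_total a.length b.length with hle | hle
        · exact h a (h1 a (by simp)) b (h2 b (by simp))
            (List.prefix_of_prefix_length_le (List.prefix_append a l.flatten)
              (h3 ▸ List.prefix_append b m.flatten) hle)
        · exact (h b (h2 b (by simp)) a (h1 a (by simp))
            (List.prefix_of_prefix_length_le (List.prefix_append b m.flatten)
              (h3 ▸ List.prefix_append a l.flatten) hle)).symm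
      subst hab
      rw [ih m (fun w hw => h1 w (by simp [hw])) (fun w hw => h2 w (by simp [hw]))
        (List.append_cancel_left h3)]

theorem kraft_pf {S : Finset Str} (h : ∀ x ∈ S, ∀ y ∈ S, x <+: y → x = y) :
    ∑ ρ ∈ S, ((2:ℝ) ^ ρ.length)⁻¹ ≤ 1 := by
  by_cases h0 : [] ∈ S
  · have : S = {[]} := by
      ext x
      simp only [Finset.mem_singleton]
      exact ⟨fun hx => (h [] h0 x hx ⟨x, List.nil_append x⟩).symm, fun hx => hx ▸ h0⟩
    rw [this]; simp
  · have := InformationTheory.kraft_mcmillan_inequality (S := S)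
      (prefix_free_ud (S := (S : Set Str)) (fun x hx y hy => h x hx y hy) (by simpa using h0))
    simpa using this

theorem events_pf {U : Str →. Str} (hU : PFMachine U) :
    ∃ ev : ℕ → Option (Str × ℕ), Primrec ev ∧
      (∀ i σ ℓ, ev i = Option.some (σ, ℓ) → KC U σ ≤ ℓ ∧ σ.length ≤ i) ∧
      (∀ ρ σ, σ ∈ U ρ → ∃ i, ev i = Option.some (σ, ρ.length)) ∧
      ∀ T, tm ev T ≤ 1 := by
  obtain ⟨ev, d, h1, h2, h3, h4⟩ := events hU.1
  refine ⟨ev, h1, ?_, h3, ?_⟩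
  · intro i σ ℓ h
    obtain ⟨a, b, c⟩ := h2 i σ ℓ h
    exact ⟨a ▸ KC_le_of_mem b, c⟩
  · intro T
    rw [tm_eq_sum]
    set I := (Finset.range T).filter (fun i => (ev i).isSome)
    have e1 : ∑ i ∈ Finset.range T, rw' (ev i) = ∑ i ∈ I, ((2:ℝ) ^ (d i).length)⁻¹ := by
      rw [Finset.sum_filter]
      refine Finset.sum_congr rfl fun i _ => ?_
      rcases h : ev i with _ | ⟨σ, ℓ⟩
      · simp [rw']
      · simp [rw', (h2 i σ ℓ h).1]
    have e2 : ∑ i ∈ I, ((2:ℝ) ^ (d i).length)⁻¹ = ∑ ρ ∈ I.image d, ((2:ℝ) ^ ρ.length)⁻¹ := by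
      rw [Finset.sum_image]
      intro i hi j hj hij
      exact h4 i j (Finset.mem_filter.1 hi).2 (Finset.mem_filter.1 hj).2 hij
    rw [e1, e2]
    apply kraft_pf
    have hd : ∀ x ∈ I.image d, (U x).Dom := by
      intro x hx
      obtain ⟨i, hi, rfl⟩ := Finset.mem_image.1 hx
      obtain ⟨⟨σ, ℓ⟩, hq⟩ := Option.isSome_iff_exists.1 (Finset.mem_filter.1 hi).2
      exact Part.dom_iff_mem.2 ⟨σ, (h2 i σ ℓ hq).2.1⟩
    intro x hx y hy hxy
    exact hU.2 x y (hd x hx) (hd y hy) hxy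

theorem KC_le_iff {M : Str →. Str} {σ : Str} {k : ℕ} :
    KC M σ ≤ k ↔ ∃ ρ, σ ∈ M ρ ∧ ρ.length ≤ k := by
  constructor
  · intro h
    by_contra hc
    push Not at hc
    have : ((k + 1 : ℕ) : ℕ∞) ≤ KC M σ := by
      refine le_iInf fun ρ => ?_
      exact_mod_cast hc ρ.1 ρ.2
    have := this.trans h
    have : k + 1 ≤ k := by exact_mod_cast this
    omega
  · rintro ⟨ρ, h1, h2⟩
    exact (KC_le_of_mem h1).trans (by exact_mod_cast h2)

theorem le_add_of_forall {a b : ℕ∞} {c : ℕ} (h : ∀ k : ℕ, a ≤ k → b ≤ k + c) : b ≤ a + c := by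
  cases a with
  | top => simp
  | coe k => exact h k le_rfl

theorem KC_pf_finite {U : Str →. Str} (hU : OptimalPF U) (σ : Str) : ∃ k : ℕ, KC U σ = k := by
  let u : ℕ → Option (Str × ℕ) := fun i => bif decide (i = 0) then Option.some (σ, 0) else Option.none
  have hu : Primrec u := by simp only [u]; fun_prop
  obtain ⟨c, hc⟩ := kraft_chaitin hU hu (by
    intro T
    rw [tm_eq_sum]
    calc ∑ i ∈ Finset.range T, rw' (u i) ≤ ∑ i ∈ Finset.range T, (if i = 0 then (1:ℝ) else 0) := by
          refine Finset.sum_le_sum fun i _ => ?_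
          by_cases h : i = 0 <;> simp [u, h, rw']
      _ ≤ 1 := by rw [Finset.sum_ite_eq']; split_ifs <;> norm_num)
  have := hc 0 σ 0 rfl
  have h2 : KC U σ ≠ ⊤ := by
    intro h; rw [h] at this
    have h3 := top_le_iff.1 this
    have : ((0 + c : ℕ) : ℕ∞) = ⊤ := by push_cast; exact_mod_cast h3
    exact ENat.natCast_ne_top _ this
  obtain ⟨k, hk⟩ := ENat.ne_top_iff_exists.1 h2
  exact ⟨k, hk.symm⟩

/-! c.e. sets -/

theorem ce_enum {A : Set ℕ} (h : CESet A) : ∃ a : ℕ → ℕ → Bool,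
    Primrec (fun p : ℕ × ℕ => a p.1 p.2) ∧ (∀ s t x, s ≤ t → a s x = true → a t x = true) ∧
    (∀ x, x ∈ A ↔ ∃ s, a s x = true) := by
  obtain ⟨f, hf, hA⟩ := h
  obtain ⟨c, hc⟩ := Nat.Partrec.Code.exists_code.1 hf
  refine ⟨fun s x => (c.evaln s x).isSome, by fun_prop, ?_, ?_⟩
  · intro s t x hst h
    obtain ⟨y, hy⟩ := Option.isSome_iff_exists.1 h
    have := Nat.Partrec.Code.evaln_mono hst (Option.mem_def.2 hy)
    rw [Option.isSome_iff_exists]; exact ⟨y, this⟩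
  · intro x
    rw [hA, ← hc, Part.dom_iff_mem]
    constructor
    · rintro ⟨y, hy⟩
      obtain ⟨k, hk⟩ := Nat.Partrec.Code.evaln_complete.1 hy
      exact ⟨k, Option.isSome_iff_exists.2 ⟨y, hk⟩⟩
    · rintro ⟨k, hk⟩
      obtain ⟨y, hy⟩ := Option.isSome_iff_exists.1 hk
      exact ⟨y, Nat.Partrec.Code.evaln_sound (Option.mem_def.2 hy)⟩

theorem ce_of_enum {a : ℕ → ℕ → Bool} (h : Primrec (fun p : ℕ × ℕ => a p.1 p.2)) :
    CESet {x | ∃ s, a s x = true} := by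
  let f : ℕ → ℕ → Option ℕ := fun x s => bif a s x then Option.some 0 else Option.none
  have hf : Primrec (fun p : ℕ × ℕ => f p.1 p.2) := by simp only [f]; fun_prop
  have hf2 : Computable₂ f := Primrec.to_comp hf
  refine ⟨fun x => Nat.rfindOpt (f x), Partrec.nat_iff.1 (Partrec.rfindOpt hf2), ?_⟩
  intro x
  rw [Nat.rfindOpt_dom]
  constructor
  · rintro ⟨s, hs⟩
    exact ⟨s, 0, by simp [f, hs]⟩
  · rintro ⟨s, y, hs⟩
    refine ⟨s, ?_⟩
    by_contra h
    rw [Bool.not_eq_true] at h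
    simp [f, h] at hs

/-- initial segment of a Boolean sequence -/
def rs (a : ℕ → Bool) (n : ℕ) : Str := (List.range n).map a

@[simp] theorem rs_length (a n) : (rs a n).length = n := by simp [rs]
theorem rs_eq_iff {a b : ℕ → Bool} {n : ℕ} : rs a n = rs b n ↔ ∀ x < n, a x = b x := by
  simp [rs]
theorem rs_pr {a : ℕ → ℕ → Bool} (h : Primrec (fun p : ℕ × ℕ => a p.1 p.2)) :
    Primrec (fun p : ℕ × ℕ => rs (a p.1) p.2) := by unfold rs; fun_prop
theorem restrSet_eq_rs (A : Set ℕ) (n : ℕ) : restrSet A n = rs (fun i => decide (i ∈ A)) n := rfl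

theorem exists_stage {A : Set ℕ} {a : ℕ → ℕ → Bool} (hm : ∀ s t x, s ≤ t → a s x = true → a t x = true)
    (hA : ∀ x, x ∈ A ↔ ∃ s, a s x = true) (n : ℕ) :
    ∃ s, ∀ t, s ≤ t → ∀ x < n, a t x = decide (x ∈ A) := by
  induction n with
  | zero => exact ⟨0, by simp⟩
  | succ n ih =>
    obtain ⟨s, hs⟩ := ih
    by_cases h : n ∈ A
    · obtain ⟨s', hs'⟩ := (hA n).1 h
      refine ⟨max s s', fun t ht x hx => ?_⟩
      rcases Nat.lt_succ_iff_lt_or_eq.1 hx with hx | rfl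
      · exact hs t (le_trans (le_max_left _ _) ht) x hx
      · simp only [h, decide_true]; exact hm _ _ _ (le_trans (le_max_right _ _) ht) hs'
    · refine ⟨s, fun t ht x hx => ?_⟩
      rcases Nat.lt_succ_iff_lt_or_eq.1 hx with hx | rfl
      · exact hs t ht x hx
      · simp only [h, decide_false]
        rw [← Bool.not_eq_true]
        exact fun hc => h ((hA _).2 ⟨t, hc⟩)

end PartP5

section PartK1
/-! ### Part K : the construction -/

/-- `(start, end, goal, type, string)` -/
abbrev Batch := ℕ × ℕ × ℕ × Bool × Str
/-- `(start, goal, number of acts, received batches)` -/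
abbrev Frame := ℕ × ℕ × ℕ × List Batch
/-- `(returning?, labels, stack)` -/
abbrev Run := Bool × List (ℕ × ℕ) × List Frame

section Kconstr
variable (ev : ℕ → Option (Str × ℕ)) (a : Bool → ℕ → ℕ → Bool)

def ars (b : Bool) (T y : ℕ) : Str := rs (a b T) y

/-- is `σ` an initial segment of the `b`-set at stage `T` -/
def live (b : Bool) (σ : Str) (T : ℕ) : Bool := decide (σ = ars a b T σ.length)

/-- live mass above `s` -/
def clist (b : Bool) (s T : ℕ) : List ℕ :=
  (List.range T).filterMap fun i => (ev i).bind fun q =>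
    bif decide (s < q.1.length) && live a b q.1 T then Option.some q.2 else Option.none

def wlist (labels : List (ℕ × ℕ)) (s : ℕ) : List ℕ :=
  labels.filterMap fun q => bif decide (s < q.1) then Option.some q.2 else Option.none

def upl (recv : List Batch) (T : ℕ) : List ℕ :=
  recv.filterMap fun B => bif live a B.2.2.2.1 B.2.2.2.2 T then Option.none else Option.some B.2.2.1

def filll (b : Bool) (recv : List Batch) (T y : ℕ) : List ℕ :=
  recv.filterMap fun B => bif decide (B.2.2.2.1 = b) && decide (B.2.2.2.2 = ars a b T y) then
    Option.some B.2.2.1 else Option.none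

def thr (bb T y : ℕ) : List ℕ := (plist ev T (zeroStr y) ++ [y]).map (· + bb)

def unf (bb : ℕ) (b : Bool) (recv : List Batch) (T y : ℕ) : Bool :=
  !(lwle (thr ev bb T y) (filll a b recv T y))

def yb (bb : ℕ) (b : Bool) (recv : List Batch) (T : ℕ) : ℕ :=
  ((List.range (recv.length + 1)).find? fun y => unf ev a bb b recv T y).getD recv.length

def Nn (e : ℕ) : ℕ := 2 ^ (2 * e + 4)
def bg (e goal : ℕ) : ℕ := goal + Nn e + 4

def xf (X : List ℕ) (x : ℕ) : Bool := decide (x ∈ X)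

def resp (e T : ℕ) (X : List ℕ) (labels : List (ℕ × ℕ)) (s : ℕ) : Bool :=
  labels.all fun q => !(decide (s < q.1)) ||
    lwle [q.2 + 2 * e] (plist ev T (rs (xf X) q.1))

def actq (e T : ℕ) (labels : List (ℕ × ℕ)) (s : ℕ) : Bool :=
  !(lwle ((wlist labels s).map (· + 2 * e)) (clist ev a true s T ++ clist ev a false s T))

def popt (s T : ℕ) : Bool := lwle (clist ev a false s T) (clist ev a true s T)

def popB (e T : ℕ) (F G : Frame) : Batch :=
  (F.1, T, F.2.1, popt ev a F.1 T, ars a (popt ev a F.1 T) T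
    (yb ev a (bg e G.2.1) (popt ev a F.1 T) G.2.2.2 T))

def pushg (e T : ℕ) (F : Frame) : ℕ :=
  yb ev a (bg e F.2.1) true F.2.2.2 T + yb ev a (bg e F.2.1) false F.2.2.2 T + bg e F.2.1

def pushs (e T : ℕ) (F : Frame) : ℕ := 2 ^ (Nat.pair e (T + 2 * e + pushg ev a e T F + 1))

def stepRet (e T : ℕ) (X : List ℕ) (labels : List (ℕ × ℕ)) (F : Frame) (rest : List Frame) :
    ℕ × List ℕ × Run :=
  bif resp ev e T X labels F.1 then
    bif actq ev a e T labels F.1 then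
      (T + 1, (F.1 + F.2.2.1) :: X, (true, labels, (F.1, F.2.1, F.2.2.1 + 1, F.2.2.2) :: rest))
    else rest.head?.elim (T + 1, X, (true, labels, F :: rest)) fun G =>
      (T + 1, X, (false, labels,
        (G.1, G.2.1, G.2.2.1, popB ev a e T F G :: G.2.2.2) :: rest.tail))
  else (T + 1, X, (true, labels, F :: rest))

def stepWork (e T : ℕ) (X : List ℕ) (labels : List (ℕ × ℕ)) (F : Frame) (rest : List Frame) :
    ℕ × List ℕ × Run :=
  bif decide (rest.length = Nn e) then (T + 1, X, (true, (T, F.2.1) :: labels, F :: rest))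
  else bif lwle [F.2.1] (upl a F.2.2.2 T) then (T + 1, X, (true, labels, F :: rest))
  else (2 * pushs ev a e T F + 1, X, (false, labels,
    (pushs ev a e T F, pushg ev a e T F, 0, []) :: F :: rest))

def step (e T : ℕ) (X : List ℕ) (r : Run) : ℕ × List ℕ × Run :=
  r.2.2.head?.elim (T + 1, X, r) fun F =>
    bif r.1 then stepRet ev a e T X r.2.1 F r.2.2.tail
    else stepWork ev a e T X r.2.1 F r.2.2.tail

abbrev GState := ℕ × List ℕ × List (ℕ × Run)

def initRun : Run := (false, [], [(0, 0, 0, [])])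

def lookupR (R : List (ℕ × Run)) (e : ℕ) : Run :=
  ((R.find? fun p => decide (p.1 = e)).map fun p => p.2).getD initRun

def gstep (n : ℕ) (g : GState) : GState :=
  let q := step ev a n.unpair.1 g.1 g.2.1 (lookupR g.2.2 n.unpair.1)
  (q.1, q.2.1, (n.unpair.1, q.2.2) :: g.2.2)

def gst (n : ℕ) : GState := Nat.rec (motive := fun _ => GState) (1, [], []) (fun n g => gstep ev a n g) n

variable {ev a}

@[fun_prop] theorem zeroStr_pr : Primrec zeroStr := by unfold zeroStr; fun_prop
@[fun_prop] theorem Nn_pr : Primrec Nn := by unfold Nn; fun_prop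
@[fun_prop] theorem bg_pr : Primrec (fun p : ℕ × ℕ => bg p.1 p.2) := by unfold bg; fun_prop
@[fun_prop] theorem xf_pr : Primrec (fun p : List ℕ × ℕ => xf p.1 p.2) := by unfold xf; fun_prop
@[fun_prop] theorem wlist_pr : Primrec (fun p : List (ℕ × ℕ) × ℕ => wlist p.1 p.2) := by
  unfold wlist; fun_prop
@[fun_prop] theorem lookupR_pr : Primrec (fun p : List (ℕ × Run) × ℕ => lookupR p.1 p.2) := by
  unfold lookupR; fun_prop
theorem ars_pr (ha : Primrec (fun p : Bool × ℕ × ℕ => a p.1 p.2.1 p.2.2)) :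
    Primrec (fun p : Bool × ℕ × ℕ => ars a p.1 p.2.1 p.2.2) := by
  unfold ars rs; fun_prop
theorem live_pr (ha : Primrec (fun p : Bool × ℕ × ℕ => a p.1 p.2.1 p.2.2)) :
    Primrec (fun p : Bool × Str × ℕ => live a p.1 p.2.1 p.2.2) := by
  have := ars_pr ha
  unfold live; fun_prop
theorem clist_pr (hev : Primrec ev) (ha : Primrec (fun p : Bool × ℕ × ℕ => a p.1 p.2.1 p.2.2)) :
    Primrec (fun p : Bool × ℕ × ℕ => clist ev a p.1 p.2.1 p.2.2) := by
  have := live_pr ha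
  unfold clist; fun_prop
theorem upl_pr (ha : Primrec (fun p : Bool × ℕ × ℕ => a p.1 p.2.1 p.2.2)) :
    Primrec (fun p : List Batch × ℕ => upl a p.1 p.2) := by
  have h0 := live_pr ha
  unfold upl; fun_prop
theorem filll_pr (ha : Primrec (fun p : Bool × ℕ × ℕ => a p.1 p.2.1 p.2.2)) :
    Primrec (fun p : Bool × List Batch × ℕ × ℕ => filll a p.1 p.2.1 p.2.2.1 p.2.2.2) := by
  have h0 := ars_pr ha
  unfold filll; fun_prop
theorem thr_pr (hev : Primrec ev) :
    Primrec (fun p : ℕ × ℕ × ℕ => thr ev p.1 p.2.1 p.2.2) := by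
  have h0 := plist_pr hev
  unfold thr; fun_prop
theorem unf_pr (hev : Primrec ev) (ha : Primrec (fun p : Bool × ℕ × ℕ => a p.1 p.2.1 p.2.2)) :
    Primrec (fun p : ℕ × Bool × List Batch × ℕ × ℕ => unf ev a p.1 p.2.1 p.2.2.1 p.2.2.2.1 p.2.2.2.2) := by
  have h0 := thr_pr hev
  have h1 := filll_pr ha
  unfold unf; fun_prop
theorem yb_pr (hev : Primrec ev) (ha : Primrec (fun p : Bool × ℕ × ℕ => a p.1 p.2.1 p.2.2)) :
    Primrec (fun p : ℕ × Bool × List Batch × ℕ => yb ev a p.1 p.2.1 p.2.2.1 p.2.2.2) := by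
  have h0 := unf_pr hev ha
  unfold yb; fun_prop
theorem resp_pr (hev : Primrec ev) :
    Primrec (fun p : ℕ × ℕ × List ℕ × List (ℕ × ℕ) × ℕ => resp ev p.1 p.2.1 p.2.2.1 p.2.2.2.1 p.2.2.2.2) := by
  have h0 := plist_pr hev
  unfold resp rs; fun_prop
theorem actq_pr (hev : Primrec ev) (ha : Primrec (fun p : Bool × ℕ × ℕ => a p.1 p.2.1 p.2.2)) :
    Primrec (fun p : ℕ × ℕ × List (ℕ × ℕ) × ℕ => actq ev a p.1 p.2.1 p.2.2.1 p.2.2.2) := by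
  have h0 := clist_pr hev ha
  unfold actq; fun_prop
theorem popt_pr (hev : Primrec ev) (ha : Primrec (fun p : Bool × ℕ × ℕ => a p.1 p.2.1 p.2.2)) :
    Primrec (fun p : ℕ × ℕ => popt ev a p.1 p.2) := by
  have h0 := clist_pr hev ha
  unfold popt; fun_prop
theorem popB_pr (hev : Primrec ev) (ha : Primrec (fun p : Bool × ℕ × ℕ => a p.1 p.2.1 p.2.2)) :
    Primrec (fun p : ℕ × ℕ × Frame × Frame => popB ev a p.1 p.2.1 p.2.2.1 p.2.2.2) := by
  have h0 := popt_pr hev ha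
  have h1 := ars_pr ha
  have h2 := yb_pr hev ha
  unfold popB; fun_prop
theorem pushg_pr (hev : Primrec ev) (ha : Primrec (fun p : Bool × ℕ × ℕ => a p.1 p.2.1 p.2.2)) :
    Primrec (fun p : ℕ × ℕ × Frame => pushg ev a p.1 p.2.1 p.2.2) := by
  have h0 := yb_pr hev ha
  unfold pushg; fun_prop
theorem pushs_pr (hev : Primrec ev) (ha : Primrec (fun p : Bool × ℕ × ℕ => a p.1 p.2.1 p.2.2)) :
    Primrec (fun p : ℕ × ℕ × Frame => pushs ev a p.1 p.2.1 p.2.2) := by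
  have h0 := pushg_pr hev ha
  unfold pushs; fun_prop
theorem stepRet_pr (hev : Primrec ev) (ha : Primrec (fun p : Bool × ℕ × ℕ => a p.1 p.2.1 p.2.2)) :
    Primrec (fun p : ℕ × ℕ × List ℕ × List (ℕ × ℕ) × Frame × List Frame => stepRet ev a p.1 p.2.1 p.2.2.1 p.2.2.2.1 p.2.2.2.2.1 p.2.2.2.2.2) := by
  have h0 := resp_pr hev
  have h1 := actq_pr hev ha
  have h2 := popB_pr hev ha
  unfold stepRet; fun_prop
theorem stepWork_pr (hev : Primrec ev) (ha : Primrec (fun p : Bool × ℕ × ℕ => a p.1 p.2.1 p.2.2)) :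
    Primrec (fun p : ℕ × ℕ × List ℕ × List (ℕ × ℕ) × Frame × List Frame => stepWork ev a p.1 p.2.1 p.2.2.1 p.2.2.2.1 p.2.2.2.2.1 p.2.2.2.2.2) := by
  have h0 := upl_pr ha
  have h1 := pushs_pr hev ha
  have h2 := pushg_pr hev ha
  unfold stepWork; fun_prop
theorem step_pr (hev : Primrec ev) (ha : Primrec (fun p : Bool × ℕ × ℕ => a p.1 p.2.1 p.2.2)) :
    Primrec (fun p : ℕ × ℕ × List ℕ × Run => step ev a p.1 p.2.1 p.2.2.1 p.2.2.2) := by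
  have h0 := stepRet_pr hev ha
  have h1 := stepWork_pr hev ha
  unfold step; fun_prop
theorem gstep_pr (hev : Primrec ev) (ha : Primrec (fun p : Bool × ℕ × ℕ => a p.1 p.2.1 p.2.2)) :
    Primrec (fun p : ℕ × GState => gstep ev a p.1 p.2) := by
  have h0 := step_pr hev ha
  unfold gstep; fun_prop
theorem gst_pr (hev : Primrec ev) (ha : Primrec (fun p : Bool × ℕ × ℕ => a p.1 p.2.1 p.2.2)) : Primrec (gst ev a) := by
  have h0 := gstep_pr hev ha
  unfold gst
  exact Pr.natRec (by fun_prop) (by fun_prop) (by fun_prop)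
end Kconstr

end PartK1

section PartK2
/-! ### Masses of sets of events -/

/-- string of event `i` -/
def es (ev : ℕ → Option (Str × ℕ)) (i : ℕ) : Str := ((ev i).map Prod.fst).getD []

noncomputable def mass (ev : ℕ → Option (Str × ℕ)) (t : ℕ) (P : ℕ → Prop) : ℝ :=
  ∑ i ∈ Finset.range t, if P i then rw' (ev i) else 0

section mass
variable {ev : ℕ → Option (Str × ℕ)}

theorem mass_nonneg (t : ℕ) (P : ℕ → Prop) : 0 ≤ mass ev t P :=
  Finset.sum_nonneg fun i _ => by split_ifs <;> simp [rw'_nonneg]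

theorem mass_mono {t t' : ℕ} (h : t ≤ t') {P Q : ℕ → Prop} (hPQ : ∀ i < t, P i → Q i) :
    mass ev t P ≤ mass ev t' Q := by
  refine le_trans (Finset.sum_le_sum (g := fun i => if Q i then rw' (ev i) else 0) fun i hi => ?_)
    (Finset.sum_le_sum_of_subset_of_nonneg (by simpa using h) fun i _ _ => by
      split_ifs <;> simp [rw'_nonneg])
  have := hPQ i (by simpa using hi)
  have h2 := rw'_nonneg (ev i)
  split_ifs <;> first | exact le_rfl | exact h2 | (exfalso; tauto)

theorem mass_add {t : ℕ} {P Q R : ℕ → Prop} (hP : ∀ i < t, P i → R i) (hQ : ∀ i < t, Q i → R i)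
    (hd : ∀ i < t, P i → ¬ Q i) : mass ev t P + mass ev t Q ≤ mass ev t R := by
  rw [mass, mass, mass, ← Finset.sum_add_distrib]
  refine Finset.sum_le_sum fun i hi => ?_
  have hi : i < t := by simpa using hi
  have := hP i hi
  have := hQ i hi
  have := hd i hi
  have h2 := rw'_nonneg (ev i)
  split_ifs <;> first | (exfalso; tauto) | linarith

theorem mass_le_tm (t : ℕ) (P : ℕ → Prop) : mass ev t P ≤ tm ev t := by
  rw [tm_eq_sum]
  refine Finset.sum_le_sum fun i hi => ?_
  have h2 := rw'_nonneg (ev i)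
  split_ifs <;> linarith

theorem mass_pm (t : ℕ) (σ : Str) : pm ev t σ ≤ mass ev t (fun i => es ev i = σ) := by
  rw [pm_eq_sum, mass]
  refine Finset.sum_le_sum fun i hi => ?_
  rcases h : ev i with _ | q
  · simp [rws, rw']
  · simp [rws, rw', es, h]

theorem mass_filterMap (t : ℕ) (c : Str → Bool) :
    lw ((List.range t).filterMap fun i => (ev i).bind fun q =>
      bif c q.1 then Option.some q.2 else Option.none) = mass ev t (fun i => c (es ev i) = true) := by
  induction t with
  | zero => simp [mass]
  | succ n ih =>
    rw [mass, Finset.sum_range_succ, ← mass, ← ih, List.range_succ, List.filterMap_append, lw_append]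
    congr 1
    rcases h : ev n with _ | q
    · simp [rw', h]
    · by_cases h2 : c q.1 = true <;> simp [rw', h, h2, es]

/-- mass of a nodup family of strings -/
theorem mass_list {ι : Type} (L : List ι) (f : ι → Str) (hf : L.Pairwise fun x y => f x ≠ f y) (v : ι → ℝ)
    (t : ℕ) (hv : ∀ x ∈ L, v x ≤ pm ev t (f x)) (R : ℕ → Prop)
    (hR : ∀ i < t, (∃ x ∈ L, es ev i = f x) → R i) :
    (L.map v).sum ≤ mass ev t R := by
  induction L generalizing R with
  | nil => simpa using mass_nonneg t R
  | cons x L ih =>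
    rw [List.pairwise_cons] at hf
    have h1 := ih hf.2 (fun y hy => hv y (by simp [hy])) (fun i => ∃ x ∈ L, es ev i = f x)
      (fun i _ h => h)
    have h2 := (hv x (by simp)).trans (mass_pm t (f x))
    rw [List.map_cons, List.sum_cons]
    refine le_trans (add_le_add h2 h1) (mass_add ?_ ?_ ?_)
    · intro i hi h; exact hR i hi ⟨x, by simp, h⟩
    · rintro i hi ⟨y, hy, h⟩; exact hR i hi ⟨y, by simp [hy], h⟩
    · rintro i hi h ⟨y, hy, h'⟩; exact hf.1 y hy (h ▸ h')
end mass

theorem rs_sandwich {Y : ℕ → ℕ → Bool} (hm : ∀ s t x, s ≤ t → Y s x = true → Y t x = true)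
    {t1 t2 t3 n : ℕ} (h12 : t1 ≤ t2) (h23 : t2 ≤ t3) (h : rs (Y t1) n = rs (Y t3) n) :
    rs (Y t1) n = rs (Y t2) n := by
  rw [rs_eq_iff] at h ⊢
  intro x hx
  have := h x hx
  have h1 := hm t1 t2 x h12
  have h2 := hm t2 t3 x h23
  cases h3 : Y t1 x <;> cases h4 : Y t2 x <;> simp_all

section dm
variable (ev : ℕ → Option (Str × ℕ)) (a : Bool → ℕ → ℕ → Bool)

/-- event `i` was live for `b` and is dead at `T` -/
def deadE (b : Bool) (T i : ℕ) : Prop :=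
  (∃ t' ≤ T, es ev i = ars a b t' (es ev i).length) ∧ es ev i ≠ ars a b T (es ev i).length

noncomputable def dm (b : Bool) (s t T : ℕ) : ℝ :=
  mass ev t fun i => s < (es ev i).length ∧ deadE ev a b T i

noncomputable def DM (s t T : ℕ) : ℝ := dm ev a true s t T + dm ev a false s t T

variable {ev a}

theorem deadE_mono (hm : ∀ b s t x, s ≤ t → a b s x = true → a b t x = true) {b : Bool} {T T' i : ℕ}
    (h : T ≤ T') (hd : deadE ev a b T i) : deadE ev a b T' i := by
  obtain ⟨⟨t', h1, h2⟩, h3⟩ := hd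
  refine ⟨⟨t', h1.trans h, h2⟩, fun h4 => h3 ?_⟩
  have := rs_sandwich (Y := a b) (hm b) h1 h (n := (es ev i).length) (by
    unfold ars at h2 h4; rw [← h2, ← h4])
  unfold ars at *
  rw [← this, ← h2]

theorem dm_mono (hm : ∀ b s t x, s ≤ t → a b s x = true → a b t x = true) {b : Bool} {s t t' T T' : ℕ}
    (ht : t ≤ t') (h : T ≤ T') : dm ev a b s t T ≤ dm ev a b s t' T' :=
  mass_mono ht fun _ _ h' => ⟨h'.1, deadE_mono hm h h'.2⟩

theorem DM_mono (hm : ∀ b s t x, s ≤ t → a b s x = true → a b t x = true) {s t t' T T' : ℕ}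
    (ht : t ≤ t') (h : T ≤ T') : DM ev a s t T ≤ DM ev a s t' T' :=
  add_le_add (dm_mono hm ht h) (dm_mono hm ht h)

theorem DM_le (h1 : ∀ T, tm ev T ≤ 1) (s t T : ℕ) : DM ev a s t T ≤ 2 := by
  have := (mass_le_tm (ev := ev) t fun i => s < (es ev i).length ∧ deadE ev a true T i).trans (h1 t)
  have := (mass_le_tm (ev := ev) t fun i => s < (es ev i).length ∧ deadE ev a false T i).trans (h1 t)
  unfold DM dm; linarith

theorem clist_eq (b : Bool) (s T : ℕ) : lw (clist ev a b s T) =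
    mass ev T fun i => s < (es ev i).length ∧ es ev i = ars a b T (es ev i).length := by
  unfold clist
  rw [mass_filterMap T (fun σ => decide (s < σ.length) && live a b σ T)]
  simp [live]

/-- a batch whose string dies -/
theorem DM_die (hm : ∀ b s t x, s ≤ t → a b s x = true → a b t x = true) {b : Bool} {s t T : ℕ} {σ : Str}
    (hs : σ.length ≤ s) (hσ : σ = ars a b t σ.length) (hT : t ≤ T) (hd : σ ≠ ars a b T σ.length) :
    DM ev a s t t + lw (clist ev a b s t) ≤ DM ev a s t T := by
  have key : dm ev a b s t t + lw (clist ev a b s t) ≤ dm ev a b s t T := by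
    rw [clist_eq]
    refine mass_add ?_ ?_ ?_
    · exact fun _ _ h' => ⟨h'.1, deadE_mono hm hT h'.2⟩
    · rintro i hi ⟨h1, h2⟩
      refine ⟨h1, ⟨t, hT, h2⟩, fun h3 => hd ?_⟩
      unfold ars at *
      rw [h2, rs_length, rs_eq_iff] at h3
      rw [hσ, rs_length, rs_eq_iff]
      exact fun x hx => h3 x (by omega)
    · rintro i hi ⟨_, h2⟩ ⟨_, h3⟩
      exact h2.2 h3
  have h2 : dm ev a (!b) s t t ≤ dm ev a (!b) s t T := dm_mono hm le_rfl hT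
  unfold DM
  cases b <;> simp at h2 <;> linarith

/-- batches occupy disjoint intervals -/
theorem DM_split (hev : ∀ i, (es ev i).length ≤ i) {s s' t t' T : ℕ} (h1 : s ≤ s') (h2 : t' ≤ t)
    (h5 : t' ≤ s') :
    DM ev a s' t T + DM ev a s t' T ≤ DM ev a s t T := by
  have key : ∀ b, dm ev a b s' t T + dm ev a b s t' T ≤ dm ev a b s t T := by
    intro b
    have : dm ev a b s t' T ≤ mass ev t fun i => i < t' ∧ s < (es ev i).length ∧ deadE ev a b T i :=
      mass_mono h2 fun i hi h => ⟨hi, h⟩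
    refine le_trans (add_le_add le_rfl this) (mass_add ?_ ?_ ?_)
    · rintro i hi ⟨h, h'⟩; exact ⟨by omega, h'⟩
    · rintro i hi ⟨_, h⟩; exact h
    · rintro i hi ⟨h, _⟩ ⟨h', _⟩
      have := hev i
      omega
  have := key true
  have := key false
  unfold DM; linarith
end dm

end PartK2

section PartK3
/-! ### Part K : invariants -/

structure KH (ev : ℕ → Option (Str × ℕ)) (a : Bool → ℕ → ℕ → Bool) : Prop where
  hm : ∀ b s t x, s ≤ t → a b s x = true → a b t x = true
  htm : ∀ T, tm ev T ≤ 1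
  hlen : ∀ i, (es ev i).length ≤ i

/-- `2^{-n}` -/
noncomputable def ip (n : ℕ) : ℝ := ((2:ℝ) ^ n)⁻¹

theorem ip_pos (n : ℕ) : 0 < ip n := by unfold ip; positivity
theorem ip_add (m n : ℕ) : ip (m + n) = ip m * ip n := by unfold ip; rw [pow_add, mul_inv]
theorem ip_le {m n : ℕ} (h : m ≤ n) : ip n ≤ ip m := by
  unfold ip; exact inv_anti₀ (by positivity) (pow_le_pow_right₀ (by norm_num) h)
theorem ip_le_one (n : ℕ) : ip n ≤ 1 := by
  have := ip_le (Nat.zero_le n); simpa [ip] using this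
theorem ip_zero : ip 0 = 1 := by simp [ip]
theorem lw_cons' (a : ℕ) (l : List ℕ) : lw (a :: l) = ip a + lw l := lw_cons a l

theorem lw_fm {β : Type} (l : List β) (c : β → Bool) (g : β → ℕ) :
    lw (l.filterMap fun B => bif c B then Option.some (g B) else Option.none) =
      (l.map fun B => if c B = true then ip (g B) else 0).sum := by
  induction l with
  | nil => simp
  | cons B l ih =>
    by_cases h : c B = true
    · simp [h, ih, ip]
    · simp [h, ih]

theorem lw_fm' {β : Type} (l : List β) (c : β → Bool) (g : β → ℕ) :
    lw (l.filterMap fun B => bif c B then Option.none else Option.some (g B)) =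
      (l.map fun B => if c B = true then 0 else ip (g B)).sum := by
  induction l with
  | nil => simp
  | cons B l ih =>
    by_cases h : c B = true
    · simp [h, ih]
    · simp [h, ih, ip]

noncomputable def RF (recv : List Batch) : ℝ := lw (recv.map fun B => B.2.2.1)
noncomputable def W (L : List (ℕ × ℕ)) (s : ℕ) : ℝ := lw (wlist L s)
noncomputable def QQ (e j : ℕ) : ℝ := (1 + ip (Nn e)) ^ j

theorem W_nonneg (L s) : 0 ≤ W L s := lw_nonneg _
theorem RF_nonneg (r) : 0 ≤ RF r := lw_nonneg _
theorem QQ_pos (e j) : 0 < QQ e j := by unfold QQ; have := ip_pos (Nn e); positivity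
theorem one_le_QQ (e j) : 1 ≤ QQ e j := by
  unfold QQ; exact one_le_pow₀ (by have := ip_pos (Nn e); linarith)
theorem QQ_succ (e j) : QQ e (j + 1) = QQ e j * (1 + ip (Nn e)) := by unfold QQ; rw [pow_succ]

theorem RF_cons (B : Batch) (r) : RF (B :: r) = ip B.2.2.1 + RF r := by unfold RF; rw [List.map_cons, lw_cons']
theorem W_cons (q : ℕ × ℕ) (L s) (h : s < q.1) : W (q :: L) s = ip q.2 + W L s := by
  unfold W wlist; rw [List.filterMap_cons]; simp [h, ip]
theorem W_cons' (q : ℕ × ℕ) (L s) (h : ¬ s < q.1) : W (q :: L) s = W L s := by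
  unfold W wlist; rw [List.filterMap_cons]; simp [h]
theorem W_zero (L s) (h : ∀ q ∈ L, ¬ s < q.1) : W L s = 0 := by
  unfold W wlist
  rw [lw_fm, List.sum_eq_zero]
  intro x hx
  simp only [List.mem_map] at hx
  obtain ⟨q, hq, rfl⟩ := hx
  simp [h q hq]

section
variable (ev : ℕ → Option (Str × ℕ)) (a : Bool → ℕ → ℕ → Bool) (e : ℕ)

structure BatchOK (j s0 T : ℕ) (B : Batch) : Prop where
  h0 : s0 ≤ B.1
  hlt : B.1 < B.2.1
  hT : B.2.1 ≤ T
  hlen : B.2.2.2.2.length ≤ B.1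
  hσ : B.2.2.2.2 = ars a B.2.2.2.1 B.2.1 B.2.2.2.2.length
  hD : j * (ip (2 * e) / 2) * ip B.2.2.1 ≤ DM ev a B.1 B.2.1 B.2.1
  hc : (ip (2 * e) / 2) * ip B.2.2.1 ≤ lw (clist ev a B.2.2.2.1 B.1 B.2.1)

structure FrameOK (T : ℕ) (X : List ℕ) (dx : ℝ) (L : List (ℕ × ℕ)) (k : ℕ) (F : Frame) : Prop where
  hT : 2 * F.1 + 1 ≤ T
  hs : F.1 = 0 ∨ ∃ r, F.1 = 2 ^ Nat.pair e r ∧ 2 * e + F.2.1 + 1 ≤ r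
  hX : ∀ x ∈ X, F.1 ≤ x → x < 2 * F.1 → x < F.1 + F.2.2.1
  hL : ∀ q ∈ L, F.1 < q.1 → 2 * F.1 < q.1
  hacts : F.2.2.1 * ip (2 * e + F.2.1) ≤ dx
  hk : k = 0 → F.2.2.2 = []
  hB : ∀ B ∈ F.2.2.2, BatchOK ev a e (k - 1) F.1 T B
  hch : F.2.2.2.Pairwise fun n o => o.2.1 ≤ n.1
  hfill : ∀ b y, lw (filll a b F.2.2.2 T y) ≤ ip (bg e F.2.1) * (pm ev T (zeroStr y) + 2 * ip y)
  hR : RF F.2.2.2 ≤ (1 + ip (Nn e)) * ip F.2.1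

/-- `F` is the sub-frame of `G` (level of `G` is `k`) -/
structure PairOK (T : ℕ) (L : List (ℕ × ℕ)) (k : ℕ) (F G : Frame) : Prop where
  hs : 2 * G.1 < F.1
  hB : ∀ B ∈ G.2.2.2, B.2.1 ≤ F.1
  hy : ∀ b, ∃ y, unf ev a (bg e G.2.1) b G.2.2.2 T y = true ∧ y + bg e G.2.1 ≤ F.2.1 ∧ y ≤ F.1 ∧
    y ≤ G.2.2.2.length
  hR : RF G.2.2.2 + ip F.2.1 ≤ (1 + ip (Nn e)) * ip G.2.1
  hW1 : RF G.2.2.2 + W L F.1 ≤ W L G.1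
  hW2 : W L G.1 ≤ QQ e (k - 1) * RF G.2.2.2 + W L F.1

def TailOK (T : ℕ) (L : List (ℕ × ℕ)) (F : Frame) : List Frame → Prop
  | [] => F.1 = 0 ∧ F.2.1 = 0
  | G :: r => PairOK ev a e T L (Nn e - r.length) F G

def StkOK (T : ℕ) (X : List ℕ) (dx : ℝ) (L : List (ℕ × ℕ)) : List Frame → Prop
  | [] => True
  | F :: rest => rest.length ≤ Nn e ∧ FrameOK ev a e T X dx L (Nn e - rest.length) F ∧
    TailOK ev a e T L F rest ∧ StkOK T X dx L rest

def HeadOK (T : ℕ) (L : List (ℕ × ℕ)) (m : Bool) (k : ℕ) (F : Frame) : Prop :=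
  if m = true then ip F.2.1 ≤ W L F.1 ∧ W L F.1 ≤ QQ e k * ip F.2.1 ∧
    k * (ip (2 * e) / 2) * ip F.2.1 ≤ DM ev a F.1 T T
  else RF F.2.2.2 ≤ W L F.1 ∧ W L F.1 ≤ QQ e (k - 1) * RF F.2.2.2

structure LabOK (T : ℕ) (L : List (ℕ × ℕ)) : Prop where
  hn : L.Pairwise fun p q => p.1 ≠ q.1
  hb : ∀ q ∈ L, 1 ≤ q.1 ∧ q.1 < T

structure Inv (T : ℕ) (X : List ℕ) (dx : ℝ) (r : Run) : Prop where
  hne : r.2.2 ≠ []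
  hS : StkOK ev a e T X dx r.2.1 r.2.2
  hH : ∀ F rest, r.2.2 = F :: rest → HeadOK ev a e T r.2.1 r.1 (Nn e - rest.length) F
  hL : LabOK T r.2.1
end

variable {ev : ℕ → Option (Str × ℕ)} {a : Bool → ℕ → ℕ → Bool} {e : ℕ}

theorem live_persist (H : KH ev a) {b : Bool} {t T T' : ℕ} {σ : Str} (h1 : t ≤ T) (h2 : T ≤ T')
    (hσ : σ = ars a b t σ.length) (h : σ = ars a b T' σ.length) : σ = ars a b T σ.length := by
  unfold ars at *
  have := rs_sandwich (Y := a b) (H.hm b) h1 h2 (n := σ.length) (by rw [← hσ, ← h])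
  rw [← this, ← hσ]

theorem fill_mono (H : KH ev a) {recv : List Batch} {T T' : ℕ} (hT : T ≤ T')
    (hB : ∀ B ∈ recv, B.2.1 ≤ T ∧ B.2.2.2.2 = ars a B.2.2.2.1 B.2.1 B.2.2.2.2.length) (b : Bool) (y : ℕ) :
    lw (filll a b recv T' y) ≤ lw (filll a b recv T y) := by
  unfold filll
  rw [lw_fm, lw_fm]
  refine List.sum_le_sum fun B hBm => ?_
  obtain ⟨h1, h2⟩ := hB B hBm
  have h3 := ip_pos B.2.2.1
  by_cases hc : B.2.2.2.1 = b ∧ B.2.2.2.2 = ars a b T' y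
  · have hl : B.2.2.2.2.length = y := by rw [hc.2]; simp [ars]
    have : B.2.2.2.2 = ars a b T y := by
      rw [← hl]
      refine live_persist H h1 hT ?_ (by rw [hl]; exact hc.2)
      rw [← hc.1]; exact h2
    simp only [Bool.and_eq_true, decide_eq_true_eq]
    rw [if_pos hc, if_pos ⟨hc.1, this⟩]
  · simp only [Bool.and_eq_true, decide_eq_true_eq]
    rw [if_neg hc]
    split_ifs <;> linarith

theorem thr_eq (bb T y : ℕ) : lw (thr ev bb T y) = ip bb * (pm ev T (zeroStr y) + ip y) := by
  unfold thr; rw [lw_map_add, lw_append]; simp [pm, ip]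

theorem unf_iff (bb : ℕ) (b : Bool) (recv : List Batch) (T y : ℕ) : unf ev a bb b recv T y = true ↔
    lw (filll a b recv T y) < ip bb * (pm ev T (zeroStr y) + ip y) := by
  rw [← thr_eq, ← not_le, ← lwle_iff]; simp [unf]

theorem unf_mono (H : KH ev a) {bb : ℕ} {b : Bool} {recv : List Batch} {T T' y : ℕ} (hT : T ≤ T')
    (hB : ∀ B ∈ recv, B.2.1 ≤ T ∧ B.2.2.2.2 = ars a B.2.2.2.1 B.2.1 B.2.2.2.2.length)
    (h : unf ev a bb b recv T y = true) : unf ev a bb b recv T' y = true := by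
  rw [unf_iff] at *
  refine lt_of_le_of_lt (fill_mono H hT hB b y) (lt_of_lt_of_le h ?_)
  have := pm_mono ev hT (zeroStr y)
  have := ip_pos bb
  gcongr

theorem exists_unf (bb : ℕ) (b : Bool) (recv : List Batch) (T : ℕ) :
    ∃ y ≤ recv.length, unf ev a bb b recv T y = true := by
  by_contra hcon
  push Not at hcon
  have h1 : ∀ y ≤ recv.length, ∃ B ∈ recv, B.2.2.2.2.length = y := by
    intro y hy
    by_contra hno
    push Not at hno
    refine hcon y hy ?_
    rw [unf_iff]
    have : filll a b recv T y = [] := by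
      unfold filll
      rw [List.filterMap_eq_nil_iff]
      intro B hB
      have : B.2.2.2.2 ≠ ars a b T y := by
        intro h; refine hno B hB ?_; rw [h]; simp [ars]
      simp [this]
    rw [this, lw_nil]
    have := ip_pos bb
    have := ip_pos y
    have := pm_nonneg ev T (zeroStr y)
    positivity
  have h2 : (Finset.range (recv.length + 1)) ⊆ (recv.map fun B => B.2.2.2.2.length).toFinset := by
    intro y hy
    obtain ⟨B, hB, rfl⟩ := h1 y (by simpa [Nat.lt_succ_iff] using hy)
    simp only [List.mem_toFinset, List.mem_map]
    exact ⟨B, hB, rfl⟩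
  have h3 := Finset.card_le_card h2
  have h4 := List.toFinset_card_le (recv.map fun B => B.2.2.2.2.length)
  simp at h3 h4
  omega

theorem yb_spec (bb : ℕ) (b : Bool) (recv : List Batch) (T : ℕ) :
    unf ev a bb b recv T (yb ev a bb b recv T) = true ∧ yb ev a bb b recv T ≤ recv.length ∧
    ∀ y, y < yb ev a bb b recv T → unf ev a bb b recv T y = false := by
  obtain ⟨y0, hy0, h0⟩ := exists_unf (ev := ev) (a := a) bb b recv T
  unfold yb
  rcases h : (List.range (recv.length + 1)).find? fun y => unf ev a bb b recv T y with _ | y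
  · rw [List.find?_eq_none] at h
    exact absurd h0 (h y0 (by simp; omega))
  · rw [List.find?_range_eq_some] at h
    simp only [Option.getD_some]
    refine ⟨h.1, ?_, fun z hz => ?_⟩
    · have := h.2.1; simp at this; omega
    · simpa using h.2.2 z hz

theorem yb_le {bb : ℕ} {b : Bool} {recv : List Batch} {T y : ℕ}
    (h : unf ev a bb b recv T y = true) : yb ev a bb b recv T ≤ y := by
  by_contra hc
  have := (yb_spec (ev := ev) (a := a) bb b recv T).2.2 y (by omega)
  simp [h] at this

theorem FrameOK.hB' {T X dx L k F} (h : FrameOK ev a e T X dx L k F) :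
    ∀ B ∈ F.2.2.2, B.2.1 ≤ T ∧ B.2.2.2.2 = ars a B.2.2.2.1 B.2.1 B.2.2.2.2.length :=
  fun B hB => ⟨(h.hB B hB).hT, (h.hB B hB).hσ⟩

theorem FrameOK.mono (H : KH ev a) {T T' X X' dx dx' L k F} (h : FrameOK ev a e T X dx L k F)
    (hT : T ≤ T') (hdx : dx ≤ dx') (hX : ∀ x ∈ X', F.1 ≤ x → x < 2 * F.1 → x ∈ X) :
    FrameOK ev a e T' X' dx' L k F where
  hT := h.hT.trans hT
  hs := h.hs
  hX := fun x hx h1 h2 => h.hX x (hX x hx h1 h2) h1 h2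
  hL := h.hL
  hacts := h.hacts.trans hdx
  hk := h.hk
  hB := fun B hB => by
    have := h.hB B hB
    exact { this with hT := this.hT.trans hT }
  hch := h.hch
  hfill := fun b y => by
    refine (fill_mono H hT h.hB' b y).trans ((h.hfill b y).trans ?_)
    have := pm_mono ev hT (zeroStr y)
    have := ip_pos (bg e F.2.1)
    gcongr
  hR := h.hR

theorem StkOK.mono (H : KH ev a) {T T' X X' dx dx' L} (hT : T ≤ T') (hdx : dx ≤ dx') {stk : List Frame}
    (h : StkOK ev a e T X dx L stk) (hX : ∀ F ∈ stk, ∀ x ∈ X', F.1 ≤ x → x < 2 * F.1 → x ∈ X) :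
    StkOK ev a e T' X' dx' L stk := by
  induction stk with
  | nil => exact h
  | cons F rest ih =>
    obtain ⟨h0, h1, h2, h3⟩ := h
    refine ⟨h0, h1.mono H hT hdx (hX F (by simp)), ?_, ih h3 (fun F hF => hX F (by simp [hF]))⟩
    cases rest with
    | nil => exact h2
    | cons G r =>
      unfold TailOK at *
      have hG : FrameOK ev a e T X dx L (Nn e - r.length) G := h3.2.1
      exact { h2 with
        hy := fun b => by
          obtain ⟨y, hy1, hy2⟩ := h2.hy b
          exact ⟨y, unf_mono H hT hG.hB' hy1, hy2⟩ }

theorem HeadOK.mono (H : KH ev a) {T T' L m k F} (hT : T ≤ T') (h : HeadOK ev a e T L m k F) :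
    HeadOK ev a e T' L m k F := by
  unfold HeadOK at *
  split_ifs with hm
  · rw [if_pos hm] at h
    exact ⟨h.1, h.2.1, h.2.2.trans (DM_mono H.hm hT hT)⟩
  · rwa [if_neg hm] at h

theorem StkOK.frame {T X dx L} {stk : List Frame} (h : StkOK ev a e T X dx L stk) :
    ∀ F ∈ stk, 2 * F.1 + 1 ≤ T := by
  induction stk with
  | nil => exact fun F hF => by simp at hF
  | cons F rest ih =>
    obtain ⟨h0, h1, h2, h3⟩ := h
    intro F' hF'
    rw [List.mem_cons] at hF'
    rcases hF' with rfl | hF'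
    · exact h1.hT
    · cases rest with
      | nil => simp at hF'
      | cons G r => exact ih h3 F' hF'

theorem StkOK.label {T X dx L g} {stk : List Frame} (h : StkOK ev a e T X dx L stk) :
    StkOK ev a e T X dx ((T, g) :: L) stk := by
  induction stk with
  | nil => exact h
  | cons F rest ih =>
    have hfr := h.frame
    obtain ⟨h0, h1, h2, h3⟩ := h
    have hF := hfr F (by simp)
    refine ⟨h0, { h1 with
      hL := fun q hq hlt => ?_ }, ?_, ih h3⟩
    · rw [List.mem_cons] at hq
      rcases hq with rfl | hq
      · simpa using hF
      · exact h1.hL q hq hlt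
    cases rest with
    | nil => exact h2
    | cons G r =>
      have hG := hfr G (by simp)
      unfold TailOK at *
      have e1 := W_cons (T, g) L F.1 (by simp; omega)
      have e2 := W_cons (T, g) L G.1 (by simp; omega)
      exact { h2 with
        hW1 := by have := h2.hW1; rw [e1, e2]; linarith
        hW2 := by have := h2.hW2; rw [e1, e2]; linarith }

theorem Inv.mono (H : KH ev a) {T T' X X' dx dx' r} (hT : T ≤ T') (hdx : dx ≤ dx')
    (h : Inv ev a e T X dx r) (hX : ∀ F ∈ r.2.2, ∀ x ∈ X', F.1 ≤ x → x < 2 * F.1 → x ∈ X) :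
    Inv ev a e T' X' dx' r where
  hne := h.hne
  hS := h.hS.mono H hT hdx hX
  hH := fun F rest hr => (h.hH F rest hr).mono H hT
  hL := { h.hL with hb := fun q hq => ⟨(h.hL.hb q hq).1, (h.hL.hb q hq).2.trans_le hT⟩ }

end PartK3

section PartK4
/-! ### Part K : steps preserve the invariant -/
variable {ev : ℕ → Option (Str × ℕ)} {a : Bool → ℕ → ℕ → Bool} {e : ℕ}

theorem dead_sum (H : KH ev a) {j s0 T tt : ℕ} {recv : List Batch}
    (hB : ∀ B ∈ recv, BatchOK ev a e j s0 T B) (hch : recv.Pairwise fun n o => o.2.1 ≤ n.1)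
    (htt : ∀ B ∈ recv, B.2.1 ≤ tt) :
    lw (upl a recv T) * ((j + 1) * (ip (2 * e) / 2)) ≤ DM ev a s0 tt T := by
  induction recv generalizing tt with
  | nil =>
    simp only [upl, List.filterMap_nil, lw_nil, zero_mul]
    exact add_nonneg (mass_nonneg _ _) (mass_nonneg _ _)
  | cons B recv ih =>
    rw [List.pairwise_cons] at hch
    have hB0 := hB B (by simp)
    have h1 := ih (fun B hB' => hB B (by simp [hB'])) hch.2 (tt := B.1) hch.1
    have htB := htt B (by simp)
    have h2 : DM ev a B.1 tt T + DM ev a s0 B.1 T ≤ DM ev a s0 tt T :=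
      DM_split H.hlen hB0.h0 (by have := hB0.hlt; omega) le_rfl
    have h3 : DM ev a B.1 B.2.1 T ≤ DM ev a B.1 tt T := DM_mono H.hm htB le_rfl
    by_cases hl : live a B.2.2.2.1 B.2.2.2.2 T = true
    · have : upl a (B :: recv) T = upl a recv T := by simp [upl, hl]
      rw [this]
      have : 0 ≤ DM ev a B.1 tt T := add_nonneg (mass_nonneg _ _) (mass_nonneg _ _)
      linarith
    · have : upl a (B :: recv) T = B.2.2.1 :: upl a recv T := by simp [upl, hl]
      rw [this, lw_cons']
      have h4 := DM_die (ev := ev) H.hm hB0.hlen hB0.hσ hB0.hT (by simpa [live] using hl)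
      have h5 := hB0.hD
      have h6 := hB0.hc
      nlinarith

theorem sum_ip_le (Y : ℕ) : ∑ y ∈ Finset.range Y, ip y ≤ 2 := by
  have := geom_le (Finset.range Y) 1 (by norm_num) (fun j _ => ip_le_one j)
  simpa [ip] using this

theorem sum_pm_zero (H : KH ev a) (T Y : ℕ) : ∑ y ∈ Finset.range Y, pm ev T (zeroStr y) ≤ 1 := by
  have hinj : Set.InjOn zeroStr (Finset.range Y : Set ℕ) := by
    intro x _ y _ h
    simpa [zeroStr] using congrArg List.length h
  rw [← Finset.sum_image (f := fun σ => pm ev T σ) hinj]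
  exact (sum_pm_le_tm ev T _).trans (H.htm T)

theorem live_fill (recv : List Batch) (T Y : ℕ) (b : Bool) (hY : ∀ B ∈ recv, B.2.2.2.2.length < Y) :
    (recv.map fun B => if B.2.2.2.1 = b ∧ live a B.2.2.2.1 B.2.2.2.2 T = true then ip B.2.2.1 else 0).sum ≤
      ∑ y ∈ Finset.range Y, lw (filll a b recv T y) := by
  induction recv with
  | nil => simp [filll]
  | cons B recv ih =>
    have h1 := ih fun B hB => hY B (by simp [hB])
    have h2 : ∀ y, lw (filll a b (B :: recv) T y) =
        (if B.2.2.2.1 = b ∧ B.2.2.2.2 = ars a b T y then ip B.2.2.1 else 0) + lw (filll a b recv T y) := by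
      intro y
      unfold filll
      rw [lw_fm, lw_fm]
      simp
    simp only [h2, Finset.sum_add_distrib, List.map_cons, List.sum_cons]
    refine add_le_add ?_ h1
    have hnn : ∀ y, 0 ≤ if B.2.2.2.1 = b ∧ B.2.2.2.2 = ars a b T y then ip B.2.2.1 else 0 := by
      intro y; have := ip_pos B.2.2.1; split_ifs <;> linarith
    by_cases hc : B.2.2.2.1 = b ∧ live a B.2.2.2.1 B.2.2.2.2 T = true
    · rw [if_pos hc]
      have h3 : B.2.2.2.1 = b ∧ B.2.2.2.2 = ars a b T B.2.2.2.2.length := by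
        have := hc.2
        rw [hc.1] at this
        exact ⟨hc.1, by simpa [live] using this⟩
      refine le_trans ?_ (Finset.single_le_sum (fun y _ => hnn y)
        (Finset.mem_range.2 (hY B (by simp))))
      rw [if_pos h3]
    · rw [if_neg hc]
      exact Finset.sum_nonneg fun y _ => hnn y

theorem R_le_up (H : KH ev a) {T X dx L k F} (h : FrameOK ev a e T X dx L k F) :
    RF F.2.2.2 ≤ lw (upl a F.2.2.2 T) + 10 * ip (bg e F.2.1) := by
  obtain ⟨Y, hY⟩ : ∃ Y, ∀ B ∈ F.2.2.2, B.2.2.2.2.length < Y :=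
    ⟨T, fun B hB => by have := h.hB B hB; have := this.hlen; have := (h.hB B hB).hlt; have := (h.hB B hB).hT; omega⟩
  have key : ∀ b, ∑ y ∈ Finset.range Y, lw (filll a b F.2.2.2 T y) ≤ 5 * ip (bg e F.2.1) := by
    intro b
    refine (Finset.sum_le_sum fun y _ => h.hfill b y).trans ?_
    rw [← Finset.mul_sum, Finset.sum_add_distrib, ← Finset.mul_sum]
    have := sum_ip_le Y
    have := sum_pm_zero H T Y
    have := ip_pos (bg e F.2.1)
    nlinarith
  have h1 := (live_fill F.2.2.2 T Y true hY).trans (key true)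
  have h2 := (live_fill F.2.2.2 T Y false hY).trans (key false)
  have h3 : RF F.2.2.2 = lw (upl a F.2.2.2 T) +
      (F.2.2.2.map fun B => if B.2.2.2.1 = true ∧ live a B.2.2.2.1 B.2.2.2.2 T = true then ip B.2.2.1 else 0).sum +
      (F.2.2.2.map fun B => if B.2.2.2.1 = false ∧ live a B.2.2.2.1 B.2.2.2.2 T = true then ip B.2.2.1 else 0).sum := by
    generalize F.2.2.2 = recv
    unfold upl
    rw [lw_fm']
    induction recv with
    | nil => simp [RF]
    | cons B recv ih =>
      rw [RF_cons, ih]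
      simp only [List.map_cons, List.sum_cons]
      by_cases hl : live a B.2.2.2.1 B.2.2.2.2 T = true <;> cases hb : B.2.2.2.1 <;> simp [hb] at hl <;>
        simp [hl] <;> ring
  linarith

theorem StkOK.below {T X dx L F} {rest : List Frame} (h : StkOK ev a e T X dx L (F :: rest)) :
    ∀ G ∈ rest, 2 * G.1 < F.1 := by
  induction rest generalizing F with
  | nil => simp
  | cons G r ih =>
    intro G' hG'
    have hp : 2 * G.1 < F.1 := PairOK.hs h.2.2.1
    rw [List.mem_cons] at hG'
    rcases hG' with rfl | hG'
    · exact hp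
    · have := ih h.2.2.2 G' hG'; omega

/-- the top frame never returns -/
theorem ret_rest (H : KH ev a) {T X dx L F rest} (h : Inv ev a e T X dx (true, L, F :: rest)) : rest ≠ [] := by
  rintro rfl
  have h1 := h.hH F [] rfl
  have h2 := h.hS.2.2.1
  have h3 : F.2.1 = 0 := h2.2
  simp only [HeadOK, if_true, h3, ip_zero] at h1
  have h4 := DM_le (ev := ev) (a := a) H.htm F.1 T T
  have h5 : ((Nn e - ([] : List Frame).length : ℕ) : ℝ) * (ip (2 * e) / 2) = 8 := by
    simp only [List.length_nil, Nat.sub_zero, Nn, ip]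
    push_cast
    rw [pow_add]
    field_simp
    norm_num
  have := h1.2.2
  rw [h5] at this
  linarith

theorem inv_act (H : KH ev a) {T X dx L F rest dx'} (h : Inv ev a e T X dx (true, L, F :: rest))
    (hr : resp ev e T X L F.1 = true) (ha : actq ev a e T L F.1 = true) (hdx1 : dx ≤ 1)
    (hdx : dx + mass ev T (fun i => es ev i = rs (xf X) (es ev i).length ∧
      es ev i ≠ rs (xf ((F.1 + F.2.2.1) :: X)) (es ev i).length) ≤ dx') :
    Inv ev a e (T + 1) ((F.1 + F.2.2.1) :: X) dx' (true, L, (F.1, F.2.1, F.2.2.1 + 1, F.2.2.2) :: rest) ∧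
    F.2.2.1 < F.1 ∧ (∃ r, F.1 = 2 ^ Nat.pair e r) ∧ F.1 + F.2.2.1 ∉ X ∧
    (∃ q ∈ L, F.1 + F.2.2.1 < q.1) ∧
    ∀ b, lw (clist ev a b F.1 T) ≤ dx' - dx := by
  have hne := ret_rest H h
  obtain ⟨G, r, rfl⟩ := List.exists_cons_of_ne_nil hne
  obtain ⟨h0, hF, hP, hS⟩ := h.hS
  have hP' : PairOK ev a e T L (Nn e - r.length) F G := hP
  obtain ⟨w1, w2, w3⟩ : _ ∧ _ ∧ _ := by
    have := h.hH F _ rfl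
    simpa only [HeadOK, if_true] using this
  obtain ⟨r', hr1, hr2⟩ : ∃ r', F.1 = 2 ^ Nat.pair e r' ∧ 2 * e + F.2.1 + 1 ≤ r' := by
    rcases hF.hs with h' | h'
    · have := hP'.hs; omega
    · exact h'
  have hacts : F.2.2.1 < F.1 := by
    have h1 := hF.hacts.trans hdx1
    have h2 : (F.2.2.1 : ℝ) ≤ 2 ^ (2 * e + F.2.1) := by
      unfold ip at h1
      rwa [mul_inv_le_iff₀ (by positivity), one_mul] at h1
    have h3 : F.2.2.1 ≤ 2 ^ (2 * e + F.2.1) := by exact_mod_cast h2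
    refine lt_of_le_of_lt h3 ?_
    rw [hr1]
    exact Nat.pow_lt_pow_right (by norm_num) (by have := Nat.right_le_pair e r'; omega)
  have hnX : F.1 + F.2.2.1 ∉ X := fun hx => by
    have := hF.hX _ hx (by omega) (by omega); omega
  -- the gain
  have hgain : ip (2 * e) * W L F.1 ≤ mass ev T (fun i => es ev i = rs (xf X) (es ev i).length ∧
      es ev i ≠ rs (xf ((F.1 + F.2.2.1) :: X)) (es ev i).length) := by
    have h1 := mass_list (ev := ev) (L.filter fun q => decide (F.1 < q.1)) (fun q => rs (xf X) q.1) (by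
        refine (h.hL.hn.filter _).imp fun {p q} hpq heq => hpq ?_
        simpa using congrArg List.length heq) (fun q => ip (q.2 + 2 * e)) T (by
        intro q hq
        simp only [List.mem_filter, decide_eq_true_eq] at hq
        have := hr
        simp only [resp, List.all_eq_true] at this
        have := this q hq.1
        simp only [hq.2, decide_true, Bool.not_true, Bool.false_or] at this
        rw [lwle_iff] at this
        simpa [ip, pm] using this)
      (fun i => es ev i = rs (xf X) (es ev i).length ∧
        es ev i ≠ rs (xf ((F.1 + F.2.2.1) :: X)) (es ev i).length) (by
        rintro i _ ⟨q, hq, hi⟩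
        simp only [List.mem_filter, decide_eq_true_eq] at hq
        rw [hi, rs_length]
        refine ⟨rfl, fun hcon => ?_⟩
        rw [rs_eq_iff] at hcon
        have h3 := hF.hL q hq.1 hq.2
        have := hcon (F.1 + F.2.2.1) (by omega)
        simp [xf, hnX] at this)
    refine le_trans (le_of_eq ?_) h1
    unfold W wlist
    rw [lw_fm]
    clear * -
    induction L with
    | nil => simp
    | cons q L ih =>
      rw [List.map_cons, List.sum_cons, mul_add, ih]
      by_cases hq : F.1 < q.1
      · simp [hq, ip_add]; ring
      · simp [hq]
  have hcost : lw (clist ev a true F.1 T) + lw (clist ev a false F.1 T) < ip (2 * e) * W L F.1 := by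
    simp only [actq, Bool.not_eq_true', ← Bool.not_eq_true, lwle_iff, not_le] at ha
    rw [lw_append, lw_map_add] at ha
    exact ha
  have hle : dx ≤ dx' := by
    have := mass_nonneg (ev := ev) T (fun i => es ev i = rs (xf X) (es ev i).length ∧
      es ev i ≠ rs (xf ((F.1 + F.2.2.1) :: X)) (es ev i).length)
    linarith
  have hqex : ∃ q ∈ L, F.1 + F.2.2.1 < q.1 := by
    by_contra hcon
    push Not at hcon
    have := W_zero L F.1 (fun q hq hlt => by
      have h1 := hF.hL q hq hlt; have := hcon q hq; omega)
    have := ip_pos F.2.1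
    linarith
  refine ⟨⟨by simp, ⟨h0, ?_, ?_, ?_⟩, ?_, ?_⟩, hacts, ⟨r', hr1⟩, hnX, hqex, fun b => ?_⟩
  · have hmono : FrameOK ev a e (T + 1) X dx' L _ F := hF.mono H (Nat.le_succ T) hle (fun x hx _ _ => hx)
    exact { hmono with
      hX := fun x hx h1 h2 => by
        rw [List.mem_cons] at hx
        rcases hx with rfl | hx
        · dsimp only; omega
        · have := hF.hX x hx h1 h2; dsimp only; omega
      hacts := by
        have := hF.hacts
        rw [ip_add] at *
        have := ip_pos (2 * e)
        push_cast
        nlinarith }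
  · exact { hP' with
      hy := fun b => by
          obtain ⟨y, hy1, hy2⟩ := hP'.hy b
          exact ⟨y, unf_mono H (Nat.le_succ T) hS.2.1.hB' hy1, hy2⟩ }
  · refine hS.mono H (Nat.le_succ T) hle fun G' hG' x hx h1 h2 => ?_
    rw [List.mem_cons] at hx
    rcases hx with rfl | hx
    · have := h.hS.below G' hG'
      omega
    · exact hx
  · rintro F' rest' heq
    obtain ⟨rfl, rfl⟩ := List.cons.inj heq
    exact (h.hH F _ rfl).mono H (Nat.le_succ T)
  · exact { h.hL with hb := fun q hq => ⟨(h.hL.hb q hq).1, (h.hL.hb q hq).2.trans_le (Nat.le_succ T)⟩ }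
  · have h1 := lw_nonneg (clist ev a true F.1 T)
    have h2 := lw_nonneg (clist ev a false F.1 T)
    cases b <;> linarith

end PartK4

section PartK5
variable {ev : ℕ → Option (Str × ℕ)} {a : Bool → ℕ → ℕ → Bool} {e : ℕ}

theorem TailOK.congr {T L F F'} {rest : List Frame} (h1 : F.1 = F'.1) (h2 : F.2.1 = F'.2.1)
    (h : TailOK ev a e T L F rest) : TailOK ev a e T L F' rest := by
  cases rest with
  | nil => exact ⟨h1 ▸ h.1, h2 ▸ h.2⟩
  | cons G r =>
    have h' : PairOK ev a e T L (Nn e - r.length) F G := h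
    exact ⟨h1 ▸ h'.hs, h1 ▸ h'.hB, h1 ▸ h2 ▸ h'.hy, h2 ▸ h'.hR, h1 ▸ h'.hW1, h1 ▸ h'.hW2⟩

theorem Inv.succ (H : KH ev a) {T X dx r} (h : Inv ev a e T X dx r) : Inv ev a e (T + 1) X dx r :=
  h.mono H (Nat.le_succ T) le_rfl fun _ _ _ hx _ _ => hx

theorem filll_cons (b : Bool) (B : Batch) (recv : List Batch) (T y : ℕ) :
    lw (filll a b (B :: recv) T y) =
      (if B.2.2.2.1 = b ∧ B.2.2.2.2 = ars a b T y then ip B.2.2.1 else 0) + lw (filll a b recv T y) := by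
  unfold filll
  rw [lw_fm, lw_fm]
  simp

theorem inv_pop (H : KH ev a) {T X dx L F G r} (h : Inv ev a e T X dx (true, L, F :: G :: r))
    (ha : actq ev a e T L F.1 = false) :
    Inv ev a e (T + 1) X dx (false, L, (G.1, G.2.1, G.2.2.1, popB ev a e T F G :: G.2.2.2) :: r) := by
  refine Inv.succ H ?_
  obtain ⟨h0, hF, hP, hS⟩ := h.hS
  obtain ⟨h0', hG, hP2, hS2⟩ := hS
  have hP' : PairOK ev a e T L (Nn e - r.length) F G := hP
  obtain ⟨w1, w2, w3⟩ : _ ∧ _ ∧ _ := by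
    have := h.hH F _ rfl
    simpa only [HeadOK, if_true] using this
  have hk : Nn e - r.length - 1 = Nn e - (G :: r).length := by simp; omega
  have hk0 : Nn e - r.length ≠ 0 := by simp at h0; omega
  have hcost : ip (2 * e) * W L F.1 ≤ lw (clist ev a true F.1 T) + lw (clist ev a false F.1 T) := by
    simp only [actq, Bool.not_eq_false', lwle_iff] at ha
    rwa [lw_append, lw_map_add] at ha
  have hB1 : (popB ev a e T F G).1 = F.1 := rfl
  have hB2 : (popB ev a e T F G).2.1 = T := rfl
  have hBg : (popB ev a e T F G).2.2.1 = F.2.1 := rfl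
  have hBt : (popB ev a e T F G).2.2.2.1 = popt ev a F.1 T := rfl
  set B := popB ev a e T F G with hBdef
  set b := popt ev a F.1 T with hb
  set y := yb ev a (bg e G.2.1) b G.2.2.2 T with hy
  have hBσ : B.2.2.2.2 = ars a b T y := rfl
  have hBl : B.2.2.2.2.length = y := by rw [hBσ]; simp [ars]
  obtain ⟨y1, hy1, hy2, hy3, -⟩ := hP'.hy b
  have hyy : y ≤ y1 := yb_le hy1
  have hGF := hP'.hs
  have hFT := hF.hT
  have hBOK : BatchOK ev a e (Nn e - r.length - 1) G.1 T B := by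
    refine ⟨by rw [hB1]; omega, by rw [hB1, hB2]; omega, by rw [hB2], by rw [hBl, hB1]; omega,
      by rw [hBl, hBt, hB2, hBσ], by rw [hBg, hB1, hB2, hk]; exact w3, ?_⟩
    rw [hBg, hBt, hB1, hB2]
    have h1 : lw (clist ev a true F.1 T) + lw (clist ev a false F.1 T) ≤ 2 * lw (clist ev a b F.1 T) := by
      by_cases hc : lw (clist ev a false F.1 T) ≤ lw (clist ev a true F.1 T)
      · have : b = true := by rw [hb, popt, lwle_iff]; exact hc
        rw [this]; linarith
      · have : b = false := by rw [hb, popt, ← Bool.not_eq_true, lwle_iff]; exact hc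
        rw [this]; linarith
    have := ip_pos (2 * e)
    nlinarith
  have hRc : RF (B :: G.2.2.2) = ip F.2.1 + RF G.2.2.2 := by rw [RF_cons, hBg]
  refine ⟨by simp, ⟨h0', ?_, TailOK.congr (F := G) rfl rfl hP2, hS2⟩, ?_, h.hL⟩
  · refine { hG with
      hk := fun h' => absurd h' hk0
      hB := ?_, hch := ?_, hfill := ?_, hR := ?_ }
    · intro B' hB'
      rw [List.mem_cons] at hB'
      rcases hB' with rfl | hB'
      · exact hBOK
      · exact hG.hB B' hB'
    · rw [List.pairwise_cons]
      exact ⟨fun B' hB' => by rw [hB1]; exact hP'.hB B' hB', hG.hch⟩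
    · intro b' y'
      dsimp only
      rw [filll_cons]
      split_ifs with hc
      · have e1 : b = b' := hc.1
        have e2 : y = y' := by rw [← hBl, hc.2]; simp [ars]
        subst e1; subst e2
        have h1 := (yb_spec (ev := ev) (a := a) (bg e G.2.1) b G.2.2.2 T).1
        rw [unf_iff, ← hy] at h1
        have h2 : ip F.2.1 ≤ ip (bg e G.2.1) * ip y := by
          rw [← ip_add]; exact ip_le (by omega)
        rw [hBg]
        linarith
      · have := hG.hfill b' y'; linarith
    · dsimp only
      rw [hRc]; have := hP'.hR; linarith
  · rintro F' rest' heq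
    obtain ⟨rfl, rfl⟩ := List.cons.inj heq
    simp only [HeadOK, Bool.false_eq_true, if_false]
    rw [hRc, hk]
    have h1 := hP'.hW1
    have h2 := hP'.hW2
    rw [hk] at h2
    constructor
    · linarith
    · linarith

theorem inv_label (H : KH ev a) {T X dx L F rest} (h : Inv ev a e T X dx (false, L, F :: rest))
    (hl : rest.length = Nn e) : Inv ev a e (T + 1) X dx (true, (T, F.2.1) :: L, F :: rest) := by
  have hS : StkOK ev a e T X dx L (F :: rest) := h.hS
  have hT := hS.2.1.hT
  have hH := h.hH F rest rfl
  simp only [HeadOK, Bool.false_eq_true, if_false] at hH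
  have hk : Nn e - rest.length = 0 := by omega
  have hr := hS.2.1.hk hk
  rw [hr, hk] at hH
  have hW : W L F.1 = 0 := by
    have := hH.1; have := hH.2; simp [RF] at *; linarith
  have e1 := W_cons (T, F.2.1) L F.1 (by simp; omega)
  refine ⟨by simp, hS.label.mono H (Nat.le_succ T) le_rfl (fun _ _ _ hx _ _ => hx), ?_, ?_, ?_⟩
  · rintro F' rest' heq
    obtain ⟨rfl, rfl⟩ := List.cons.inj heq
    simp only [HeadOK, if_true]
    rw [e1, hW, hk]
    refine ⟨by simp, by simp [QQ], ?_⟩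
    simp only [Nat.cast_zero, zero_mul]
    exact add_nonneg (mass_nonneg _ _) (mass_nonneg _ _)
  · rw [List.pairwise_cons]
    exact ⟨fun q hq => by have := (h.hL.hb q hq).2; dsimp only; omega, h.hL.hn⟩
  · intro q hq
    rw [List.mem_cons] at hq
    rcases hq with rfl | hq
    · dsimp only; omega
    · have := h.hL.hb q hq; omega

theorem inv_toret (H : KH ev a) {T X dx L F rest} (h : Inv ev a e T X dx (false, L, F :: rest))
    (hl : rest.length ≠ Nn e) (hu : lwle [F.2.1] (upl a F.2.2.2 T) = true) :
    Inv ev a e (T + 1) X dx (true, L, F :: rest) := by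
  have hS : StkOK ev a e T X dx L (F :: rest) := h.hS
  have hH := h.hH F rest rfl
  simp only [HeadOK, Bool.false_eq_true, if_false] at hH
  have hF := hS.2.1
  have hle : rest.length ≤ Nn e := hS.1
  obtain ⟨k, hk⟩ : ∃ k, Nn e - rest.length = k + 1 := ⟨Nn e - rest.length - 1, by omega⟩
  rw [hk] at hH hF
  simp only [Nat.add_sub_cancel] at hH
  rw [lwle_iff, lw_cons', lw_nil, add_zero] at hu
  have hup : lw (upl a F.2.2.2 T) ≤ RF F.2.2.2 := by
    clear * -
    generalize F.2.2.2 = recv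
    unfold upl
    rw [lw_fm']
    induction recv with
    | nil => simp [RF]
    | cons B recv ih =>
      rw [RF_cons]
      simp only [List.map_cons, List.sum_cons]
      have := ip_pos B.2.2.1
      refine add_le_add ?_ ih
      split_ifs <;> linarith
  refine Inv.succ H ⟨by simp, hS, ?_, h.hL⟩
  rintro F' rest' heq
  obtain ⟨rfl, rfl⟩ := List.cons.inj heq
  simp only [HeadOK, if_true]
  rw [hk]
  refine ⟨by linarith, ?_, ?_⟩
  · rw [QQ_succ, mul_assoc]
    exact hH.2.trans (mul_le_mul_of_nonneg_left hF.hR (QQ_pos e k).le)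
  · have h1 := dead_sum H (tt := T) hF.hB hF.hch fun B hB => (hF.hB B hB).hT
    simp only [Nat.add_sub_cancel] at h1
    refine le_trans ?_ h1
    push_cast
    have := ip_pos (2 * e)
    rw [mul_comm]
    gcongr

theorem pushs_gt (e T : ℕ) (F : Frame) : T + pushg ev a e T F < pushs ev a e T F := by
  unfold pushs
  refine lt_of_lt_of_le ?_ (Nat.lt_two_pow_self).le
  have := Nat.right_le_pair e (T + 2 * e + pushg ev a e T F + 1)
  omega

theorem inv_push (H : KH ev a) {T X dx L F rest} (h : Inv ev a e T X dx (false, L, F :: rest))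
    (hl : rest.length ≠ Nn e) (hu : lwle [F.2.1] (upl a F.2.2.2 T) = false)
    (hX : ∀ x ∈ X, x < T) (hdx : 0 ≤ dx) :
    Inv ev a e (2 * pushs ev a e T F + 1) X dx
      (false, L, (pushs ev a e T F, pushg ev a e T F, 0, []) :: F :: rest) := by
  have hS : StkOK ev a e T X dx L (F :: rest) := h.hS
  have hH := h.hH F rest rfl
  simp only [HeadOK, Bool.false_eq_true, if_false] at hH
  have hF := hS.2.1
  have hle : rest.length ≤ Nn e := hS.1
  have hgt := pushs_gt (ev := ev) (a := a) e T F
  have hT' : T ≤ 2 * pushs ev a e T F + 1 := by omega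
  have hW0 : W L (pushs ev a e T F) = 0 := W_zero _ _ fun q hq => by have := (h.hL.hb q hq).2; omega
  have hFT := hF.hT
  rw [← Bool.not_eq_true, lwle_iff, lw_cons', lw_nil, add_zero, not_le] at hu
  have hRF := R_le_up H hF
  have hg : ip (pushg ev a e T F) ≤ ip (bg e F.2.1) := ip_le (by unfold pushg; omega)
  have hg16 : ip (Nn e) * ip F.2.1 = 16 * ip (bg e F.2.1) := by
    have : bg e F.2.1 = Nn e + F.2.1 + 4 := by unfold bg; omega
    rw [this, ip_add, ip_add]
    norm_num [ip]
    ring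
  have hy : ∀ b, yb ev a (bg e F.2.1) b F.2.2.2 T + bg e F.2.1 ≤ pushg ev a e T F := by
    intro b; unfold pushg; cases b <;> omega
  have hgp := ip_pos (bg e F.2.1)
  refine ⟨by simp, ⟨?_, ?_, ?_, ?_⟩, ?_, ?_⟩
  · simp; omega
  · refine ⟨le_rfl, Or.inr ⟨_, rfl, by dsimp only; omega⟩, ?_, ?_, by simpa using hdx, fun _ => rfl, by simp, by simp,
      ?_, ?_⟩
    · intro x hx h1 h2; have := hX x hx; dsimp only at h1; omega
    · intro q hq h1; have := (h.hL.hb q hq).2; dsimp only at h1; omega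
    · intro b y
      simp only [filll, List.filterMap_nil, lw_nil]
      have := pm_nonneg ev (2 * pushs ev a e T F + 1) (zeroStr y)
      have := ip_pos y
      have := ip_pos (bg e (pushg ev a e T F))
      positivity
    · have := ip_pos (Nn e)
      have := ip_pos (pushg ev a e T F)
      simp only [RF, List.map_nil, lw_nil]
      positivity
  · refine ⟨by dsimp only; omega, fun B hB => ?_, fun b => ?_, ?_, ?_, ?_⟩
    · have := (hF.hB B hB).hT; dsimp only; omega
    · have h1 := yb_spec (ev := ev) (a := a) (bg e F.2.1) b F.2.2.2 T
      have h2 := hy b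
      exact ⟨_, unf_mono H hT' hF.hB' h1.1, h2, by dsimp only; omega, h1.2.1⟩
    · dsimp only; linarith
    · dsimp only; rw [hW0]; linarith [hH.1]
    · dsimp only; rw [hW0]; linarith [hH.2]
  · exact hS.mono H hT' le_rfl (fun _ _ _ hx _ _ => hx)
  · rintro F' rest' heq
    obtain ⟨rfl, rfl⟩ := List.cons.inj heq
    simp only [HeadOK, Bool.false_eq_true, if_false]
    rw [hW0]
    simp [RF]
  · exact ⟨h.hL.hn, fun q hq => ⟨(h.hL.hb q hq).1, by have := (h.hL.hb q hq).2; omega⟩⟩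

end PartK5

section PartK6
/-! ### Part K : the global construction -/

section basic
variable (ev : ℕ → Option (Str × ℕ)) (a : Bool → ℕ → ℕ → Bool)

def Tn (n : ℕ) : ℕ := (gst ev a n).1
def Xn (n : ℕ) : List ℕ := (gst ev a n).2.1
def rn (n e : ℕ) : Run := lookupR (gst ev a n).2.2 e

/-- the result of the `n`-th step -/
def stn (n : ℕ) : ℕ × List ℕ × Run :=
  step ev a n.unpair.1 (Tn ev a n) (Xn ev a n) (rn ev a n n.unpair.1)

theorem Tn_succ (n : ℕ) : Tn ev a (n + 1) = (stn ev a n).1 := rfl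
theorem Xn_succ (n : ℕ) : Xn ev a (n + 1) = (stn ev a n).2.1 := rfl
theorem rn_succ (n : ℕ) : rn ev a (n + 1) n.unpair.1 = (stn ev a n).2.2 := by
  have : gst ev a (n + 1) = gstep ev a n (gst ev a n) := rfl
  unfold rn lookupR
  rw [this]
  simp [gstep, stn, Tn, Xn, rn]
theorem rn_succ_ne (n e : ℕ) (h : e ≠ n.unpair.1) : rn ev a (n + 1) e = rn ev a n e := by
  have : gst ev a (n + 1) = gstep ev a n (gst ev a n) := rfl
  unfold rn lookupR
  rw [this]
  simp [gstep, h.symm]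
theorem rn_zero (e : ℕ) : rn ev a 0 e = initRun := rfl

theorem step_work (e T : ℕ) (X : List ℕ) (L : List (ℕ × ℕ)) (F : Frame) (rest : List Frame) :
    step ev a e T X (false, L, F :: rest) = stepWork ev a e T X L F rest := rfl
theorem step_ret (e T : ℕ) (X : List ℕ) (L : List (ℕ × ℕ)) (F : Frame) (rest : List Frame) :
    step ev a e T X (true, L, F :: rest) = stepRet ev a e T X L F rest := rfl

theorem step_basic (e T : ℕ) (X : List ℕ) (r : Run) :
    T < (step ev a e T X r).1 ∧ ((step ev a e T X r).2.1 = X ∨ ∃ x, (step ev a e T X r).2.1 = x :: X) := by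
  obtain ⟨m, L, stk⟩ := r
  cases stk with
  | nil => simp [step]
  | cons F rest =>
    cases m
    · rw [step_work]
      unfold stepWork
      have := pushs_gt (ev := ev) (a := a) e T F
      cases decide (rest.length = Nn e) <;> cases lwle [F.2.1] (upl a F.2.2.2 T) <;> simp <;> omega
    · rw [step_ret]
      unfold stepRet
      cases resp ev e T X L F.1 <;> cases actq ev a e T L F.1 <;> cases rest <;> simp

theorem Tn_mono {m n : ℕ} (h : m ≤ n) : Tn ev a m ≤ Tn ev a n :=
  monotone_nat_of_le_succ (fun n => by
    rw [Tn_succ]; exact (step_basic ev a _ _ _ _).1.le) h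
theorem Tn_ge (n : ℕ) : n < Tn ev a n := by
  induction n with
  | zero => exact Nat.one_pos
  | succ n ih =>
    rw [Tn_succ]
    have : Tn ev a n < _ := (step_basic ev a n.unpair.1 (Tn ev a n) (Xn ev a n) (rn ev a n n.unpair.1)).1
    unfold stn
    omega

theorem Xn_mono (m n x : ℕ) (h : m ≤ n) (hx : xf (Xn ev a m) x = true) : xf (Xn ev a n) x = true := by
  induction n, h using Nat.le_induction with
  | base => exact hx
  | succ n _ ih =>
    rw [Xn_succ]
    rcases (step_basic ev a n.unpair.1 (Tn ev a n) (Xn ev a n) (rn ev a n n.unpair.1)).2 with h | ⟨z, h⟩ <;>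
      unfold stn <;> rw [h]
    · exact ih
    · simp [xf] at ih ⊢; exact Or.inr ih

/-- accumulated dead mass of `X` -/
noncomputable def dx (n : ℕ) : ℝ := mass ev (Tn ev a n) fun i => ∃ n' < n, i < Tn ev a n' ∧
  es ev i = rs (xf (Xn ev a n')) (es ev i).length ∧ es ev i ≠ rs (xf (Xn ev a (n' + 1))) (es ev i).length
end basic

variable {ev : ℕ → Option (Str × ℕ)} {a : Bool → ℕ → ℕ → Bool} {e : ℕ}

theorem dx_nonneg (n : ℕ) : 0 ≤ dx ev a n := mass_nonneg _ _
theorem dx_le (H : KH ev a) (n : ℕ) : dx ev a n ≤ 1 := (mass_le_tm _ _).trans (H.htm _)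

theorem dx_succ (n : ℕ) : dx ev a n + mass ev (Tn ev a n) (fun i =>
    es ev i = rs (xf (Xn ev a n)) (es ev i).length ∧
    es ev i ≠ rs (xf (Xn ev a (n + 1))) (es ev i).length) ≤ dx ev a (n + 1) := by
  refine le_trans (mass_add (R := fun i => ∃ n' < n + 1, i < Tn ev a n' ∧
    es ev i = rs (xf (Xn ev a n')) (es ev i).length ∧
    es ev i ≠ rs (xf (Xn ev a (n' + 1))) (es ev i).length) ?_ ?_ ?_)
    (mass_mono (Tn_mono ev a (Nat.le_succ n)) fun i _ h => h)
  · rintro i hi ⟨n', h, h'⟩; exact ⟨n', by omega, h'⟩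
  · rintro i hi h; exact ⟨n, by omega, hi, h⟩
  · rintro i hi ⟨n', h1, h2, h3, h4⟩ ⟨h5, h6⟩
    have := rs_sandwich (Y := fun n => xf (Xn ev a n)) (Xn_mono ev a) (t1 := n') (t2 := n' + 1) (t3 := n)
      (n := (es ev i).length) (by omega) (by omega) (by rw [← h3, ← h5])
    exact h4 (by rw [← this, ← h3])

theorem StkOK.start {T X dx L} {stk : List Frame} (h : StkOK ev a e T X dx L stk) :
    ∀ F ∈ stk, F.1 = 0 ∨ ∃ r, F.1 = 2 ^ Nat.pair e r := by
  induction stk with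
  | nil => simp
  | cons F rest ih =>
    intro F' hF'
    rw [List.mem_cons] at hF'
    rcases hF' with rfl | hF'
    · rcases h.2.1.hs with h' | ⟨r, h', _⟩
      · exact Or.inl h'
      · exact Or.inr ⟨r, h'⟩
    · exact ih h.2.2.2 F' hF'

theorem inv_init (e : ℕ) (X : List ℕ) (hX : X = []) : Inv ev a e 1 X 0 initRun := by
  subst hX
  have h2 := ip_pos (Nn e)
  refine ⟨by simp [initRun], ⟨by simp, ⟨by simp, Or.inl rfl, by simp, by simp [initRun], by simp, fun _ => rfl,
    by simp, by simp, ?_, ?_⟩, ⟨rfl, rfl⟩, trivial⟩, ?_, ⟨by simp [initRun], by simp [initRun]⟩⟩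
  · intro b y
    simp only [filll, List.filterMap_nil, lw_nil]
    have := pm_nonneg ev 1 (zeroStr y)
    have := ip_pos y
    have := ip_pos (bg e 0)
    positivity
  · simp only [RF, List.map_nil, lw_nil]
    have := ip_pos 0
    positivity
  · rintro F rest heq
    simp only [initRun] at heq
    obtain ⟨rfl, rfl⟩ := List.cons.inj heq
    simp [HeadOK, initRun, RF, W, wlist]

theorem step_inv (H : KH ev a) {T X d d'} {r : Run} (h : Inv ev a e T X d r) (hX : ∀ x ∈ X, x < T)
    (hd0 : 0 ≤ d) (hd1 : d ≤ 1) (hd : d + mass ev T (fun i => es ev i = rs (xf X) (es ev i).length ∧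
      es ev i ≠ rs (xf (step ev a e T X r).2.1) (es ev i).length) ≤ d') :
    Inv ev a e (step ev a e T X r).1 (step ev a e T X r).2.1 d' (step ev a e T X r).2.2 ∧
    ((step ev a e T X r).2.1 = X ∨ ∃ s x k, s = 2 ^ Nat.pair e k ∧ s ≤ x ∧ x < 2 * s ∧ x < T ∧
      (step ev a e T X r).2.1 = x :: X ∧ ∀ b, lw (clist ev a b s T) ≤ d' - d) := by
  have hle : d ≤ d' := le_trans (le_add_of_nonneg_right (mass_nonneg _ _)) hd
  have up : ∀ {T r}, Inv ev a e T X d r → Inv ev a e T X d' r := fun h =>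
    h.mono H le_rfl hle fun _ _ _ hx _ _ => hx
  obtain ⟨m, L, stk⟩ := r
  obtain ⟨F, rest, rfl⟩ := List.exists_cons_of_ne_nil h.hne
  cases m
  · rw [step_work]
    unfold stepWork
    rcases h1 : decide (rest.length = Nn e) with _ | _
    · rw [decide_eq_false_iff_not] at h1
      rcases h2 : lwle [F.2.1] (upl a F.2.2.2 T) with _ | _
      · simp only [cond_false]
        exact ⟨up (inv_push H h h1 h2 hX hd0), Or.inl trivial⟩
      · simp only [cond_false, cond_true]
        exact ⟨up (inv_toret H h h1 h2), Or.inl trivial⟩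
    · rw [decide_eq_true_eq] at h1
      simp only [cond_true]
      exact ⟨up (inv_label H h h1), Or.inl trivial⟩
  · rw [step_ret] at hd ⊢
    unfold stepRet at hd ⊢
    rcases h1 : resp ev e T X L F.1 with _ | _
    · simp only [cond_false]
      exact ⟨up (h.succ H), Or.inl trivial⟩
    rcases h2 : actq ev a e T L F.1 with _ | _
    · obtain ⟨G, r', rfl⟩ := List.exists_cons_of_ne_nil (ret_rest H h)
      simp only [cond_false, cond_true, List.head?_cons, List.tail_cons]
      exact ⟨up (inv_pop H h h2), Or.inl rfl⟩
    · rw [h1, h2] at hd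
      simp only [cond_true] at hd ⊢
      obtain ⟨h3, h4, ⟨k, h5⟩, -, -, h6⟩ := inv_act H h h1 h2 hd1 hd
      have hT : 2 * F.1 + 1 ≤ T := h.hS.2.1.hT
      exact ⟨h3, Or.inr ⟨F.1, F.1 + F.2.2.1, k, h5, by omega, by omega, by omega, rfl, h6⟩⟩

theorem ginv (H : KH ev a) (n : ℕ) : (∀ e, Inv ev a e (Tn ev a n) (Xn ev a n) (dx ev a n) (rn ev a n e)) ∧
    ∀ x ∈ Xn ev a n, x < Tn ev a n := by
  induction n with
  | zero =>
    refine ⟨fun e => ?_, by simp [Xn, gst]⟩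
    have h0 : dx ev a 0 = 0 := by simp [dx, mass]
    rw [h0]
    exact inv_init e _ rfl
  | succ n ih =>
    obtain ⟨ih1, ih2⟩ := ih
    have hstep := step_inv H (ih1 n.unpair.1) ih2 (dx_nonneg n) (dx_le H n) (dx_succ n)
    have hT : Tn ev a n ≤ Tn ev a (n + 1) := Tn_mono ev a (Nat.le_succ n)
    refine ⟨fun e => ?_, ?_⟩
    · by_cases he : e = n.unpair.1
      · subst he
        rw [rn_succ]
        exact hstep.1
      · rw [rn_succ_ne _ _ _ _ he]
        refine (ih1 e).mono H hT
          (le_trans (le_add_of_nonneg_right (mass_nonneg _ _)) (dx_succ n)) fun F hF x hx h1 h2 => ?_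
        rcases hstep.2 with h | ⟨s, z, k, hs, hz1, hz2, -, h, -⟩
        · rw [Xn_succ, stn, h] at hx; exact hx
        · rw [Xn_succ, stn, h, List.mem_cons] at hx
          rcases hx with rfl | hx
          · exfalso
            rcases (ih1 e).hS.start F hF with h0 | ⟨r, hr⟩
            · omega
            · rw [hr] at h1 h2
              rw [hs] at hz1 hz2
              have e1 := (Nat.log_eq_iff (b := 2) (n := x) (m := Nat.pair e r) (Or.inr ⟨by norm_num, by have := Nat.two_pow_pos (Nat.pair e r); omega⟩)).2
                ⟨h1, by rw [pow_succ]; omega⟩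
              have e2 := (Nat.log_eq_iff (b := 2) (n := x) (m := Nat.pair n.unpair.1 k) (Or.inr ⟨by norm_num, by have := Nat.two_pow_pos (Nat.pair e r); omega⟩)).2
                ⟨hz1, by rw [pow_succ]; omega⟩
              have := (Nat.pair_eq_pair.1 (e1.symm.trans e2)).1
              exact he this
          · exact hx
    · intro x hx
      rcases hstep.2 with h | ⟨s, z, k, hs, hz1, hz2, hzT, h, -⟩
      · rw [Xn_succ, stn, h] at hx; exact (ih2 x hx).trans_le hT
      · rw [Xn_succ, stn, h, List.mem_cons] at hx
        rcases hx with rfl | hx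
        · omega
        · exact (ih2 x hx).trans_le hT

/-- cost of a step -/
theorem cost_le (H : KH ev a) (n : ℕ) (b : Bool) :
    mass ev (Tn ev a n) (fun i => es ev i = ars a b (Tn ev a n) (es ev i).length ∧
      rs (xf (Xn ev a n)) (es ev i).length ≠ rs (xf (Xn ev a (n + 1))) (es ev i).length) ≤
      dx ev a (n + 1) - dx ev a n := by
  obtain ⟨ih1, ih2⟩ := ginv H n
  have hstep := step_inv H (ih1 n.unpair.1) ih2 (dx_nonneg n) (dx_le H n) (dx_succ n)
  rcases hstep.2 with h | ⟨s, z, k, hs, hz1, hz2, hzT, h, hc⟩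
  · have hX : Xn ev a (n + 1) = Xn ev a n := h
    have h1 := dx_succ (ev := ev) (a := a) n
    rw [hX] at h1 ⊢
    have h2 : mass ev (Tn ev a n) (fun i => es ev i = ars a b (Tn ev a n) (es ev i).length ∧
      rs (xf (Xn ev a n)) (es ev i).length ≠ rs (xf (Xn ev a n)) (es ev i).length) = 0 := by simp [mass]
    have h3 := mass_nonneg (ev := ev) (Tn ev a n) (fun i =>
      es ev i = rs (xf (Xn ev a n)) (es ev i).length ∧
      es ev i ≠ rs (xf (Xn ev a n)) (es ev i).length)
    rw [h2]
    linarith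
  · have hX : Xn ev a (n + 1) = z :: Xn ev a n := h
    refine le_trans ?_ (hc b)
    rw [clist_eq, hX]
    refine mass_mono le_rfl fun i hi h' => ⟨?_, h'.1⟩
    by_contra hcon
    refine h'.2 ?_
    rw [rs_eq_iff]
    intro x hx
    have : x ≠ z := by omega
    simp [xf, this]

end PartK6

section PartK7
/-! ### Part K : the constructed set is below both given sets -/

theorem pm_ge_of {u : ℕ → Option (Str × ℕ)} {m : ℕ} {σ : Str} {ℓ : ℕ} (h : u m = Option.some (σ, ℓ)) :
    ip ℓ ≤ pm u (m + 1) σ := by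
  rw [pm_eq_sum]
  refine le_trans ?_ (Finset.single_le_sum (f := fun i => rws (u i) σ) (fun i _ => rws_nonneg _ _)
    (Finset.mem_range.2 (Nat.lt_succ_self m)))
  simp [h, rws, ip]

/-- bounding a stream indexed by pairs -/
theorem tm_pair_le {u : ℕ → Option (Str × ℕ)} {f : ℕ → ℕ → ℝ} (hf : ∀ n i, 0 ≤ f n i)
    (hu : ∀ m, rw' (u m) ≤ f m.unpair.1 m.unpair.2) (M : ℕ) :
    tm u M ≤ ∑ n ∈ Finset.range M, ∑ i ∈ Finset.range M, f n i := by
  rw [tm_eq_sum, ← Finset.sum_product' (f := f)]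
  refine (Finset.sum_le_sum fun m _ => hu m).trans ?_
  rw [← Finset.sum_image (s := Finset.range M) (g := Nat.unpair) (f := fun p => f p.1 p.2)
    (fun x _ y _ h => by rw [← Nat.pair_unpair x, h, Nat.pair_unpair])]
  refine Finset.sum_le_sum_of_subset_of_nonneg ?_ fun p _ _ => hf _ _
  intro p hp
  simp only [Finset.mem_image, Finset.mem_range, Finset.mem_product] at hp ⊢
  obtain ⟨m, hm, rfl⟩ := hp
  exact ⟨(Nat.unpair_left_le m).trans_lt hm, (Nat.unpair_right_le m).trans_lt hm⟩

section
variable (ev : ℕ → Option (Str × ℕ)) (a : Bool → ℕ → ℕ → Bool)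

/-- request at the transition `n → n+1` for event `i` -/
def xreq (b : Bool) (m : ℕ) : Option (Str × ℕ) :=
  (ev m.unpair.2).bind fun q =>
    bif (decide (m.unpair.2 < Tn ev a (m.unpair.1 + 1)) && live a b q.1 (Tn ev a (m.unpair.1 + 1))) &&
      (decide (Tn ev a m.unpair.1 ≤ m.unpair.2) || !(live a b q.1 (Tn ev a m.unpair.1)) ||
        !(decide (rs (xf (Xn ev a m.unpair.1)) q.1.length = rs (xf (Xn ev a (m.unpair.1 + 1))) q.1.length)))
    then Option.some (rs (xf (Xn ev a (m.unpair.1 + 1))) q.1.length, q.2) else Option.none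
end

variable {ev : ℕ → Option (Str × ℕ)} {a : Bool → ℕ → ℕ → Bool} {e : ℕ}

theorem Tn_pr (hev : Primrec ev) (ha : Primrec (fun p : Bool × ℕ × ℕ => a p.1 p.2.1 p.2.2)) :
    Primrec (Tn ev a) := by
  have := gst_pr hev ha
  unfold Tn; fun_prop
theorem Xn_pr (hev : Primrec ev) (ha : Primrec (fun p : Bool × ℕ × ℕ => a p.1 p.2.1 p.2.2)) :
    Primrec (Xn ev a) := by
  have := gst_pr hev ha
  unfold Xn; fun_prop
theorem rn_pr (hev : Primrec ev) (ha : Primrec (fun p : Bool × ℕ × ℕ => a p.1 p.2.1 p.2.2)) :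
    Primrec (fun p : ℕ × ℕ => rn ev a p.1 p.2) := by
  have := gst_pr hev ha
  unfold rn; fun_prop
theorem xreq_pr (hev : Primrec ev) (ha : Primrec (fun p : Bool × ℕ × ℕ => a p.1 p.2.1 p.2.2)) (b : Bool) :
    Primrec (xreq ev a b) := by
  have h1 := Tn_pr hev ha
  have h2 := Xn_pr hev ha
  have h3 := live_pr ha
  unfold xreq rs; fun_prop

theorem xreq_some {b : Bool} {n i : ℕ} {q : Str × ℕ} (hq : ev i = Option.some q)
    (h1 : i < Tn ev a (n + 1)) (h2 : q.1 = ars a b (Tn ev a (n + 1)) q.1.length)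
    (h3 : Tn ev a n ≤ i ∨ q.1 ≠ ars a b (Tn ev a n) q.1.length ∨
      rs (xf (Xn ev a n)) q.1.length ≠ rs (xf (Xn ev a (n + 1))) q.1.length) :
    xreq ev a b (Nat.pair n i) = Option.some (rs (xf (Xn ev a (n + 1))) q.1.length, q.2) := by
  have h3' : (decide (Tn ev a n ≤ i) || !(live a b q.1 (Tn ev a n)) ||
        !(decide (rs (xf (Xn ev a n)) q.1.length = rs (xf (Xn ev a (n + 1))) q.1.length))) = true := by
    simp only [live, Bool.or_eq_true, Bool.not_eq_true', decide_eq_true_eq, decide_eq_false_iff_not]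
    tauto
  have h2' : live a b q.1 (Tn ev a (n + 1)) = true := by
    simp only [live, decide_eq_true_eq]; exact h2
  unfold xreq
  rw [Nat.unpair_pair]
  simp only [hq, Option.bind_some, h3', h2', h1, decide_true, Bool.and_self, cond_true]

/-- newly live -/
def NL (ev : ℕ → Option (Str × ℕ)) (a : Bool → ℕ → ℕ → Bool) (b : Bool) (n i : ℕ) : Prop :=
  i < Tn ev a (n + 1) ∧ es ev i = ars a b (Tn ev a (n + 1)) (es ev i).length ∧
    (Tn ev a n ≤ i ∨ es ev i ≠ ars a b (Tn ev a n) (es ev i).length)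

def CH (ev : ℕ → Option (Str × ℕ)) (a : Bool → ℕ → ℕ → Bool) (b : Bool) (n i : ℕ) : Prop :=
  es ev i = ars a b (Tn ev a n) (es ev i).length ∧
      rs (xf (Xn ev a n)) (es ev i).length ≠ rs (xf (Xn ev a (n + 1))) (es ev i).length

theorem NL_unique (H : KH ev a) {b : Bool} {n n' i : ℕ} (h : NL ev a b n i) (h' : NL ev a b n' i) (hlt : n < n') : False := by
  obtain ⟨h1, h2, h3⟩ := h
  obtain ⟨h4, h5, h6⟩ := h'
  have := live_persist H (Tn_mono ev a (show n + 1 ≤ n' by omega)) (Tn_mono ev a (show n' ≤ n' + 1 by omega)) h2 h5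
  have h7 := Tn_mono ev a (show n + 1 ≤ n' by omega)
  rcases h6 with h6 | h6
  · omega
  · exact h6 this

theorem xreq_rw (b : Bool) (m : ℕ) : rw' (xreq ev a b m) ≤
    (if NL ev a b m.unpair.1 m.unpair.2 then rw' (ev m.unpair.2) else 0) +
    (if m.unpair.2 < Tn ev a m.unpair.1 ∧ CH ev a b m.unpair.1 m.unpair.2 then rw' (ev m.unpair.2) else 0) := by
  generalize hn : m.unpair.1 = n
  generalize hi : m.unpair.2 = i
  have h0 := rw'_nonneg (ev i)
  rcases hev : ev i with _ | q
  · have : xreq ev a b m = Option.none := by simp [xreq, hi, hev]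
    rw [this]; simp [rw']
  have hes : es ev i = q.1 := by simp [es, hev]
  rw [hev] at h0
  by_cases hN : NL ev a b n i
  · rw [if_pos hN]
    have : rw' (xreq ev a b m) ≤ rw' (Option.some q) := by
      unfold xreq
      rw [hn, hi, hev, Option.bind_some]
      cases (decide (i < Tn ev a (n + 1)) && live a b q.1 (Tn ev a (n + 1))) &&
        (decide (Tn ev a n ≤ i) || !(live a b q.1 (Tn ev a n)) ||
        !(decide (rs (xf (Xn ev a n)) q.1.length = rs (xf (Xn ev a (n + 1))) q.1.length)))
      · exact h0
      · simp [rw']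
    split_ifs <;> linarith
  · rw [if_neg hN]
    by_cases hC : i < Tn ev a n ∧ CH ev a b n i
    · rw [if_pos hC]
      unfold xreq
      rw [hn, hi, hev, Option.bind_some]
      cases (decide (i < Tn ev a (n + 1)) && live a b q.1 (Tn ev a (n + 1))) &&
        (decide (Tn ev a n ≤ i) || !(live a b q.1 (Tn ev a n)) ||
        !(decide (rs (xf (Xn ev a n)) q.1.length = rs (xf (Xn ev a (n + 1))) q.1.length)))
      · simpa [rw'] using h0
      · simp [rw']
    · rw [if_neg hC]
      unfold xreq
      rw [hn, hi, hev, Option.bind_some]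
      have : ((decide (i < Tn ev a (n + 1)) && live a b q.1 (Tn ev a (n + 1))) &&
        (decide (Tn ev a n ≤ i) || !(live a b q.1 (Tn ev a n)) ||
        !(decide (rs (xf (Xn ev a n)) q.1.length = rs (xf (Xn ev a (n + 1))) q.1.length)))) = false := by
        rw [Bool.eq_false_iff]
        intro hc
        simp only [live, Bool.or_eq_true, Bool.and_eq_true, Bool.not_eq_true', decide_eq_true_eq,
          decide_eq_false_iff_not] at hc
        unfold NL at hN
        unfold CH at hC
        rw [hes] at hN hC
        by_cases h1 : Tn ev a n ≤ i
        · exact hN ⟨hc.1.1, hc.1.2, Or.inl h1⟩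
        by_cases h2 : q.1 = ars a b (Tn ev a n) q.1.length
        · refine hC ⟨by omega, h2, ?_⟩
          tauto
        · exact hN ⟨hc.1.1, hc.1.2, Or.inr h2⟩
      rw [this]
      simp [rw']

theorem xreq_tm (H : KH ev a) (b : Bool) (M : ℕ) : tm (xreq ev a b) M ≤ 2 := by
  refine (tm_pair_le (f := fun n i => (if NL ev a b n i then rw' (ev i) else 0) +
    (if i < Tn ev a n ∧ CH ev a b n i then rw' (ev i) else 0)) ?_ (xreq_rw b) M).trans ?_
  · intro n i
    have h0 := rw'_nonneg (ev i)
    split_ifs <;> linarith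
  simp only [Finset.sum_add_distrib]
  have e1 : ∑ n ∈ Finset.range M, ∑ i ∈ Finset.range M, (if NL ev a b n i then rw' (ev i) else 0) ≤ 1 := by
    rw [Finset.sum_comm]
    refine le_trans ?_ (H.htm M)
    rw [tm_eq_sum]
    refine Finset.sum_le_sum fun i _ => ?_
    have h0 := rw'_nonneg (ev i)
    rw [← Finset.sum_filter, Finset.sum_const, nsmul_eq_mul]
    have : ((Finset.range M).filter fun n => NL ev a b n i).card ≤ 1 := by
      rw [Finset.card_le_one]
      intro x hx y hy
      rw [Finset.mem_filter] at hx hy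
      rcases lt_trichotomy x y with h | h | h
      · exact (NL_unique H hx.2 hy.2 h).elim
      · exact h
      · exact (NL_unique H hy.2 hx.2 h).elim
    have : (((Finset.range M).filter fun n => NL ev a b n i).card : ℝ) ≤ 1 := by exact_mod_cast this
    nlinarith
  have e2 : ∑ n ∈ Finset.range M, ∑ i ∈ Finset.range M,
      (if i < Tn ev a n ∧ CH ev a b n i then rw' (ev i) else 0) ≤ 1 := by
    refine (Finset.sum_le_sum (g := fun n => dx ev a (n + 1) - dx ev a n) fun n _ => ?_).trans ?_
    · refine le_trans ?_ (cost_le H n b)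
      unfold mass
      have h1 : ∀ i, 0 ≤ (if i < Tn ev a n ∧ CH ev a b n i then rw' (ev i) else 0) := by
        intro i
        have h0 := rw'_nonneg (ev i)
        split_ifs <;> linarith
      refine (Finset.sum_le_sum_of_subset_of_nonneg
        (t := Finset.range (max M (Tn ev a n))) (by simp) fun i _ _ => h1 i).trans ?_
      rw [← Finset.sum_subset (s₁ := Finset.range (Tn ev a n))]
      · refine Finset.sum_le_sum fun i hi => ?_
        rw [Finset.mem_range] at hi
        unfold CH
        by_cases hh : es ev i = ars a b (Tn ev a n) (es ev i).length ∧
          rs (xf (Xn ev a n)) (es ev i).length ≠ rs (xf (Xn ev a (n + 1))) (es ev i).length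
        · rw [if_pos ⟨hi, hh⟩, if_pos hh]
        · rw [if_neg (fun h => hh h.2), if_neg hh]
      · simp
      · intro i _ hi
        rw [Finset.mem_range] at hi
        simp [hi]
    · rw [Finset.sum_range_sub]
      have := dx_le H M
      have := dx_nonneg (ev := ev) (a := a) 0
      linarith
  linarith

theorem xreq_ex (H : KH ev a) {b : Bool} {i : ℕ} {q : Str × ℕ} (hq : ev i = Option.some q) (hi : 1 ≤ i) (n : ℕ)
    (h1 : i < Tn ev a n) (h2 : q.1 = ars a b (Tn ev a n) q.1.length) :
    ∃ m, xreq ev a b m = Option.some (rs (xf (Xn ev a n)) q.1.length, q.2) := by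
  induction n with
  | zero => have : Tn ev a 0 = 1 := rfl
            omega
  | succ n ih =>
    by_cases h3 : Tn ev a n ≤ i ∨ q.1 ≠ ars a b (Tn ev a n) q.1.length ∨
      rs (xf (Xn ev a n)) q.1.length ≠ rs (xf (Xn ev a (n + 1))) q.1.length
    · exact ⟨_, xreq_some hq h1 h2 h3⟩
    · push Not at h3
      rw [← h3.2.2]
      exact ih h3.1 h3.2.1

/-- the constructed set -/
def XS (ev : ℕ → Option (Str × ℕ)) (a : Bool → ℕ → ℕ → Bool) : Set ℕ := {x | ∃ n, xf (Xn ev a n) x = true}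

theorem XS_ce (hev : Primrec ev) (ha : Primrec (fun p : Bool × ℕ × ℕ => a p.1 p.2.1 p.2.2)) :
    CESet (XS ev a) := by
  have := Xn_pr hev ha
  exact ce_of_enum (a := fun n x => xf (Xn ev a n) x) (by fun_prop)

theorem XS_stage (n : ℕ) : ∃ s, ∀ t, s ≤ t → rs (xf (Xn ev a t)) n = restrSet (XS ev a) n := by
  obtain ⟨s, hs⟩ := exists_stage (A := XS ev a) (a := fun t => xf (Xn ev a t)) (Xn_mono ev a) (fun x => Iff.rfl) n
  exact ⟨s, fun t ht => by rw [restrSet_eq_rs, rs_eq_iff]; exact hs t ht⟩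

theorem XS_le {U : Str →. Str} (hU : OptimalPF U) (hev : Primrec ev)
    (ha : Primrec (fun p : Bool × ℕ × ℕ => a p.1 p.2.1 p.2.2)) (H : KH ev a)
    (hcomp : ∀ ρ σ, σ ∈ U ρ → ∃ i, ev i = Option.some (σ, ρ.length)) (b : Bool) (A : Set ℕ)
    (hA : ∀ x, x ∈ A ↔ ∃ s, a b s x = true) : KLeSet U (XS ev a) A := by
  obtain ⟨c, hc⟩ := coding hU (xreq_pr hev ha b) 2 (fun T => by exact_mod_cast xreq_tm H b T)
  refine ⟨c, fun n => ?_⟩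
  rcases Nat.eq_zero_or_pos n with rfl | hn
  · have : restrSet (XS ev a) 0 = restrSet A 0 := by simp [restrSet]
    rw [this]; exact le_self_add
  refine le_add_of_forall fun k hk => ?_
  obtain ⟨ρ, hρ, hl⟩ := KC_le_iff.1 hk
  obtain ⟨i, hi⟩ := hcomp ρ _ hρ
  have hlen : (restrSet A n).length = n := by simp [restrSet]
  have hi1 : n ≤ i := by
    have := H.hlen i
    simpa [es, hi, hlen] using this
  obtain ⟨s, hs⟩ := exists_stage (H.hm b) hA n
  obtain ⟨s', hs'⟩ := XS_stage (ev := ev) (a := a) n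
  set t := max i (max s s') with ht
  have hTt := Tn_ge ev a t
  obtain ⟨m, hm⟩ := xreq_ex H (b := b) hi (by omega) t (by omega) (by
    dsimp only
    rw [hlen, restrSet_eq_rs, ars, rs_eq_iff]
    intro x hx
    exact (hs _ (by omega) x hx).symm)
  dsimp only at hm
  rw [hlen, hs' t (by omega)] at hm
  refine (hc _ _ _ (pm_ge_of hm)).trans ?_
  gcongr

end PartK7

section PartK8
/-! ### Part K : labels, responses and returning -/

variable {ev : ℕ → Option (Str × ℕ)} {a : Bool → ℕ → ℕ → Bool} {e : ℕ}

theorem QQ_le (e : ℕ) : QQ e (Nn e) ≤ 3 := by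
  unfold QQ
  generalize Nn e = N
  have h1 : (1 + ip N) ^ N ≤ Real.exp (ip N) ^ N := by
    have := ip_pos N
    have h2 := Real.add_one_le_exp (ip N)
    exact pow_le_pow_left₀ (by linarith) (by linarith) N
  rw [← Real.exp_nat_mul] at h1
  have h3 : (N : ℝ) * ip N ≤ 1 := by
    unfold ip
    rw [← div_eq_mul_inv, div_le_one (by positivity)]
    exact_mod_cast (Nat.lt_two_pow_self (n := N)).le
  have h4 := Real.exp_le_exp.2 h3
  have h5 := Real.exp_one_lt_d9
  linarith

theorem stk_W {T X dx L} {stk : List Frame} (h : StkOK ev a e T X dx L stk) :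
    ∀ F rest, stk = F :: rest → W L F.1 ≤ QQ e (Nn e - rest.length) * ip F.2.1 → W L 0 ≤ 3 := by
  induction stk with
  | nil => intro F rest h; simp at h
  | cons F rest ih =>
    intro F' rest' heq hw
    obtain ⟨rfl, rfl⟩ := List.cons.inj heq
    obtain ⟨h0, h1, h2, h3⟩ := h
    cases rest with
    | nil =>
      obtain ⟨h4, h5⟩ : F.1 = 0 ∧ F.2.1 = 0 := h2
      rw [h4, h5, ip_zero] at hw
      have := QQ_le e
      simp at hw
      linarith
    | cons G r =>
      have hP : PairOK ev a e T L (Nn e - r.length) F G := h2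
      refine ih h3 G r rfl ?_
      simp only [List.length_cons] at hw h0
      obtain ⟨k, hk⟩ : ∃ k, Nn e - r.length = k + 1 := ⟨Nn e - r.length - 1, by omega⟩
      have hk' : Nn e - (r.length + 1) = k := by omega
      have h4 := hP.hW2
      have h5 := hP.hR
      rw [hk, Nat.add_sub_cancel] at h4
      rw [hk'] at hw
      rw [hk, QQ_succ]
      have := QQ_pos e k
      nlinarith

theorem inv_W {T X dx r} (h : Inv ev a e T X dx r) : W r.2.1 0 ≤ 3 := by
  obtain ⟨F, rest, hr⟩ := List.exists_cons_of_ne_nil h.hne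
  have hH := h.hH F rest hr
  have hS := h.hS
  refine stk_W hS F rest hr ?_
  rw [hr] at hS
  have hF := hS.2.1
  unfold HeadOK at hH
  split_ifs at hH
  · exact hH.2.1
  · have h1 := hH.2
    rcases Nat.eq_zero_or_pos (Nn e - rest.length) with h0 | h0
    · have := hF.hk h0
      rw [this] at h1
      simp only [RF, List.map_nil, lw_nil, mul_zero] at h1
      have := QQ_pos e (Nn e - rest.length)
      have := ip_pos F.2.1
      nlinarith
    · obtain ⟨k, hk⟩ : ∃ k, Nn e - rest.length = k + 1 := ⟨Nn e - rest.length - 1, by omega⟩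
      rw [hk] at h1 ⊢
      rw [Nat.add_sub_cancel] at h1
      rw [QQ_succ]
      have h5 := hF.hR
      have := QQ_pos e k
      nlinarith

theorem W_all {L : List (ℕ × ℕ)} (h : ∀ q ∈ L, 1 ≤ q.1) : W L 0 = lw (L.map Prod.snd) := by
  induction L with
  | nil => simp [W, wlist]
  | cons q L ih =>
    rw [W_cons _ _ _ (by have := h q (by simp); omega), ih fun q hq => h q (by simp [hq]), List.map_cons, lw_cons']

theorem step_lab (T : ℕ) (X : List ℕ) (r : Run) : (step ev a e T X r).2.2.2.1 = r.2.1 ∨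
    ∃ q, (step ev a e T X r).2.2.2.1 = q :: r.2.1 := by
  obtain ⟨m, L, stk⟩ := r
  cases stk with
  | nil => exact Or.inl rfl
  | cons F rest =>
    cases m
    · rw [step_work]
      unfold stepWork
      cases decide (rest.length = Nn e) <;> cases lwle [F.2.1] (upl a F.2.2.2 T) <;> simp
    · rw [step_ret]
      unfold stepRet
      cases resp ev e T X L F.1 <;> cases actq ev a e T L F.1 <;> cases rest <;> simp

/-- label requests -/
def lreq (ev : ℕ → Option (Str × ℕ)) (a : Bool → ℕ → ℕ → Bool) (n : ℕ) : Option (Str × ℕ) :=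
  bif decide ((rn ev a (n + 1) n.unpair.1).2.1.length = (rn ev a n n.unpair.1).2.1.length + 1) then
    (rn ev a (n + 1) n.unpair.1).2.1.head?.map fun q => (zeroStr q.1, q.2 + (n.unpair.1 + 1))
  else Option.none

theorem lreq_pr (hev : Primrec ev) (ha : Primrec (fun p : Bool × ℕ × ℕ => a p.1 p.2.1 p.2.2)) :
    Primrec (lreq ev a) := by
  have h1 := rn_pr hev ha
  unfold lreq; fun_prop

theorem lreq_none {n : ℕ} (h : (rn ev a (n + 1) n.unpair.1).2.1 = (rn ev a n n.unpair.1).2.1) :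
    lreq ev a n = Option.none := by
  unfold lreq; rw [h]; simp
theorem lreq_some {n : ℕ} {q} (h : (rn ev a (n + 1) n.unpair.1).2.1 = q :: (rn ev a n n.unpair.1).2.1) :
    lreq ev a n = Option.some (zeroStr q.1, q.2 + (n.unpair.1 + 1)) := by
  unfold lreq; rw [h]; simp

theorem lab_step (n : ℕ) : (rn ev a (n + 1) n.unpair.1).2.1 = (rn ev a n n.unpair.1).2.1 ∨
    ∃ q, (rn ev a (n + 1) n.unpair.1).2.1 = q :: (rn ev a n n.unpair.1).2.1 := by
  rw [rn_succ]; exact step_lab _ _ _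

theorem lreq_tm' (K M : ℕ) (h : M ≤ K) : tm (lreq ev a) M =
    ∑ e ∈ Finset.range K, ip (e + 1) * lw ((rn ev a M e).2.1.map Prod.snd) := by
  induction M with
  | zero =>
    rw [tm_eq_sum, Finset.sum_range_zero, Finset.sum_eq_zero]
    intro e _
    rw [rn_zero]; simp [initRun]
  | succ M ih =>
    rw [tm_succ, ih (by omega)]
    have hmem : M.unpair.1 ∈ Finset.range K := by
      have := Nat.unpair_left_le M
      simp; omega
    rw [← Finset.add_sum_erase _ _ hmem, ← Finset.add_sum_erase _ (fun e => ip (e + 1) * lw ((rn ev a (M+1) e).2.1.map Prod.snd)) hmem]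
    have hs : ∑ x ∈ (Finset.range K).erase M.unpair.1, ip (x + 1) * lw ((rn ev a M x).2.1.map Prod.snd) =
       ∑ x ∈ (Finset.range K).erase M.unpair.1, ip (x + 1) * lw ((rn ev a (M+1) x).2.1.map Prod.snd) := by
      refine Finset.sum_congr rfl fun x hx => ?_
      rw [rn_succ_ne _ _ _ _ (Finset.ne_of_mem_erase hx)]
    rw [hs]
    rcases lab_step (ev := ev) (a := a) M with h | ⟨q, h⟩
    · rw [lreq_none h, h]; simp [rw']
    · rw [lreq_some h, h, List.map_cons, lw_cons']
      simp only [rw', Option.elim]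
      have : ((2:ℝ) ^ (q.2 + (M.unpair.1 + 1)))⁻¹ = ip (M.unpair.1 + 1) * ip q.2 := by
        rw [mul_comm, ← ip_add]; rfl
      rw [this]
      ring

theorem lreq_tm (H : KH ev a) (M : ℕ) : tm (lreq ev a) M ≤ 3 := by
  rw [lreq_tm' M M le_rfl]
  have : ∀ e, lw ((rn ev a M e).2.1.map Prod.snd) ≤ 3 := by
    intro e
    have h := (ginv H M).1 e
    rw [← W_all fun q hq => (h.hL.hb q hq).1]
    exact inv_W h
  refine (Finset.sum_le_sum (g := fun e => 3 * ip (e + 1)) fun e _ => ?_).trans ?_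
  · have := this e
    have := ip_pos (e + 1)
    nlinarith
  rw [← Finset.mul_sum]
  have : ∀ M, ∑ e ∈ Finset.range M, ip (e + 1) = 1 - ip M := by
    intro M
    induction M with
    | zero => simp [ip]
    | succ M ih =>
      rw [Finset.sum_range_succ, ih, ip_add M 1]
      have : ip 1 = 1 / 2 := by simp [ip]
      rw [this]; ring
  rw [this]
  have := ip_pos M
  linarith

theorem lab_mem {n : ℕ} : ∀ q ∈ (rn ev a n e).2.1, ∃ m, lreq ev a m = Option.some (zeroStr q.1, q.2 + (e + 1)) := by
  induction n with
  | zero => rw [rn_zero]; simp [initRun]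
  | succ n ih =>
    by_cases he : e = n.unpair.1
    · subst he
      intro q hq
      rcases lab_step (ev := ev) (a := a) n with h | ⟨q', h⟩
      · rw [h] at hq; exact ih q hq
      · have h0 := h
        rw [h, List.mem_cons] at hq
        rcases hq with rfl | hq
        · exact ⟨n, lreq_some h0⟩
        · exact ih q hq
    · rw [rn_succ_ne _ _ _ _ he]; exact ih

/-- if the constructed set is trivial then some run gets all the responses -/
theorem responses {U : Str →. Str} (hU : OptimalPF U) (hev : Primrec ev)
    (ha : Primrec (fun p : Bool × ℕ × ℕ => a p.1 p.2.1 p.2.2)) (H : KH ev a)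
    (hcomp : ∀ ρ σ, σ ∈ U ρ → ∃ i, ev i = Option.some (σ, ρ.length)) (ht : KTrivialSet U (XS ev a)) :
    ∃ e, ∀ n, ∀ q ∈ (rn ev a n e).2.1, ∃ T0, ∀ T, T0 ≤ T →
      ip (q.2 + 2 * e) ≤ pm ev T (restrSet (XS ev a) q.1) := by
  obtain ⟨c, hc⟩ := ht
  obtain ⟨c', hc'⟩ := coding hU (lreq_pr hev ha) 3 (fun T => by exact_mod_cast lreq_tm H T)
  refine ⟨1 + c + c', fun n q hq => ?_⟩
  obtain ⟨m, hm⟩ := lab_mem q hq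
  have h1 := hc' _ _ _ (pm_ge_of hm)
  have h2 : KC U (restrSet (XS ev a) q.1) ≤ ((q.2 + 2 * (1 + c + c') : ℕ) : ℕ∞) := by
    refine (hc q.1).trans ((add_le_add_left h1 _).trans ?_)
    norm_cast
    omega
  obtain ⟨ρ, h3, h4⟩ := KC_le_iff.1 h2
  obtain ⟨i, hi⟩ := hcomp _ _ h3
  refine ⟨i + 1, fun T hT => ?_⟩
  exact (ip_le h4).trans ((pm_ge_of hi).trans (pm_mono ev hT _))

theorem next_sched (n e : ℕ) : ∃ n', n ≤ n' ∧ n'.unpair.1 = e ∧ rn ev a n' e = rn ev a n e := by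
  have hex : ∃ k, (n + k).unpair.1 = e := by
    refine ⟨Nat.pair e n - n, ?_⟩
    have := Nat.right_le_pair e n
    rw [show n + (Nat.pair e n - n) = Nat.pair e n by omega, Nat.unpair_pair]
  refine ⟨n + Nat.find hex, by omega, Nat.find_spec hex, ?_⟩
  have hmin := fun k => Nat.find_min hex (m := k)
  generalize Nat.find hex = k at hmin
  induction k with
  | zero => rfl
  | succ k ih =>
    rw [← Nat.add_assoc, rn_succ_ne _ _ _ _ (fun h => hmin k (by omega) h.symm)]
    exact ih fun j hj => hmin j (by omega)

theorem rn_sched {n : ℕ} (h : n.unpair.1 = e) : rn ev a (n + 1) e =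
    (step ev a e (Tn ev a n) (Xn ev a n) (rn ev a n e)).2.2 := by
  subst h; exact rn_succ ev a n

/-- pop result -/
def popF (ev : ℕ → Option (Str × ℕ)) (a : Bool → ℕ → ℕ → Bool) (e T : ℕ) (F G : Frame) : Frame :=
  (G.1, G.2.1, G.2.2.1, popB ev a e T F G :: G.2.2.2)

theorem ret_pop (H : KH ev a) (hr : ∀ n, ∀ q ∈ (rn ev a n e).2.1, ∃ T0, ∀ T, T0 ≤ T →
      ip (q.2 + 2 * e) ≤ pm ev T (restrSet (XS ev a) q.1)) {n L F rest}
    (h : rn ev a n e = (true, L, F :: rest)) :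
    ∃ n1 > n, ∃ T G r', rest = G :: r' ∧ rn ev a n1 e = (false, L, popF ev a e T F G :: r') := by
  by_contra hno
  have key : ∀ n', n ≤ n' → ∃ x, rn ev a n' e = (true, L, (F.1, F.2.1, x, F.2.2.2) :: rest) := by
    intro n' hn'
    induction n', hn' using Nat.le_induction with
    | base => exact ⟨_, h⟩
    | succ n' hn' ih =>
      obtain ⟨x, hx⟩ := ih
      by_cases he : e = n'.unpair.1
      · have h1 := rn_sched (ev := ev) (a := a) he.symm
        have hI := (ginv H n').1 e
        rw [hx] at hI
        obtain ⟨G, r', hrest⟩ := List.exists_cons_of_ne_nil (ret_rest H hI)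
        have h2 := h1
        rw [hx, step_ret] at h1
        unfold stepRet at h1
        dsimp only at h1
        rcases hc1 : resp ev e (Tn ev a n') (Xn ev a n') L F.1 with _ | _ <;> rw [hc1] at h1
        · exact ⟨x, by simpa using h1⟩
        rcases hc2 : actq ev a e (Tn ev a n') L F.1 with _ | _ <;> rw [hc2] at h1
        · exfalso
          refine hno ⟨n' + 1, by omega, Tn ev a n', G, r', hrest, ?_⟩
          rw [h1, hrest]
          rfl
        · exact ⟨x + 1, by simpa using h1⟩
      · rw [rn_succ_ne _ _ _ _ he]; exact ⟨x, hx⟩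
  -- a late stage
  have hlate : ∃ s, n ≤ s ∧ ∀ t, s ≤ t → ∀ q ∈ L, rs (xf (Xn ev a t)) q.1 = restrSet (XS ev a) q.1 ∧
      ip (q.2 + 2 * e) ≤ pm ev (Tn ev a t) (restrSet (XS ev a) q.1) := by
    have hrL := hr n
    rw [h] at hrL
    clear hno key h
    dsimp only at hrL
    induction L with
    | nil => exact ⟨n, le_rfl, by simp⟩
    | cons q L ih =>
      obtain ⟨s, hs, hs'⟩ := ih fun q hq => hrL q (by simp [hq])
      obtain ⟨T0, hT0⟩ := hrL q (by simp)
      obtain ⟨s1, hs1⟩ := XS_stage (ev := ev) (a := a) q.1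
      refine ⟨max s (max T0 s1), by omega, fun t ht q' hq' => ?_⟩
      rw [List.mem_cons] at hq'
      rcases hq' with rfl | hq'
      · have := Tn_ge ev a t
        exact ⟨hs1 t (by omega), hT0 _ (by omega)⟩
      · exact hs' t (by omega) q' hq'
  obtain ⟨s, hs, hs'⟩ := hlate
  obtain ⟨t, hst, hte, -⟩ := next_sched (ev := ev) (a := a) s e
  obtain ⟨x, hx⟩ := key t (by omega)
  have h1 := rn_sched (ev := ev) (a := a) hte
  have hI := (ginv H t).1 e
  rw [hx] at hI
  obtain ⟨G, r', hrest⟩ := List.exists_cons_of_ne_nil (ret_rest H hI)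
  have hresp : resp ev e (Tn ev a t) (Xn ev a t) L F.1 = true := by
    unfold resp
    rw [List.all_eq_true]
    intro q hq
    obtain ⟨h2, h3⟩ := hs' t hst q hq
    rw [Bool.or_eq_true]
    right
    rw [lwle_iff, h2]
    simpa [pm, ip] using h3
  have h1' := h1
  rw [hx, step_ret] at h1
  unfold stepRet at h1
  rcases hact : actq ev a e (Tn ev a t) L F.1 with _ | _
  · refine hno ⟨t + 1, by omega, Tn ev a t, G, r', hrest, ?_⟩
    dsimp only at h1
    rw [h1, hresp, hact, hrest]
    rfl
  · have hXs : Xn ev a (t + 1) = (F.1 + x) :: Xn ev a t := by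
      rw [Xn_succ]
      unfold stn
      rw [hte, hx, step_ret]
      unfold stepRet
      dsimp only
      rw [hresp, hact]
      rfl
    obtain ⟨-, -, -, h4, ⟨q, hq, h5⟩, -⟩ := inv_act H hI hresp hact (dx_le H t) le_rfl
    have h6 := (hs' t hst q hq).1
    have h7 := (hs' (t + 1) (by omega) q hq).1
    rw [← h7, rs_eq_iff] at h6
    have := h6 _ h5
    rw [hXs] at this
    simp [xf, h4] at this

end PartK8

section PartK9
/-! ### Part K : the golden run -/

def fsel (b : Bool) (σ : Str) (recv : List Batch) : List ℕ :=
  recv.filterMap fun B => bif decide (B.2.2.2.1 = b) && decide (B.2.2.2.2 = σ) then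
    Option.some B.2.2.1 else Option.none

def gstream (ρ : ℕ → List Batch) (b : Bool) (n : ℕ) : Option (Str × ℕ) :=
  bif decide ((ρ (n + 1)).length = (ρ n).length + 1) then
    (ρ (n + 1)).head?.bind fun B => bif decide (B.2.2.2.1 = b) then Option.some (B.2.2.2.2, B.2.2.1) else Option.none
  else Option.none

theorem pm_succ (u : ℕ → Option (Str × ℕ)) (n : ℕ) (σ : Str) : pm u (n + 1) σ = pm u n σ + rws (u n) σ := by
  rw [pm_eq_sum, pm_eq_sum, Finset.sum_range_succ]

theorem gstream_pr {ρ : ℕ → List Batch} (hρ : Primrec ρ) (b : Bool) : Primrec (gstream ρ b) := by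
  have h1 : Primrec fun n => ρ (n + 1) := hρ.comp Primrec.succ
  have h2 : Primrec fun B : Batch =>
      bif decide (B.2.2.2.1 = b) then Option.some (B.2.2.2.2, B.2.2.1) else Option.none := by
    have g1 : Primrec fun B : Batch => B.2.2.2 :=
      Primrec.snd.comp (Primrec.snd.comp Primrec.snd)
    have g2 : Primrec fun B : Batch => decide (B.2.2.2.1 = b) :=
      Primrec.eq.decide.comp (Primrec.fst.comp g1) (Primrec.const b)
    have g3 : Primrec fun B : Batch => (B.2.2.2.2, B.2.2.1) :=
      Primrec.pair (Primrec.snd.comp g1) (Primrec.fst.comp (Primrec.snd.comp Primrec.snd))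
    exact Primrec.cond g2 (Primrec.option_some.comp g3) (Primrec.const _)
  have h3 : Primrec fun n => (ρ (n + 1)).head? := Primrec.list_head?.comp h1
  have h4 : Primrec fun n => (ρ (n + 1)).head?.bind fun B : Batch =>
      bif decide (B.2.2.2.1 = b) then Option.some (B.2.2.2.2, B.2.2.1) else Option.none :=
    Primrec.option_bind h3 (h2.comp Primrec.snd)
  have h5 : Primrec fun n => decide ((ρ (n + 1)).length = (ρ n).length + 1) :=
    Primrec.eq.decide.comp (Primrec.list_length.comp h1) (Primrec.succ.comp (Primrec.list_length.comp hρ))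
  exact Primrec.cond h5 h4 (Primrec.const _)

theorem grow_stream {U : Str →. Str} (hU : OptimalPF U) {ρ : ℕ → List Batch} (hρ : Primrec ρ) (h0 : ρ 0 = [])
    (hs : ∀ n, ρ (n + 1) = ρ n ∨ ∃ B, ρ (n + 1) = B :: ρ n) (C : ℕ) (hC : ∀ n, RF (ρ n) ≤ C) (b : Bool) :
    ∃ c : ℕ, ∀ n σ (k : ℕ), ip k ≤ lw (fsel b σ (ρ n)) → KC U σ ≤ k + c := by
  have hpr : Primrec (gstream ρ b) := gstream_pr hρ b
  have h1 : ∀ n, tm (gstream ρ b) n ≤ RF (ρ n) := by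
    intro n
    induction n with
    | zero => rw [tm_eq_sum, h0]; simp [RF]
    | succ n ih =>
      rw [tm_succ]
      rcases hs n with h | ⟨B, h⟩
      · have : gstream ρ b n = Option.none := by unfold gstream; rw [h]; simp
        rw [this, h]; simpa [rw'] using ih
      · have : rw' (gstream ρ b n) ≤ ip B.2.2.1 := by
          unfold gstream; rw [h]
          have := ip_pos B.2.2.1
          by_cases hb : B.2.2.2.1 = b
          · simp [hb, rw', ip]
          · simp [hb, rw', this.le]
        rw [h, RF_cons]; linarith
  have h2 : ∀ n σ, pm (gstream ρ b) n σ = lw (fsel b σ (ρ n)) := by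
    intro n σ
    induction n with
    | zero => rw [pm_eq_sum, h0]; simp [fsel]
    | succ n ih =>
      rw [pm_succ, ih]
      rcases hs n with h | ⟨B, h⟩
      · have : gstream ρ b n = Option.none := by unfold gstream; rw [h]; simp
        rw [this, h]; simp [rws]
      · unfold gstream; rw [h]
        by_cases hb : B.2.2.2.1 = b <;> by_cases hσ : B.2.2.2.2 = σ <;>
          simp [hb, hσ, rws, fsel, add_comm]
  obtain ⟨c, hc⟩ := coding hU hpr C fun T => (h1 T).trans (hC T)
  exact ⟨c, fun n σ k h => hc σ n k (by rw [h2]; exact h)⟩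

def recvAt (d : ℕ) (r : Run) : List Batch := (r.2.2.reverse[d]?).elim [] fun F => F.2.2.2

theorem recvAt_eq {r : Run} {pre rest : List Frame} {F : Frame} (h : r.2.2 = pre ++ F :: rest) :
    recvAt rest.length r = F.2.2.2 := by
  unfold recvAt
  rw [h]
  simp

variable {ev : ℕ → Option (Str × ℕ)} {a : Bool → ℕ → ℕ → Bool} {e : ℕ}

theorem StkOK.mid {T X dx L} {pre rest : List Frame} {F : Frame} (h : StkOK ev a e T X dx L (pre ++ F :: rest)) :
    FrameOK ev a e T X dx L (Nn e - rest.length) F := by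
  induction pre with
  | nil => exact h.2.1
  | cons P pre ih => exact ih h.2.2.2

/-- a frame with given received batches -/
def fr (F : Frame) (recv : List Batch) : Frame := (F.1, F.2.1, F.2.2.1, recv)

theorem track_step {n : ℕ} {pre rest : List Frame} {F : Frame} {recv : List Batch}
    (h : (rn ev a n e).2.2 = pre ++ fr F recv :: rest) (hm : pre = [] → (rn ev a n e).1 = false) :
    ∃ pre' recv', (rn ev a (n + 1) e).2.2 = pre' ++ fr F recv' :: rest ∧
      (recv' = recv ∨ ∃ B, recv' = B :: recv) := by
  by_cases he : e = n.unpair.1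
  swap
  · rw [rn_succ_ne _ _ _ _ he]; exact ⟨pre, recv, h, Or.inl rfl⟩
  rw [rn_sched he.symm]
  generalize Tn ev a n = T
  generalize Xn ev a n = X
  generalize rn ev a n e = r at h hm
  obtain ⟨m, L, stk⟩ := r
  dsimp only at h hm
  subst h
  have hw : ∀ P rest0, ∃ pre0, (stepWork ev a e T X L P rest0).2.2.2.2 = pre0 ++ P :: rest0 := by
    intro P rest0
    unfold stepWork
    cases decide (rest0.length = Nn e) <;> cases lwle [P.2.1] (upl a P.2.2.2 T)
    · exact ⟨[_], rfl⟩
    · exact ⟨[], rfl⟩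
    · exact ⟨[], rfl⟩
    · exact ⟨[], rfl⟩
  cases pre with
  | nil =>
    rw [hm rfl]
    rw [List.nil_append, step_work]
    obtain ⟨pre0, h0⟩ := hw (fr F recv) rest
    exact ⟨pre0, recv, h0, Or.inl rfl⟩
  | cons P pre =>
    rw [List.cons_append]
    cases m
    · rw [step_work]
      obtain ⟨pre0, h0⟩ := hw P (pre ++ fr F recv :: rest)
      exact ⟨pre0 ++ P :: pre, recv, by rw [h0]; simp, Or.inl rfl⟩
    · rw [step_ret]
      unfold stepRet
      cases resp ev e T X L P.1
      · exact ⟨P :: pre, recv, rfl, Or.inl rfl⟩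
      cases actq ev a e T L P.1
      · cases pre with
        | nil => exact ⟨[], popB ev a e T P (fr F recv) :: recv, rfl, Or.inr ⟨_, rfl⟩⟩
        | cons Q pre => exact ⟨popF ev a e T P Q :: pre, recv, rfl, Or.inl rfl⟩
      · exact ⟨_ :: pre, recv, rfl, Or.inl rfl⟩

theorem golden {U : Str →. Str} (hU : OptimalPF U) (hev : Primrec ev)
    (ha : Primrec (fun p : Bool × ℕ × ℕ => a p.1 p.2.1 p.2.2)) (H : KH ev a)
    (hcomp : ∀ ρ σ, σ ∈ U ρ → ∃ i, ev i = Option.some (σ, ρ.length)) {A : Bool → Set ℕ}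
    (hA : ∀ b x, x ∈ A b ↔ ∃ s, a b s x = true) (hnt : ∀ b, ¬ KTrivialSet U (A b))
    (hr : ∀ n, ∀ q ∈ (rn ev a n e).2.1, ∃ T0, ∀ T, T0 ≤ T →
      ip (q.2 + 2 * e) ≤ pm ev T (restrSet (XS ev a) q.1)) (k : ℕ) :
    ∀ n L F rest, rn ev a n e = (false, L, F :: rest) → F.2.2.2 = [] → rest.length + k = Nn e →
      ∃ n1 > n, ∃ L' G r' B, rest = G :: r' ∧ B.2.2.1 = F.2.1 ∧
        rn ev a n1 e = (false, L', fr G (B :: G.2.2.2) :: r') := by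
  induction k with
  | zero =>
    intro n L F rest hn _ hk
    obtain ⟨n', h1, h2, h3⟩ := next_sched (ev := ev) (a := a) n e
    rw [hn] at h3
    have h4 := rn_sched (ev := ev) (a := a) h2
    rw [h3, step_work] at h4
    unfold stepWork at h4
    rw [decide_eq_true (by omega : rest.length = Nn e), cond_true] at h4
    obtain ⟨n1, h5, T, G, r', h6, h7⟩ := ret_pop H hr h4
    exact ⟨n1, by omega, _, G, r', popB ev a e T F G, h6, rfl, h7⟩
  | succ k ih =>
    intro n L0 F rest hn hF0 hk
    by_contra hno
    have hnoret : ∀ n' L recv, n ≤ n' → rn ev a n' e ≠ (true, L, fr F recv :: rest) := by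
      intro n' L recv hn' h
      obtain ⟨n1, h5, T, G, r', h6, h7⟩ := ret_pop H hr h
      exact hno ⟨n1, by omega, _, G, r', popB ev a e T (fr F recv) G, h6, rfl, h7⟩
    have hFF : F = fr F [] := by rw [fr, ← hF0]
    have track : ∀ j, ∃ pre recv, (rn ev a (n + j) e).2.2 = pre ++ fr F recv :: rest ∧
        (pre = [] → (rn ev a (n + j) e).1 = false) := by
      intro j
      induction j with
      | zero => exact ⟨[], [], by rw [Nat.add_zero, hn, ← hFF]; rfl, fun _ => by rw [Nat.add_zero, hn]⟩
      | succ j ihj =>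
        obtain ⟨pre, recv, h1, h2⟩ := ihj
        obtain ⟨pre', recv', h3, h4⟩ := track_step h1 h2
        refine ⟨pre', recv', h3, ?_⟩
        rintro rfl
        rw [← Nat.add_assoc]
        by_contra hc
        rw [Bool.not_eq_false] at hc
        refine hnoret (n + j + 1) (rn ev a (n + j + 1) e).2.1 recv' (by omega) ?_
        refine Prod.ext hc (Prod.ext rfl h3)
    set ρ : ℕ → List Batch := fun j => recvAt rest.length (rn ev a (n + j) e) with hρ
    have hρpr : Primrec ρ := by
      have := rn_pr hev ha
      rw [hρ]; unfold recvAt; fun_prop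
    have hρ0 : ρ 0 = [] := by
      rw [hρ]; dsimp only
      rw [recvAt_eq (pre := []) (F := F) (by rw [Nat.add_zero, hn]; rfl), hF0]
    have hρs : ∀ j, ρ (j + 1) = ρ j ∨ ∃ B, ρ (j + 1) = B :: ρ j := by
      intro j
      obtain ⟨pre, recv, h1, h2⟩ := track j
      obtain ⟨pre', recv', h3, h4⟩ := track_step h1 h2
      rw [hρ]; dsimp only
      rw [recvAt_eq h1, ← Nat.add_assoc, recvAt_eq h3]
      exact h4
    have hRF : ∀ n' pre recv, (rn ev a n' e).2.2 = pre ++ fr F recv :: rest → RF recv ≤ 2 := by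
      intro n' pre recv h
      have h1 := ((ginv H n').1 e).hS
      rw [h] at h1
      have h2 := h1.mid.hR
      have h3 : RF recv ≤ (1 + ip (Nn e)) * ip F.2.1 := h2
      have h4 := ip_le_one (Nn e)
      have h5 := ip_le_one F.2.1
      have h6 := ip_pos F.2.1
      have h7 := ip_pos (Nn e)
      nlinarith
    have hρC : ∀ j, RF (ρ j) ≤ (2 : ℕ) := by
      intro j
      obtain ⟨pre, recv, h1, h2⟩ := track j
      rw [hρ]; dsimp only
      rw [recvAt_eq h1]
      exact_mod_cast hRF _ _ _ h1
    have next_home : ∀ n' L recv, n ≤ n' → rn ev a n' e = (false, L, fr F recv :: rest) →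
        ∃ n1 ≥ n', ∃ n2 > n1, ∃ L' B, B.2.2.1 = pushg ev a e (Tn ev a n1) (fr F recv) ∧
          rn ev a n1 e = (false, L, fr F recv :: rest) ∧
          rn ev a n2 e = (false, L', fr F (B :: recv) :: rest) := by
      intro n' L recv hn' h
      obtain ⟨n1, h1, h2, h3⟩ := next_sched (ev := ev) (a := a) n' e
      rw [h] at h3
      have h4 := rn_sched (ev := ev) (a := a) h2
      rw [h3, step_work] at h4
      unfold stepWork at h4
      rw [decide_eq_false (by omega : ¬ rest.length = Nn e), cond_false] at h4
      rcases hl : lwle [(fr F recv).2.1] (upl a (fr F recv).2.2.2 (Tn ev a n1)) with _ | _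
      · rw [hl, cond_false] at h4
        obtain ⟨n2, h5, L', G, r', B, h6, h7, h8⟩ := ih _ _ _ _ h4 rfl (by simp; omega)
        obtain ⟨rfl, rfl⟩ := List.cons.inj h6
        exact ⟨n1, h1, n2, by omega, L', B, h7, h3, h8⟩
      · rw [hl, cond_true] at h4
        exact absurd h4 (hnoret _ _ _ (by omega))
    have homes : ∀ N, ∃ n' ≥ N, n ≤ n' ∧ ∃ L recv, rn ev a n' e = (false, L, fr F recv :: rest) := by
      intro N
      induction N with
      | zero => exact ⟨n, by omega, le_rfl, L0, [], by rw [← hFF]; exact hn⟩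
      | succ N ihN =>
        obtain ⟨n', h1, h2, L, recv, h3⟩ := ihN
        obtain ⟨n1, h4, n2, h5, L', B, -, -, h6⟩ := next_home n' L recv h2 h3
        exact ⟨n2, by omega, by omega, L', _, h6⟩
    have stuck : ∀ b, ∃ y0 N, ∀ n1 L recv, N ≤ n1 → n ≤ n1 →
        rn ev a n1 e = (false, L, fr F recv :: rest) → yb ev a (bg e F.2.1) b recv (Tn ev a n1) ≤ y0 := by
      intro b
      by_contra hc
      push Not at hc
      refine hnt b ?_
      obtain ⟨c, hcc⟩ := grow_stream hU hρpr hρ0 hρs 2 hρC b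
      refine ⟨bg e F.2.1 + c, fun y => ?_⟩
      refine le_add_of_forall fun k hk => ?_
      obtain ⟨τ, h1, h2⟩ := KC_le_iff.1 hk
      obtain ⟨i, hi⟩ := hcomp _ _ h1
      obtain ⟨s, hs⟩ := exists_stage (H.hm b) (hA b) y
      obtain ⟨n1, L, recv, h3, h4, h5, h6⟩ := hc y (max s (i + 1))
      have h7 := (yb_spec (ev := ev) (a := a) (bg e F.2.1) b recv (Tn ev a n1)).2.2 y h6
      rw [← Bool.not_eq_true, unf_iff, not_lt] at h7
      have hT := Tn_ge ev a n1
      have h8 : filll a b recv (Tn ev a n1) y = fsel b (restrSet (A b) y) recv := by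
        unfold filll fsel
        have : ars a b (Tn ev a n1) y = restrSet (A b) y := by
          rw [restrSet_eq_rs, ars, rs_eq_iff]
          exact hs _ (by omega)
        rw [this]
      have h9 : ρ (n1 - n) = recv := by
        rw [hρ]; dsimp only
        rw [recvAt_eq (pre := []) (F := fr F recv) (by rw [show n + (n1 - n) = n1 by omega, h5]; rfl)]
        rfl
      have h10 := (pm_ge_of hi).trans (pm_mono ev (show i + 1 ≤ Tn ev a n1 by omega) _)
      have h11 := hcc (n1 - n) (restrSet (A b) y) (τ.length + bg e F.2.1) (by
        rw [h9, ← h8, ip_add]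
        refine le_trans ?_ h7
        have := ip_pos y
        have := ip_pos (bg e F.2.1)
        nlinarith)
      refine h11.trans ?_
      norm_cast
      omega
    obtain ⟨y0, N0, hs0⟩ := stuck true
    obtain ⟨y1, N1, hs1⟩ := stuck false
    have grow : ∀ j : ℕ, ∃ n' ≥ max N0 N1, n ≤ n' ∧ ∃ L recv, rn ev a n' e = (false, L, fr F recv :: rest) ∧
        j * ip (y0 + y1 + bg e F.2.1) ≤ RF recv := by
      intro j
      induction j with
      | zero =>
        obtain ⟨n', h1, h2, L, recv, h3⟩ := homes (max N0 N1)
        exact ⟨n', h1, h2, L, recv, h3, by simp [RF_nonneg]⟩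
      | succ j ihj =>
        obtain ⟨n', h1, h2, L, recv, h3, h4⟩ := ihj
        obtain ⟨n1, h5, n2, h6, L', B, h7, h8, h9⟩ := next_home n' L recv h2 h3
        refine ⟨n2, by omega, by omega, L', _, h9, ?_⟩
        have g0 := hs0 n1 L recv (by omega) (by omega) h8
        have g1 := hs1 n1 L recv (by omega) (by omega) h8
        have g2 : B.2.2.1 ≤ y0 + y1 + bg e F.2.1 := by
          rw [h7]; unfold pushg
          change yb ev a (bg e F.2.1) true recv (Tn ev a n1) + yb ev a (bg e F.2.1) false recv (Tn ev a n1) +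
            bg e F.2.1 ≤ _
          omega
        have g3 := ip_le g2
        rw [RF_cons]
        push_cast
        linarith
    obtain ⟨j, hj⟩ := exists_nat_gt (2 / ip (y0 + y1 + bg e F.2.1))
    obtain ⟨n', h1, h2, L, recv, h3, h4⟩ := grow j
    have h5 := hRF n' [] recv (by rw [h3]; rfl)
    rw [div_lt_iff₀ (ip_pos _)] at hj
    linarith

theorem XS_nontrivial {U : Str →. Str} (hU : OptimalPF U) (hev : Primrec ev)
    (ha : Primrec (fun p : Bool × ℕ × ℕ => a p.1 p.2.1 p.2.2)) (H : KH ev a)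
    (hcomp : ∀ ρ σ, σ ∈ U ρ → ∃ i, ev i = Option.some (σ, ρ.length)) {A : Bool → Set ℕ}
    (hA : ∀ b x, x ∈ A b ↔ ∃ s, a b s x = true) (hnt : ∀ b, ¬ KTrivialSet U (A b)) :
    ¬ KTrivialSet U (XS ev a) := by
  intro ht
  obtain ⟨e, hr⟩ := responses hU hev ha H hcomp ht
  obtain ⟨n1, -, L', G, r', B, h, -⟩ := golden hU hev ha H hcomp hA hnt hr (Nn e) 0 [] (0, 0, 0, []) []
    (rn_zero ev a e) rfl (by simp)
  simp at h

/-- no minimal pairs in the `K`-degrees of c.e. sets -/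
theorem partK {U : Str →. Str} (hU : OptimalPF U) :
    ¬ (∃ A D : Set ℕ, CESet A ∧ CESet D ∧ ¬ KTrivialSet U A ∧ ¬ KTrivialSet U D ∧
        ∀ X : Set ℕ, CESet X → KLeSet U X A → KLeSet U X D → KTrivialSet U X) := by
  rintro ⟨A, D, hA, hD, hAt, hDt, hX⟩
  obtain ⟨ev, hev, h1, hcomp, htm⟩ := events_pf hU.1
  obtain ⟨a1, ha1, hm1, hs1⟩ := ce_enum hA
  obtain ⟨a2, ha2, hm2, hs2⟩ := ce_enum hD
  let a : Bool → ℕ → ℕ → Bool := fun b s x => bif b then a1 s x else a2 s x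
  have ha : Primrec (fun p : Bool × ℕ × ℕ => a p.1 p.2.1 p.2.2) := by
    show Primrec (fun p : Bool × ℕ × ℕ => bif p.1 then a1 p.2.1 p.2.2 else a2 p.2.1 p.2.2)
    fun_prop
  have H : KH ev a := by
    refine ⟨?_, htm, ?_⟩
    · intro b s t x hst h
      cases b
      · exact hm2 s t x hst h
      · exact hm1 s t x hst h
    · intro i
      rcases h : ev i with _ | ⟨σ, ℓ⟩
      · simp [es, h]
      · simpa [es, h] using (h1 i σ ℓ h).2
  refine XS_nontrivial hU hev ha H hcomp (A := fun b => bif b then A else D) ?_ ?_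
    (hX (XS ev a) (XS_ce hev ha) (XS_le hU hev ha H hcomp true A hs1) (XS_le hU hev ha H hcomp false D hs2))
  · intro b x
    cases b
    · exact hs2 x
    · exact hs1 x
  · intro b
    cases b
    · exact hDt
    · exact hAt

end PartK9

section PartC1
/-! ### Part C : enumerations and version counting -/

/-- uniform enumeration of the c.e. sets -/
def wn (i s x : ℕ) : Bool :=
  (Nat.Partrec.Code.evaln s (Denumerable.ofNat Nat.Partrec.Code i) x).isSome

@[fun_prop] theorem wn_pr : Primrec fun p : ℕ × ℕ × ℕ => wn p.1 p.2.1 p.2.2 := by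
  unfold wn; fun_prop

theorem wn_mono (i s t x : ℕ) (hst : s ≤ t) (h : wn i s x = true) : wn i t x = true := by
  obtain ⟨y, hy⟩ := Option.isSome_iff_exists.1 h
  have := Nat.Partrec.Code.evaln_mono hst (Option.mem_def.2 hy)
  unfold wn
  rw [Option.isSome_iff_exists]; exact ⟨y, this⟩

theorem ce_index {A : Set ℕ} (h : CESet A) : ∃ i, ∀ x, x ∈ A ↔ ∃ s, wn i s x = true := by
  obtain ⟨f, hf, hA⟩ := h
  obtain ⟨c, hc⟩ := Nat.Partrec.Code.exists_code.1 hf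
  refine ⟨Encodable.encode c, fun x => ?_⟩
  unfold wn
  rw [Denumerable.ofNat_encode, hA, ← hc, Part.dom_iff_mem]
  constructor
  · rintro ⟨y, hy⟩
    obtain ⟨k, hk⟩ := Nat.Partrec.Code.evaln_complete.1 hy
    exact ⟨k, Option.isSome_iff_exists.2 ⟨y, hk⟩⟩
  · rintro ⟨k, hk⟩
    obtain ⟨y, hy⟩ := Option.isSome_iff_exists.1 hk
    exact ⟨y, Nat.Partrec.Code.evaln_sound (Option.mem_def.2 hy)⟩

/-- number with binary digits given by a string (least significant first), with a leading one -/
def num (l : Str) : ℕ := l.foldr (fun b n => 2 * n + bif b then 1 else 0) 1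

@[fun_prop] theorem num_pr : Primrec num := by unfold num; fun_prop

theorem num_cons (b : Bool) (l : Str) : num (b :: l) = 2 * num l + bif b then 1 else 0 := rfl

theorem num_lt (l : Str) : num l < 2 ^ (l.length + 1) := by
  induction l with
  | nil => simp [num]
  | cons b l ih => rw [num_cons, List.length_cons, pow_succ]; cases b <;> simp <;> omega

theorem num_pos (l : Str) : 0 < num l := by
  induction l with
  | nil => simp [num]
  | cons b l ih => rw [num_cons]; omega

theorem num_inj {l m : Str} (h : num l = num m) : l = m := by
  induction l generalizing m with
  | nil =>
    cases m with
    | nil => rfl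
    | cons b m => rw [num_cons] at h; have := num_pos m; change 1 = _ at h; omega
  | cons b l ih =>
    cases m with
    | nil => rw [num_cons] at h; have := num_pos l; change _ = 1 at h; omega
    | cons c m =>
      rw [num_cons, num_cons] at h
      cases b <;> cases c <;> simp at h <;> first | omega | (rw [ih (by omega)])

theorem num_surj (j n : ℕ) (h1 : 2 ^ j ≤ n) (h2 : n < 2 ^ (j + 1)) : ∃ l : Str, l.length = j ∧ num l = n := by
  induction j generalizing n with
  | zero => exact ⟨[], rfl, by simp [num]; omega⟩
  | succ j ih =>
    rw [pow_succ] at h1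
    rw [pow_succ] at h2
    obtain ⟨l, hl, hn⟩ := ih (n / 2) (by omega) (by omega)
    refine ⟨decide (n % 2 = 1) :: l, by simp [hl], ?_⟩
    rw [num_cons, hn]
    by_cases h : n % 2 = 1 <;> simp [h] <;> omega

section
variable (ev : ℕ → Option (Str × ℕ))

def wrs (i s n : ℕ) : Str := rs (wn i s) n

def hitq (k : ℕ) (σ : Str) (b : ℕ) : Bool := (ev k).elim false fun q =>
    decide (q.1 = σ) && decide (q.2 ≤ b)

/-- all lengths in the block `j` are compressible at stage `s` -/
def gd (i c s j : ℕ) : Bool :=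
  (List.range (2 ^ j)).all fun m => (List.range s).any fun k =>
    hitq ev k (wrs i s (2 ^ j + m)) (j + c)

def vnew (i c j t : ℕ) : Bool :=
  gd ev i c t j && (List.range t).all fun u => !(gd ev i c u j) || !(decide (wrs i u (2 ^ j) = wrs i t (2 ^ j)))

def ver (i c j s : ℕ) : ℕ := ((List.range (s + 1)).filter (vnew ev i c j)).length

variable {ev}

@[fun_prop] theorem wrs_pr : Primrec fun p : ℕ × ℕ × ℕ => wrs p.1 p.2.1 p.2.2 := by
  unfold wrs rs; fun_prop

theorem hitq_pr (h : Primrec ev) : Primrec fun p : ℕ × Str × ℕ => hitq ev p.1 p.2.1 p.2.2 := by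
  unfold hitq; fun_prop

theorem gd_pr (h : Primrec ev) : Primrec fun p : ℕ × ℕ × ℕ × ℕ => gd ev p.1 p.2.1 p.2.2.1 p.2.2.2 := by
  have h0 := hitq_pr h
  unfold gd; fun_prop

theorem vnew_pr (h : Primrec ev) : Primrec fun p : ℕ × ℕ × ℕ × ℕ => vnew ev p.1 p.2.1 p.2.2.1 p.2.2.2 := by
  have h1 := gd_pr h
  unfold vnew; fun_prop

theorem ver_pr (h : Primrec ev) : Primrec fun p : ℕ × ℕ × ℕ × ℕ => ver ev p.1 p.2.1 p.2.2.1 p.2.2.2 := by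
  have h1 := vnew_pr h
  unfold ver; fun_prop

theorem ver_eq (i c j s : ℕ) :
    ver ev i c j s = ((Finset.range (s + 1)).filter fun t => vnew ev i c j t = true).card := by
  unfold ver
  rw [← List.toFinset_card_of_nodup (List.nodup_range.filter _)]
  congr 1
  ext t; simp

theorem ver_mono (i c j : ℕ) {s t : ℕ} (h : s ≤ t) : ver ev i c j s ≤ ver ev i c j t := by
  rw [ver_eq, ver_eq]
  apply Finset.card_le_card
  intro u hu
  simp only [Finset.mem_filter, Finset.mem_range] at *
  exact ⟨by omega, hu.2⟩

theorem gd_iff {i c s j : ℕ} : gd ev i c s j = true ↔ ∀ n, 2 ^ j ≤ n → n < 2 ^ (j + 1) →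
    ∃ k < s, ∃ ℓ, ev k = Option.some (rs (wn i s) n, ℓ) ∧ ℓ ≤ j + c := by
  unfold gd hitq wrs
  simp only [List.all_eq_true, List.mem_range, List.any_eq_true]
  constructor
  · intro h n h1 h2
    obtain ⟨k, hk, hq⟩ := h (n - 2 ^ j) (by rw [pow_succ] at h2; omega)
    refine ⟨k, hk, ?_⟩
    rw [show 2 ^ j + (n - 2 ^ j) = n by omega] at hq
    rcases he : ev k with _ | ⟨σ, ℓ⟩
    · simp [he] at hq
    · simp only [he, Option.elim, Bool.and_eq_true, decide_eq_true_eq] at hq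
      exact ⟨ℓ, by rw [hq.1], hq.2⟩
  · intro h m hm
    obtain ⟨k, hk, ℓ, h1, h2⟩ := h (2 ^ j + m) (by omega) (by rw [pow_succ]; omega)
    exact ⟨k, hk, by simp [h1, h2]⟩

theorem vnew_iff {i c j t : ℕ} : vnew ev i c j t = true ↔ gd ev i c t j = true ∧
    ∀ u < t, gd ev i c u j = true → rs (wn i u) (2 ^ j) ≠ rs (wn i t) (2 ^ j) := by
  unfold vnew wrs
  simp only [Bool.and_eq_true, List.all_eq_true, List.mem_range, Bool.or_eq_true, Bool.not_eq_true',
    decide_eq_false_iff_not]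
  refine and_congr_right fun _ => forall₂_congr fun u hu => ?_
  cases gd ev i c u j <;> simp

/-- if the version count does not move, a good string was already seen -/
theorem ver_same {i c j s s' : ℕ} (hs : s ≤ s') (hv : ver ev i c j s' ≤ ver ev i c j s)
    (hg : gd ev i c s' j = true) : ∀ x < 2 ^ j, wn i s' x = wn i s x := by
  have hex : ∃ t, gd ev i c t j = true ∧ rs (wn i t) (2 ^ j) = rs (wn i s') (2 ^ j) := ⟨s', hg, rfl⟩
  have hnew : vnew ev i c j (Nat.find hex) = true := by
    rw [vnew_iff]
    refine ⟨(Nat.find_spec hex).1, fun u hu hgu he => ?_⟩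
    exact Nat.find_min hex hu ⟨hgu, he.trans (Nat.find_spec hex).2⟩
  have hle : Nat.find hex ≤ s' := Nat.find_min' hex ⟨hg, rfl⟩
  have hsub : ((Finset.range (s + 1)).filter fun t => vnew ev i c j t = true) =
      (Finset.range (s' + 1)).filter fun t => vnew ev i c j t = true := by
    apply Finset.eq_of_subset_of_card_le
    · intro u hu
      simp only [Finset.mem_filter, Finset.mem_range] at *
      exact ⟨by omega, hu.2⟩
    · rw [← ver_eq, ← ver_eq]; exact hv
  have hmem : Nat.find hex ∈ (Finset.range (s' + 1)).filter fun t => vnew ev i c j t = true := by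
    simp only [Finset.mem_filter, Finset.mem_range]; exact ⟨by omega, hnew⟩
  rw [← hsub] at hmem
  simp only [Finset.mem_filter, Finset.mem_range] at hmem
  have h2 := rs_eq_iff.1 (Nat.find_spec hex).2
  intro x hx
  have := h2 x hx
  cases h : wn i s' x with
  | false =>
    cases h' : wn i s x with
    | false => rfl
    | true => rw [wn_mono i s s' x hs h'] at h; exact absurd h (by simp)
  | true =>
    rw [h] at this
    exact (wn_mono i _ s x (by omega) this).symm

variable {V : Str →. Str} {d : ℕ → Str}

theorem ver_bound (hd : ∀ i σ ℓ, ev i = Option.some (σ, ℓ) → (d i).length = ℓ ∧ σ ∈ V (d i) ∧ σ.length ≤ i)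
    (i c j s : ℕ) : ver ev i c j s ≤ 2 ^ (c + 1) := by
  rw [ver_eq]
  set T := (Finset.range (s + 1)).filter fun t => vnew ev i c j t = true with hT
  have key : ∀ p : ℕ × ℕ, p ∈ T ×ˢ Finset.range (2 ^ j) → ∃ ρ : Str, ρ.length ≤ j + c ∧
      rs (wn i p.1) (2 ^ j + p.2) ∈ V ρ := by
    rintro ⟨t, m⟩ hp
    simp only [Finset.mem_product, hT, Finset.mem_filter, Finset.mem_range] at hp
    obtain ⟨k, _, ℓ, h1, h2⟩ := gd_iff.1 (vnew_iff.1 hp.1.2).1 (2 ^ j + m) (by omega) (by rw [pow_succ]; omega)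
    obtain ⟨h3, h4, _⟩ := hd _ _ _ h1
    exact ⟨d k, by omega, h4⟩
  choose! f hf using key
  have hcard : (T ×ˢ Finset.range (2 ^ j)).card ≤ (Finset.range (2 ^ (j + c + 1))).card := by
    apply Finset.card_le_card_of_injOn (fun p => num (f p))
    · intro p hp
      have := num_lt (f p)
      have h2 := (hf p hp).1
      simp only [Finset.coe_range, Set.mem_Iio]
      exact this.trans_le (Nat.pow_le_pow_right (by norm_num) (by omega))
    · intro p hp q hq h
      have h1 := num_inj h
      have h2 := (hf p hp).2
      have h3 := (hf q hq).2
      rw [h1] at h2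
      have h4 := Part.mem_unique h2 h3
      have h5 : 2 ^ j + p.2 = 2 ^ j + q.2 := by simpa using congrArg List.length h4
      have h6 : p.2 = q.2 := by omega
      rw [← h6] at h4
      have h7 : rs (wn i p.1) (2 ^ j) = rs (wn i q.1) (2 ^ j) :=
        rs_eq_iff.2 fun x hx => rs_eq_iff.1 h4 x (by omega)
      simp only [Finset.coe_product, Set.mem_prod, Finset.mem_coe, hT, Finset.mem_filter] at hp hq
      have h8 := vnew_iff.1 hp.1.2
      have h9 := vnew_iff.1 hq.1.2
      have h10 : p.1 = q.1 := by
        rcases lt_trichotomy p.1 q.1 with h | h | h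
        · exact absurd h7 (h9.2 _ h h8.1)
        · exact h
        · exact absurd h7.symm (h8.2 _ h h9.1)
      exact Prod.ext h10 h6
  rw [Finset.card_product, Finset.card_range, Finset.card_range,
    show j + c + 1 = (c + 1) + j by ring, pow_add] at hcard
  exact Nat.le_of_mul_le_mul_right hcard (by positivity)

/-- eventual value of the version count on an infinite set -/
theorem ver_choice (hd : ∀ i σ ℓ, ev i = Option.some (σ, ℓ) → (d i).length = ℓ ∧ σ ∈ V (d i) ∧ σ.length ≤ i)
    (i c : ℕ) (S : ℕ → Prop) (hS : ∀ N, ∃ j, N < j ∧ S j) :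
    ∃ v j0, (∀ j, S j → j0 < j → ∀ s, ver ev i c j s ≤ v) ∧
      ∀ N, ∃ j, N < j ∧ S j ∧ ∃ s, ∀ t, s ≤ t → ver ev i c j t = v := by
  let P : ℕ → Prop := fun v => ∃ j0, ∀ j, S j → j0 < j → ∀ s, ver ev i c j s ≤ v
  have hex : ∃ v, P v := ⟨2 ^ (c + 1), 0, fun j _ _ s => ver_bound hd i c j s⟩
  obtain ⟨j0, hj0⟩ := Nat.find_spec hex
  refine ⟨Nat.find hex, j0, hj0, fun N => ?_⟩
  by_cases h0 : Nat.find hex = 0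
  · obtain ⟨j, hj, hs⟩ := hS (max N j0)
    refine ⟨j, by omega, hs, 0, fun t _ => ?_⟩
    have := hj0 j hs (by omega) t
    omega
  · have h1 := Nat.find_min hex (m := Nat.find hex - 1) (by omega)
    have h2 : ¬ ∀ j, S j → max N j0 < j → ∀ s, ver ev i c j s ≤ Nat.find hex - 1 := fun h => h1 ⟨_, h⟩
    push Not at h2
    obtain ⟨j, hs, hj, s, hv⟩ := h2
    refine ⟨j, by omega, hs, s, fun t ht => ?_⟩
    have h3 := hj0 j hs (by omega) t
    have h4 := ver_mono (ev := ev) i c j ht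
    omega

theorem gd_of_KC (he : ∀ ρ σ, σ ∈ V ρ → ∃ i, ev i = Option.some (σ, ρ.length)) {X : Set ℕ} {i : ℕ}
    (hX : ∀ x, x ∈ X ↔ ∃ s, wn i s x = true) {c j : ℕ}
    (h : ∀ n, 2 ^ j ≤ n → n < 2 ^ (j + 1) → KC V (restrSet X n) ≤ (j + c : ℕ)) :
    ∃ s0, ∀ s, s0 ≤ s → gd ev i c s j = true := by
  obtain ⟨s1, hs1⟩ := exists_stage (wn_mono i) hX (2 ^ (j + 1))
  have key : ∀ n, ∃ k, 2 ^ j ≤ n → n < 2 ^ (j + 1) →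
      ∃ ℓ, ev k = Option.some (restrSet X n, ℓ) ∧ ℓ ≤ j + c := by
    intro n
    by_cases hn : 2 ^ j ≤ n ∧ n < 2 ^ (j + 1)
    · obtain ⟨ρ, h1, h2⟩ := KC_le_iff.1 (h n hn.1 hn.2)
      obtain ⟨k, hk⟩ := he _ _ h1
      exact ⟨k, fun _ _ => ⟨_, hk, h2⟩⟩
    · exact ⟨0, fun a b => absurd ⟨a, b⟩ hn⟩
  choose k hk using key
  refine ⟨s1 + (∑ n ∈ Finset.range (2 ^ (j + 1)), k n) + 1, fun s hs => gd_iff.2 fun n h1 h2 => ?_⟩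
  obtain ⟨ℓ, h3, h4⟩ := hk n h1 h2
  have h5 : k n ≤ ∑ n ∈ Finset.range (2 ^ (j + 1)), k n :=
    Finset.single_le_sum (f := k) (fun _ _ => Nat.zero_le _) (Finset.mem_range.2 h2)
  refine ⟨k n, by omega, ℓ, ?_, h4⟩
  rw [h3, restrSet_eq_rs]
  congr 2
  exact (rs_eq_iff.2 fun x hx => hs1 s (by omega) x (by omega)).symm

/-- Chaitin's argument -/
theorem chaitin (hev : Primrec ev)
    (hd : ∀ i σ ℓ, ev i = Option.some (σ, ℓ) → (d i).length = ℓ ∧ σ ∈ V (d i) ∧ σ.length ≤ i)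
    {X : Set ℕ} {i : ℕ} (hX : ∀ x, x ∈ X ↔ ∃ s, wn i s x = true) (c : ℕ)
    (h : ∀ j, ∃ s0, ∀ s, s0 ≤ s → gd ev i c s j = true) : CESet Xᶜ := by
  obtain ⟨v, j0, h1, h2⟩ := ver_choice hd i c (fun _ => True) (fun N => ⟨N + 1, by omega, trivial⟩)
  let a : ℕ → ℕ → Bool := fun m x => decide (j0 < m.unpair.1) && decide (x < m.unpair.1) &&
    decide (ver ev i c m.unpair.1 m.unpair.2 = v) && !(wn i m.unpair.2 x)
  have ha : Primrec fun p : ℕ × ℕ => a p.1 p.2 := by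
    have := ver_pr hev
    simp only [a]; fun_prop
  have : Xᶜ = {x | ∃ m, a m x = true} := by
    ext x
    simp only [Set.mem_compl_iff, Set.mem_ofPred_eq, a, Bool.and_eq_true, decide_eq_true_eq, Bool.not_eq_true']
    constructor
    · intro hx
      obtain ⟨j, hj, -, s, hs⟩ := h2 (max j0 x)
      refine ⟨Nat.pair j s, ?_⟩
      simp only [Nat.unpair_pair]
      refine ⟨⟨⟨by omega, by omega⟩, hs s le_rfl⟩, ?_⟩
      rw [← Bool.not_eq_true]
      exact fun hc => hx ((hX x).2 ⟨s, hc⟩)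
    · rintro ⟨m, ⟨⟨hm1, hm2⟩, hm3⟩, hm4⟩ hx
      set j := m.unpair.1
      set s := m.unpair.2
      obtain ⟨s1, hs1⟩ := (hX x).1 hx
      obtain ⟨s0, hs0⟩ := h j
      let s' := max s (max s0 s1)
      have := ver_same (ev := ev) (i := i) (c := c) (j := j) (s := s) (s' := s') (le_max_left _ _)
        (by rw [hm3]; exact h1 j trivial hm1 s') (hs0 s' (by simp [s'])) x
        (hm2.trans Nat.lt_two_pow_self)
      rw [hm4, wn_mono i s1 s' x (by simp [s']) hs1] at this
      exact absurd this (by simp)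
  rw [this]
  exact ce_of_enum ha

end

end PartC1

section PartC2
/-! ### Part C : the construction -/

def cde (H : List (Str × ℕ)) (t : ℕ) : Str := (H[t]?.getD ([], 0)).1
def cac (H : List (Str × ℕ)) (t : ℕ) : ℕ := (H[t]?.getD ([], 0)).2
@[fun_prop] theorem cde_pr : Primrec fun p : List (Str × ℕ) × ℕ => cde p.1 p.2 := by
  unfold cde; fun_prop
@[fun_prop] theorem cac_pr : Primrec fun p : List (Str × ℕ) × ℕ => cac p.1 p.2 := by
  unfold cac; fun_prop

def agr (n : ℕ) (δ α : Str) : Bool := (List.range n).all fun j => decide (δ[j]? = α[j]?)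
@[fun_prop] theorem agr_pr : Primrec fun p : ℕ × Str × Str => agr p.1 p.2.1 p.2.2 := by
  unfold agr; fun_prop
def lft (n : ℕ) (δ α : Str) : Bool := (List.range n).any fun i =>
  agr i δ α && decide (δ[i]? = Option.some false) && decide (α[i]? = Option.some true)
@[fun_prop] theorem lft_pr : Primrec fun p : ℕ × Str × Str => lft p.1 p.2.1 p.2.2 := by
  unfold lft; fun_prop
def vis (H : List (Str × ℕ)) (e : ℕ) (α : Str) (t : ℕ) : Bool :=
  agr e (cde H t) α && decide ((cde H t)[e]? = Option.some false)
@[fun_prop] theorem vis_pr : Primrec fun p : List (Str × ℕ) × ℕ × Str × ℕ => vis p.1 p.2.1 p.2.2.1 p.2.2.2 := by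
  unfold vis; fun_prop

def col (y : ℕ) : ℕ := y.unpair.1
def typ (y : ℕ) : Bool := decide (y.unpair.1 % 2 = 1)
@[fun_prop] theorem col_pr : Primrec col := by unfold col; fun_prop
@[fun_prop] theorem typ_pr : Primrec typ := by unfold typ; fun_prop

def TTa (j : ℕ) (b : Bool) (t v : ℕ) : Bool :=
  decide (t < j) || decide (v = 0) || !(decide (typ (v - 1) = b)) || decide (j + 1 < v)
@[fun_prop] theorem TTa_pr : Primrec fun p : ℕ × Bool × ℕ × ℕ => TTa p.1 p.2.1 p.2.2.1 p.2.2.2 := by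
  unfold TTa; fun_prop
def TT (H : List (Str × ℕ)) (s : ℕ) (b : Bool) (j : ℕ) : Bool :=
  (List.range s).all fun t => TTa j b t (cac H t)
@[fun_prop] theorem TT_pr : Primrec fun p : List (Str × ℕ) × ℕ × Bool × ℕ => TT p.1 p.2.1 p.2.2.1 p.2.2.2 := by
  unfold TT; fun_prop

def prI (e : ℕ) : ℕ := e.unpair.1
def prC (e : ℕ) : ℕ := e.unpair.2.unpair.1
def prJ (e : ℕ) : ℕ := e.unpair.2.unpair.2.unpair.1
def prV (e : ℕ) (b : Bool) : ℕ := bif b then e.unpair.2.unpair.2.unpair.2.unpair.1 else e.unpair.2.unpair.2.unpair.2.unpair.2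
@[fun_prop] theorem prI_pr : Primrec prI := by unfold prI; fun_prop
@[fun_prop] theorem prC_pr : Primrec prC := by unfold prC; fun_prop
@[fun_prop] theorem prJ_pr : Primrec prJ := by unfold prJ; fun_prop
@[fun_prop] theorem prV_pr : Primrec fun p : ℕ × Bool => prV p.1 p.2 := by unfold prV; fun_prop

def cver (ev : ℕ → Option (Str × ℕ)) (e j s : ℕ) : ℕ := ver ev (prI e) (prC e) j s
def cgd (ev : ℕ → Option (Str × ℕ)) (e j s : ℕ) : Bool := gd ev (prI e) (prC e) s j

def allvis (H : List (Str × ℕ)) (s e : ℕ) (α : Str) (j : ℕ) : Bool :=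
  (List.range s).all fun t => !(vis H e α t) || decide (t < j)
@[fun_prop] theorem allvis_pr : Primrec fun p : List (Str × ℕ) × ℕ × ℕ × Str × ℕ =>
    allvis p.1 p.2.1 p.2.2.1 p.2.2.2.1 p.2.2.2.2 := by
  unfold allvis; fun_prop

section
variable (ev : ℕ → Option (Str × ℕ))

def tst1 (H : List (Str × ℕ)) (s e : ℕ) (α : Str) (L : ℕ) (b : Bool) : Bool :=
  (List.range (L + 1)).any fun j => decide (prJ e < j) && allvis H s e α j && TT H s b j &&
    decide (cver ev e j s = prV e b)
def tst2 (H : List (Str × ℕ)) (s e : ℕ) (L : ℕ) (b : Bool) : Bool :=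
  (List.range (L + 1)).all fun j => decide (j ≤ prJ e) || !(TT H s b j) ||
    (cgd ev e j s && decide (cver ev e j s ≤ prV e b))
def tst (H : List (Str × ℕ)) (s e : ℕ) (α : Str) : Bool :=
  (List.range (s + 1)).any fun L => tst1 ev H s e α L true && tst1 ev H s e α L false &&
    tst2 ev H s e L true && tst2 ev H s e L false
def cdelta (H : List (Str × ℕ)) (s n : ℕ) : Str :=
  (List.range n).foldl (fun acc e => acc ++ [!(tst ev H s e acc)]) []

def eligA (x t v : ℕ) : Bool := decide (v = 0) || (!(decide (col (v - 1) = col x)) &&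
  (decide (col x ≤ col (v - 1)) || decide (t + 1 < x)))
def eligB (H : List (Str × ℕ)) (δ : Str) (x t : ℕ) : Bool :=
  !(lft (col x + 1) (cde H t) δ) || decide (t < x)
def elig (H : List (Str × ℕ)) (s : ℕ) (δ : Str) (x : ℕ) : Bool :=
  wn (col x / 2) s x && decide (col x < s) && ((List.range s).all fun t => eligA x t (cac H t)) &&
    (List.range s).all fun t => eligB H δ x t
def cact (H : List (Str × ℕ)) (s : ℕ) (δ : Str) : ℕ :=
  ((List.range s).find? fun x => elig H s δ x).elim 0 fun x => x + 1
def cstep (H : List (Str × ℕ)) : Str × ℕ :=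
  (cdelta ev H H.length H.length, cact H H.length (cdelta ev H H.length H.length))
def hist (n : ℕ) : List (Str × ℕ) := n.rec [] fun _ H => H ++ [cstep ev H]

variable {ev}
theorem cver_pr (h : Primrec ev) : Primrec fun p : ℕ × ℕ × ℕ => cver ev p.1 p.2.1 p.2.2 := by
  have := ver_pr h
  unfold cver; fun_prop
theorem cgd_pr (h : Primrec ev) : Primrec fun p : ℕ × ℕ × ℕ => cgd ev p.1 p.2.1 p.2.2 := by
  have := gd_pr h
  unfold cgd; fun_prop
theorem tst1_pr (h : Primrec ev) : Primrec fun p : List (Str × ℕ) × ℕ × ℕ × Str × ℕ × Bool =>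
    tst1 ev p.1 p.2.1 p.2.2.1 p.2.2.2.1 p.2.2.2.2.1 p.2.2.2.2.2 := by
  have := cver_pr h
  unfold tst1; fun_prop
theorem tst2_pr (h : Primrec ev) : Primrec fun p : List (Str × ℕ) × ℕ × ℕ × ℕ × Bool =>
    tst2 ev p.1 p.2.1 p.2.2.1 p.2.2.2.1 p.2.2.2.2 := by
  have := cver_pr h
  have := cgd_pr h
  unfold tst2; fun_prop
theorem tst_pr (h : Primrec ev) : Primrec fun p : List (Str × ℕ) × ℕ × ℕ × Str =>
    tst ev p.1 p.2.1 p.2.2.1 p.2.2.2 := by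
  have := tst1_pr h
  have := tst2_pr h
  unfold tst; fun_prop
theorem cdelta_pr (h : Primrec ev) : Primrec fun p : List (Str × ℕ) × ℕ × ℕ =>
    cdelta ev p.1 p.2.1 p.2.2 := by
  have := tst_pr h
  unfold cdelta; fun_prop
@[fun_prop] theorem eligA_pr : Primrec fun p : ℕ × ℕ × ℕ => eligA p.1 p.2.1 p.2.2 := by
  unfold eligA; fun_prop
@[fun_prop] theorem eligB_pr : Primrec fun p : List (Str × ℕ) × Str × ℕ × ℕ => eligB p.1 p.2.1 p.2.2.1 p.2.2.2 := by
  unfold eligB; fun_prop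
@[fun_prop] theorem elig_pr : Primrec fun p : List (Str × ℕ) × ℕ × Str × ℕ => elig p.1 p.2.1 p.2.2.1 p.2.2.2 := by
  unfold elig; fun_prop
@[fun_prop] theorem cact_pr : Primrec fun p : List (Str × ℕ) × ℕ × Str => cact p.1 p.2.1 p.2.2 := by
  unfold cact; fun_prop
theorem cstep_pr (h : Primrec ev) : Primrec (cstep ev) := by
  have := cdelta_pr h
  unfold cstep; fun_prop
theorem hist_pr (h : Primrec ev) : Primrec (hist ev) := by
  have h1 := cstep_pr h
  exact Primrec.nat_rec₁ [] (f := fun _ H => H ++ [cstep ev H])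
    (Primrec.list_append.comp Primrec.snd (Primrec.list_cons.comp (h1.comp Primrec.snd) (Primrec.const [])))
end

end PartC2

section PartC3
/-! ### Part C : specification of the construction -/

def Agr (n : ℕ) (δ α : Str) : Prop := ∀ j < n, δ[j]? = α[j]?
def Lft (n : ℕ) (δ α : Str) : Prop :=
  ∃ i < n, Agr i δ α ∧ δ[i]? = Option.some false ∧ α[i]? = Option.some true
def Vis (e : ℕ) (δ α : Str) : Prop := Agr e δ α ∧ δ[e]? = Option.some false
def TTP (Ac : ℕ → ℕ) (b : Bool) (j s : ℕ) : Prop :=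
  ∀ t < s, j ≤ t → ∀ y, Ac t = y + 1 → typ y = b → j < y
def TestP (ev : ℕ → Option (Str × ℕ)) (D : ℕ → Str) (Ac : ℕ → ℕ) (e s : ℕ) : Prop :=
  ∃ L ≤ s, ∀ b, (∃ j ≤ L, prJ e < j ∧ (∀ t < s, Vis e (D t) (D s) → t < j) ∧ TTP Ac b j s ∧
      cver ev e j s = prV e b) ∧
    ∀ j ≤ L, prJ e < j → TTP Ac b j s → cgd ev e j s = true ∧ cver ev e j s ≤ prV e b
def EligP (D : ℕ → Str) (Ac : ℕ → ℕ) (s x : ℕ) : Prop :=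
  wn (col x / 2) s x = true ∧ col x < s ∧
    (∀ t < s, ∀ y, Ac t = y + 1 → col y ≠ col x ∧ (col y < col x → t + 1 < x)) ∧
    ∀ t < s, Lft (col x + 1) (D t) (D s) → t < x

structure CSpec (ev : ℕ → Option (Str × ℕ)) (D : ℕ → Str) (Ac : ℕ → ℕ) : Prop where
  hD : Primrec D
  hA : Primrec Ac
  d_len : ∀ s, (D s).length = s
  d_spec : ∀ s e, (D s)[e]? = Option.some false ↔ e < s ∧ TestP ev D Ac e s
  a1 : ∀ s x, Ac s = x + 1 → EligP D Ac s x
  a2 : ∀ s x, x < s → EligP D Ac s x → ∃ y, y ≤ x ∧ Ac s = y + 1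

theorem agr_iff {n : ℕ} {δ α : Str} : agr n δ α = true ↔ Agr n δ α := by
  simp [agr, Agr]
theorem lft_iff {n : ℕ} {δ α : Str} : lft n δ α = true ↔ Lft n δ α := by
  simp [lft, Lft, agr_iff, and_assoc]

section
variable (ev : ℕ → Option (Str × ℕ))
def DD (s : ℕ) : Str := (cstep ev (hist ev s)).1
def AA (s : ℕ) : ℕ := (cstep ev (hist ev s)).2
variable {ev}

theorem hist_succ (n : ℕ) : hist ev (n + 1) = hist ev n ++ [cstep ev (hist ev n)] := rfl
theorem hist_length (n : ℕ) : (hist ev n).length = n := by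
  induction n with
  | zero => rfl
  | succ n ih => rw [hist_succ]; simp [ih]
theorem hist_get {s t : ℕ} (h : t < s) : (hist ev s)[t]? = Option.some (cstep ev (hist ev t)) := by
  induction s with
  | zero => omega
  | succ n ih =>
    rw [hist_succ]
    rcases Nat.lt_succ_iff_lt_or_eq.1 h with h | rfl
    · rw [List.getElem?_append_left (by rw [hist_length]; exact h)]; exact ih h
    · rw [List.getElem?_append_right (by rw [hist_length])]; simp [hist_length]
theorem cde_hist {s t : ℕ} (h : t < s) : cde (hist ev s) t = DD ev t := by
  simp [cde, hist_get h, DD]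
theorem cac_hist {s t : ℕ} (h : t < s) : cac (hist ev s) t = AA ev t := by
  simp [cac, hist_get h, AA]

theorem vis_iff {s t e : ℕ} {α : Str} (h : t < s) : vis (hist ev s) e α t = true ↔ Vis e (DD ev t) α := by
  simp [vis, Vis, agr_iff, cde_hist h]

theorem TT_iff {s : ℕ} {b : Bool} {j : ℕ} : TT (hist ev s) s b j = true ↔ TTP (AA ev) b j s := by
  unfold TT TTP TTa
  simp only [List.all_eq_true, List.mem_range, Bool.or_eq_true, Bool.not_eq_true', decide_eq_true_eq,
    decide_eq_false_iff_not]
  refine forall₂_congr fun t ht => ?_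
  rw [cac_hist ht]
  rcases AA ev t with _ | v
  · simp
  · simp only [Nat.add_sub_cancel, Nat.add_right_cancel_iff, Nat.add_lt_add_iff_right]
    constructor
    · rintro (((h | h) | h) | h) hj y rfl hb
      · omega
      · omega
      · exact absurd hb h
      · omega
    · intro h
      by_cases h1 : t < j
      · exact Or.inl (Or.inl (Or.inl h1))
      · by_cases h2 : typ v = b
        · exact Or.inr (by have := h (by omega) v rfl h2; omega)
        · exact Or.inl (Or.inr h2)

theorem cdelta_succ (H : List (Str × ℕ)) (s n : ℕ) :
    cdelta ev H s (n + 1) = cdelta ev H s n ++ [!(tst ev H s n (cdelta ev H s n))] := by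
  unfold cdelta
  rw [List.range_succ, List.foldl_append]; rfl
theorem cdelta_length (H : List (Str × ℕ)) (s n : ℕ) : (cdelta ev H s n).length = n := by
  induction n with
  | zero => rfl
  | succ n ih => rw [cdelta_succ]; simp [ih]
theorem cdelta_get (H : List (Str × ℕ)) (s : ℕ) {n e : ℕ} (h : e < n) :
    (cdelta ev H s n)[e]? = Option.some (!(tst ev H s e (cdelta ev H s e))) := by
  induction n with
  | zero => omega
  | succ n ih =>
    rw [cdelta_succ]
    rcases Nat.lt_succ_iff_lt_or_eq.1 h with h | rfl
    · rw [List.getElem?_append_left (by rw [cdelta_length]; exact h)]; exact ih h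
    · rw [List.getElem?_append_right (by rw [cdelta_length])]; simp [cdelta_length]
theorem cdelta_agr (H : List (Str × ℕ)) (s : ℕ) {n e : ℕ} (h : e ≤ n) :
    Agr e (cdelta ev H s e) (cdelta ev H s n) := by
  intro j hj
  rw [cdelta_get H s hj, cdelta_get H s (by omega)]

theorem Agr.symm {n : ℕ} {δ α : Str} (h : Agr n δ α) : Agr n α δ := fun j hj => (h j hj).symm
theorem Agr.trans {n : ℕ} {δ α β : Str} (h : Agr n δ α) (h' : Agr n α β) : Agr n δ β :=
  fun j hj => (h j hj).trans (h' j hj)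
theorem Agr.mono {n m : ℕ} {δ α : Str} (h : Agr n δ α) (hm : m ≤ n) : Agr m δ α :=
  fun j hj => h j (by omega)
theorem Vis.congr {e : ℕ} {δ α β : Str} (h : Agr e α β) : Vis e δ α ↔ Vis e δ β :=
  ⟨fun hv => ⟨hv.1.trans h, hv.2⟩, fun hv => ⟨hv.1.trans h.symm, hv.2⟩⟩

theorem DD_eq (s : ℕ) : DD ev s = cdelta ev (hist ev s) s s := by
  simp [DD, cstep, hist_length]
theorem AA_eq (s : ℕ) : AA ev s = cact (hist ev s) s (DD ev s) := by
  simp [AA, DD, cstep, hist_length]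

theorem allvis_iff {s e j : ℕ} {α : Str} :
    allvis (hist ev s) s e α j = true ↔ ∀ t < s, Vis e (DD ev t) α → t < j := by
  unfold allvis
  simp only [List.all_eq_true, List.mem_range, Bool.or_eq_true, Bool.not_eq_true', decide_eq_true_eq]
  refine forall₂_congr fun t ht => ?_
  rw [← vis_iff (ev := ev) ht]
  cases vis (hist ev s) e α t <;> simp

theorem tst1_iff {s e : ℕ} (he : e < s) (L : ℕ) (b : Bool) :
    tst1 ev (hist ev s) s e (cdelta ev (hist ev s) s e) L b = true ↔
      (∃ j ≤ L, prJ e < j ∧ (∀ t < s, Vis e (DD ev t) (DD ev s) → t < j) ∧ TTP (AA ev) b j s ∧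
      cver ev e j s = prV e b) := by
  unfold tst1
  simp only [List.any_eq_true, List.mem_range, Bool.and_eq_true, decide_eq_true_eq, allvis_iff, TT_iff,
    Nat.lt_succ_iff, and_assoc]
  refine exists_congr fun j => and_congr_right fun _ => and_congr_right fun _ => and_congr_left fun _ => ?_
  refine forall₂_congr fun t ht => ?_
  rw [Vis.congr (β := DD ev s)]
  rw [DD_eq]
  exact cdelta_agr _ _ he.le

theorem tst2_iff {s e : ℕ} (L : ℕ) (b : Bool) : tst2 ev (hist ev s) s e L b = true ↔
      ∀ j ≤ L, prJ e < j → TTP (AA ev) b j s → cgd ev e j s = true ∧ cver ev e j s ≤ prV e b := by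
  unfold tst2
  simp only [List.all_eq_true, List.mem_range, Bool.and_eq_true, decide_eq_true_eq, Bool.or_eq_true,
    Bool.not_eq_true', Nat.lt_succ_iff]
  refine forall₂_congr fun j hj => ?_
  rw [← TT_iff]
  cases TT (hist ev s) s b j
  · simp
  · by_cases h : j ≤ prJ e
    · simp [h]
    · simp [h, not_le.1 h]

theorem tst_iff {s e : ℕ} (he : e < s) :
    tst ev (hist ev s) s e (cdelta ev (hist ev s) s e) = true ↔ TestP ev (DD ev) (AA ev) e s := by
  unfold tst TestP
  rw [List.any_eq_true]
  refine exists_congr fun L => ?_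
  rw [List.mem_range, Nat.lt_succ_iff, Bool.and_eq_true, Bool.and_eq_true, Bool.and_eq_true,
    tst1_iff he, tst1_iff he, tst2_iff, tst2_iff, Bool.forall_bool]
  exact and_congr_right fun _ => ⟨fun h => ⟨⟨h.1.1.2, h.2⟩, ⟨h.1.1.1, h.1.2⟩⟩,
    fun h => ⟨⟨⟨h.2.1, h.1.1⟩, h.2.2⟩, h.1.2⟩⟩

theorem elig_iff {s x : ℕ} : elig (hist ev s) s (DD ev s) x = true ↔ EligP (DD ev) (AA ev) s x := by
  unfold elig EligP
  simp only [Bool.and_eq_true, decide_eq_true_eq, List.all_eq_true, List.mem_range, and_assoc]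
  refine and_congr_right fun _ => and_congr_right fun _ => and_congr ?_ ?_
  · refine forall₂_congr fun t ht => ?_
    rw [cac_hist ht]
    unfold eligA
    rcases AA ev t with _ | v
    · simp
    · simp only [Nat.add_sub_cancel, Nat.add_right_cancel_iff, Bool.or_eq_true, Bool.and_eq_true,
        Bool.not_eq_true', decide_eq_true_eq, decide_eq_false_iff_not]
      constructor
      · rintro (h | ⟨h1, h2⟩) y rfl
        · omega
        · exact ⟨h1, fun _ => by omega⟩
      · intro h
        have := h v rfl
        exact Or.inr ⟨this.1, by by_contra hc; push Not at hc; have := this.2 hc.1; omega⟩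
  · refine forall₂_congr fun t ht => ?_
    unfold eligB
    rw [cde_hist ht]
    simp only [Bool.or_eq_true, Bool.not_eq_true', decide_eq_true_eq]
    rw [← lft_iff]
    cases lft (col x + 1) (DD ev t) (DD ev s) <;> simp

theorem cspec (h : Primrec ev) : CSpec ev (DD ev) (AA ev) where
  hD := Primrec.fst.comp ((cstep_pr h).comp (hist_pr h))
  hA := Primrec.snd.comp ((cstep_pr h).comp (hist_pr h))
  d_len s := by rw [DD_eq, cdelta_length]
  d_spec s e := by
    by_cases he : e < s
    · rw [DD_eq, cdelta_get _ _ he]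
      simp only [Option.some.injEq, Bool.not_eq_false', he, true_and]
      exact tst_iff he
    · simp only [he, false_and, iff_false]
      rw [List.getElem?_eq_none (by rw [DD_eq, cdelta_length]; omega)]
      simp
  a1 s x hx := by
    rw [AA_eq] at hx
    unfold cact at hx
    rcases hf : (List.range s).find? (fun x => elig (hist ev s) s (DD ev s) x) with _ | y
    · rw [hf] at hx; simp at hx
    · rw [hf] at hx
      simp only [Option.elim, Nat.add_right_cancel_iff] at hx
      have := List.find?_some hf
      rw [hx] at this
      exact elig_iff.1 this
  a2 s x hxs hx := by
    rw [AA_eq]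
    unfold cact
    rcases hf : (List.range s).find? (fun x => elig (hist ev s) s (DD ev s) x) with _ | y
    · rw [List.find?_eq_none] at hf
      exact absurd (elig_iff.2 hx) (hf x (List.mem_range.2 hxs))
    · refine ⟨y, ?_, rfl⟩
      by_contra hc
      obtain ⟨-, as, bs, hab, hn⟩ := List.find?_eq_some_iff_append.1 hf
      have hmem : x ∈ as := by
        have hm : x ∈ as ++ y :: bs := by rw [← hab]; exact List.mem_range.2 hxs
        have hp : (as ++ y :: bs).Pairwise (· < ·) := by rw [← hab]; exact List.pairwise_lt_range
        rcases List.mem_append.1 hm with h | h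
        · exact h
        · rcases List.mem_cons.1 h with h | h
          · omega
          · have := (List.pairwise_cons.1 (List.pairwise_append.1 hp).2.1).1 x h
            omega
      have := hn x hmem
      rw [elig_iff.2 hx] at this
      simp at this
end

end PartC3

section PartC4
/-! ### Part C : verification -/
section
variable {ev : ℕ → Option (Str × ℕ)} {D : ℕ → Str} {Ac : ℕ → ℕ}

theorem CSpec.uniq (S : CSpec ev D Ac) {s t y z : ℕ} (hs : Ac s = y + 1) (ht : Ac t = z + 1)
    (h : col y = col z) : s = t := by
  rcases lt_trichotomy s t with h1 | h1 | h1
  · exact absurd h ((S.a1 t z ht).2.2.1 s h1 y hs).1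
  · exact h1
  · exact absurd h.symm ((S.a1 s y hs).2.2.1 t h1 z ht).1

theorem CSpec.bdd (S : CSpec ev D Ac) (n : ℕ) : ∃ B, ∀ s y, Ac s = y + 1 → col y < n → s < B := by
  induction n with
  | zero => exact ⟨0, fun s y _ h => by omega⟩
  | succ n ih =>
    obtain ⟨B, hB⟩ := ih
    by_cases h : ∃ s y, Ac s = y + 1 ∧ col y = n
    · obtain ⟨s0, y0, h1, h2⟩ := h
      refine ⟨max B (s0 + 1), fun s y hs hy => ?_⟩
      rcases Nat.lt_succ_iff_lt_or_eq.1 hy with hy | hy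
      · have := hB s y hs hy; omega
      · have := S.uniq hs h1 (hy.trans h2.symm); omega
    · refine ⟨B, fun s y hs hy => ?_⟩
      rcases Nat.lt_succ_iff_lt_or_eq.1 hy with hy | hy
      · exact hB s y hs hy
      · exact absurd ⟨s, y, hs, hy⟩ h

theorem CSpec.truepath (S : CSpec ev D Ac) (e : ℕ) : ∃ α : Str, α.length = e ∧
    (∀ N, ∃ s, N ≤ s ∧ Agr e (D s) α) ∧ ∃ N, ∀ s, N ≤ s → ¬ Lft e (D s) α := by
  induction e with
  | zero => exact ⟨[], rfl, fun N => ⟨N, le_rfl, fun j hj => by omega⟩, 0, fun s _ ⟨i, hi, _⟩ => by omega⟩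
  | succ e ih =>
    obtain ⟨α, hl, h1, N, hN⟩ := ih
    have hA : ∀ (δ : Str) (b : Bool) n, n ≤ e → (Agr n δ (α ++ [b]) ↔ Agr n δ α) := by
      intro δ b n hn
      refine forall₂_congr fun j hj => ?_
      rw [List.getElem?_append_left (by omega)]
    have hlast : ∀ b : Bool, (α ++ [b])[e]? = Option.some b := by
      intro b; rw [List.getElem?_append_right (by omega)]; simp [hl]
    have hS : ∀ (δ : Str) (b : Bool), Agr (e + 1) δ (α ++ [b]) ↔ Agr e δ α ∧ δ[e]? = Option.some b := by
      intro δ b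
      constructor
      · intro h
        exact ⟨(hA δ b e le_rfl).1 (h.mono (by omega)), by rw [h e (by omega), hlast]⟩
      · rintro ⟨h, h'⟩ j hj
        rcases Nat.lt_succ_iff_lt_or_eq.1 hj with hj | rfl
        · exact (hA δ b e le_rfl).2 h j hj
        · rw [h', hlast]
    have hL : ∀ (δ : Str) (b : Bool), Lft (e + 1) δ (α ++ [b]) → Lft e δ α ∨ (b = true ∧ Vis e δ α) := by
      rintro δ b ⟨i, hi, h, h', h''⟩
      rcases Nat.lt_succ_iff_lt_or_eq.1 hi with hi | rfl
      · left
        rw [List.getElem?_append_left (by omega)] at h''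
        exact ⟨i, hi, (hA δ b i hi.le).1 h, h', h''⟩
      · right
        rw [hlast] at h''
        exact ⟨by simpa using h'', (hA δ b i le_rfl).1 h, h'⟩
    by_cases h : ∀ N, ∃ s, N ≤ s ∧ Vis e (D s) α
    · refine ⟨α ++ [false], by simp [hl], fun N => ?_, N, fun s hs hc => ?_⟩
      · obtain ⟨s, hs, hv⟩ := h N
        exact ⟨s, hs, (hS _ _).2 hv⟩
      · rcases hL _ _ hc with h | h
        · exact hN s hs h
        · exact absurd h.1 (by simp)
    · push Not at h
      obtain ⟨N', hN'⟩ := h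
      refine ⟨α ++ [true], by simp [hl], fun M => ?_, max N N', fun s hs hc => ?_⟩
      · obtain ⟨s, hs, hv⟩ := h1 (max M (max N' (e + 1)))
        refine ⟨s, by omega, (hS _ _).2 ⟨hv, ?_⟩⟩
        have h2 : e < (D s).length := by rw [S.d_len]; omega
        have h3 := hN' s (by omega)
        rw [List.getElem?_eq_getElem h2]
        cases h4 : (D s)[e] with
        | true => rfl
        | false => exact absurd ⟨hv, by rw [List.getElem?_eq_getElem h2, h4]⟩ h3
      · rcases hL _ _ hc with h | h
        · exact hN s (by omega) h
        · exact hN' s (by omega) h.2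

theorem CSpec.settled (S : CSpec ev D Ac) (N : ℕ) : ∃ j, N < j ∧ ∀ b s, TTP Ac b j s := by
  by_cases h : ∃ m t y, N ≤ t ∧ Ac t = y + 1 ∧ col y = m
  · obtain ⟨t, y, h1, h2, h3⟩ := Nat.find_spec h
    refine ⟨t + 1, by omega, fun b s u hu htu z hz _ => ?_⟩
    have h4 : Nat.find h ≤ col z := Nat.find_min' h ⟨u, z, by omega, hz, rfl⟩
    have h5 := (S.a1 u z hz).2.2.1 t (by omega) y h2
    exact h5.2 (by have := h5.1; omega)
  · push Not at h
    exact ⟨N + 1, by omega, fun b s u hu htu z hz _ => absurd rfl (h _ u z (by omega) hz)⟩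

/-- the sets under construction -/
def Aset (Ac : ℕ → ℕ) (b : Bool) : Set ℕ := {x | ∃ s, Ac s = x + 1 ∧ typ x = b}
def Ahat (Ac : ℕ → ℕ) (b : Bool) : Set ℕ := {n | ∃ x, x ∈ Aset Ac b ∧ n = 2 ^ x}

def hatq (b : Bool) (v n : ℕ) : Bool := decide (0 < v) && decide (typ (v - 1) = b) && decide (n = 2 ^ (v - 1))
@[fun_prop] theorem hatq_pr : Primrec fun p : Bool × ℕ × ℕ => hatq p.1 p.2.1 p.2.2 := by
  unfold hatq; fun_prop
theorem hatq_iff {b : Bool} {v n : ℕ} : hatq b v n = true ↔ ∃ x, v = x + 1 ∧ typ x = b ∧ n = 2 ^ x := by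
  unfold hatq
  simp only [Bool.and_eq_true, decide_eq_true_eq]
  constructor
  · rintro ⟨⟨h1, h2⟩, h3⟩
    exact ⟨v - 1, by omega, h2, h3⟩
  · rintro ⟨x, rfl, h2, h3⟩
    exact ⟨⟨by omega, h2⟩, h3⟩

theorem mem_Ahat {b : Bool} {n : ℕ} : n ∈ Ahat Ac b ↔ ∃ s, hatq b (Ac s) n = true := by
  simp only [hatq_iff]
  constructor
  · rintro ⟨x, ⟨s, h1, h2⟩, h3⟩
    exact ⟨s, x, h1, h2, h3⟩
  · rintro ⟨s, x, h1, h2, h3⟩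
    exact ⟨x, ⟨s, h1, h2⟩, h3⟩

theorem CSpec.ce (S : CSpec ev D Ac) (b : Bool) : CESet (Ahat Ac b) := by
  have hA := S.hA
  have h : Primrec fun p : ℕ × ℕ => hatq b (Ac p.1) p.2 := by fun_prop
  have h2 := ce_of_enum (a := fun s n => hatq b (Ac s) n) h
  have h3 : Ahat Ac b = {n | ∃ s, hatq b (Ac s) n = true} := by
    ext n; exact mem_Ahat
  rw [h3]; exact h2

def hatf (Ac : ℕ → ℕ) (b : Bool) (j n : ℕ) : Bool := (List.range j).any fun t => hatq b (Ac t) n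

theorem hatf_pr (hA : Primrec Ac) (b : Bool) : Primrec fun p : ℕ × ℕ => hatf Ac b p.1 p.2 := by
  unfold hatf; fun_prop

theorem total_machine {V : Str →. Str} (hV : OptimalPlain V) {f : Str → Str} (hf : Primrec f) :
    ∃ c : ℕ, ∀ ρ, KC V (f ρ) ≤ (ρ.length + c : ℕ) := by
  obtain ⟨c, hc⟩ := hV.2 (fun ρ => Part.some (f ρ)) (Computable.partrec hf.to_comp)
  refine ⟨c, fun ρ => (hc _).trans ?_⟩
  push_cast
  gcongr
  exact KC_le_of_mem (Part.mem_some _)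

theorem hat_complexity {V : Str →. Str} (hV : OptimalPlain V) (hA : Primrec Ac) (b : Bool) :
    ∃ c : ℕ, ∀ j, (∀ s, TTP Ac b j s) → ∀ n, 2 ^ j ≤ n → n < 2 ^ (j + 1) →
      KC V (restrSet (Ahat Ac b) n) ≤ (j + c : ℕ) := by
  have h1 := rs_pr (hatf_pr hA b)
  have hf : Primrec fun ρ : Str => rs (hatf Ac b ρ.length) (num ρ) :=
    h1.comp (Primrec.pair Primrec.list_length num_pr)
  obtain ⟨c, hc⟩ := total_machine hV hf
  refine ⟨c, fun j hj n hn1 hn2 => ?_⟩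
  obtain ⟨ρ, hρ, hnum⟩ := num_surj j n hn1 hn2
  have := hc ρ
  rw [hρ, hnum] at this
  convert this using 2
  rw [restrSet_eq_rs, rs_eq_iff]
  intro x hx
  rw [Bool.eq_iff_iff, decide_eq_true_iff, mem_Ahat]
  unfold hatf
  simp only [List.any_eq_true, List.mem_range]
  constructor
  · rintro ⟨s, hs⟩
    refine ⟨s, ?_, hs⟩
    by_contra hc
    obtain ⟨y, h1, h2, rfl⟩ := hatq_iff.1 hs
    have h3 := hj (s + 1) s (by omega) (by omega) y h1 h2
    have h4 : y < j + 1 := (Nat.pow_lt_pow_iff_right (by norm_num : 1 < 2)).1 (hx.trans hn2)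
    omega
  · rintro ⟨s, _, hs⟩
    exact ⟨s, hs⟩

theorem zero_complexity {V : Str →. Str} (hV : OptimalPlain V) :
    ∃ c : ℕ, ∀ j n, 2 ^ j ≤ n → n < 2 ^ (j + 1) → KC V (zeroStr n) ≤ (j + c : ℕ) := by
  have hf : Primrec fun ρ : Str => zeroStr (num ρ) := by unfold zeroStr; fun_prop
  obtain ⟨c, hc⟩ := total_machine hV hf
  refine ⟨c, fun j n hn1 hn2 => ?_⟩
  obtain ⟨ρ, hρ, hnum⟩ := num_surj j n hn1 hn2
  have := hc ρ
  rwa [hρ, hnum] at this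

/-- the positive requirements -/
theorem CSpec.positive (S : CSpec ev D Ac) (b : Bool) : ¬ CESet (Aset Ac b)ᶜ := by
  intro hce
  obtain ⟨i, hi⟩ := ce_index hce
  obtain ⟨e, he1, he2⟩ : ∃ e, e / 2 = i ∧ decide (e % 2 = 1) = b := by
    cases b
    · exact ⟨2 * i, by omega, by simp⟩
    · exact ⟨2 * i + 1, by omega, by simp⟩
  by_cases hact : ∃ s y, Ac s = y + 1 ∧ col y = e
  · obtain ⟨s, y, hs, hy⟩ := hact
    have h1 := (S.a1 s y hs).1
    rw [hy, he1] at h1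
    have h2 : y ∈ (Aset Ac b)ᶜ := (hi y).2 ⟨s, h1⟩
    apply h2
    refine ⟨s, hs, ?_⟩
    unfold typ
    change y.unpair.1 = e at hy
    rw [hy]; exact he2
  · push Not at hact
    obtain ⟨α, hl, hinf, N, hN⟩ := S.truepath (e + 1)
    obtain ⟨B, hB⟩ := S.bdd e
    let x := Nat.pair e (N + B + 2)
    have hx : N + B + 2 ≤ x := Nat.right_le_pair _ _
    have hcx : col x = e := by simp [col, x]
    have hxA : x ∈ (Aset Ac b)ᶜ := by
      rintro ⟨s, hs, -⟩
      exact hact s x hs hcx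
    obtain ⟨s1, hs1⟩ := (hi x).1 hxA
    obtain ⟨B', hB'⟩ := S.bdd (x + 1)
    obtain ⟨s, hs, hagr⟩ := hinf (max s1 (max B' (max (e + 1) (x + 1))))
    have hel : EligP D Ac s x := by
      refine ⟨?_, by omega, ?_, ?_⟩
      · rw [hcx, he1]; exact wn_mono i s1 s x (by omega) hs1
      · intro t ht y hy
        refine ⟨by rw [hcx]; exact hact t y hy, fun hlt => ?_⟩
        have := hB t y hy (by omega)
        omega
      · rintro t ht ⟨k, hk, h1, h2, h3⟩
        rw [hcx] at hk
        by_contra hc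
        exact hN t (by omega) ⟨k, hk, h1.trans (hagr.mono (by omega)), h2, by rw [← h3]; exact (hagr k hk).symm⟩
    obtain ⟨y, hy, hAc⟩ := S.a2 s x (by omega) hel
    have h5 : col y ≤ y := Nat.unpair_left_le y
    have := hB' s y hAc (by omega)
    omega

theorem ce_preimage_pow {A : Set ℕ} (h : CESet A) : CESet {x | 2 ^ x ∈ A} := by
  obtain ⟨a, h1, -, h3⟩ := ce_enum h
  have h4 : Primrec fun p : ℕ × ℕ => a p.1 (2 ^ p.2) := by fun_prop
  have := ce_of_enum (a := fun s x => a s (2 ^ x)) h4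
  have h5 : {x | 2 ^ x ∈ A} = {x | ∃ s, a s (2 ^ x) = true} := by ext x; exact h3 _
  rw [h5]; exact this

theorem CSpec.nontrivial {V : Str →. Str} (hV : OptimalPlain V) {d : ℕ → Str} (S : CSpec ev D Ac) (hev : Primrec ev)
    (hd : ∀ i σ ℓ, ev i = Option.some (σ, ℓ) → (d i).length = ℓ ∧ σ ∈ V (d i) ∧ σ.length ≤ i)
    (he : ∀ ρ σ, σ ∈ V ρ → ∃ i, ev i = Option.some (σ, ρ.length)) (b : Bool) :
    ¬ CTrivialSet V (Ahat Ac b) := by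
  rintro ⟨c, hc⟩
  obtain ⟨c', hc'⟩ := zero_complexity hV
  obtain ⟨i, hi⟩ := ce_index (S.ce b)
  have h1 : CESet (Ahat Ac b)ᶜ := chaitin hev hd hi (c' + c) fun j => gd_of_KC he hi fun n h1 h2 => by
    refine (hc n).trans ?_
    calc KC V (zeroStr n) + c ≤ (j + c' : ℕ) + c := by gcongr; exact hc' j n h1 h2
      _ = _ := by push_cast; ring
  apply S.positive b
  have h2 := ce_preimage_pow h1
  convert h2 using 1
  ext x
  simp only [Set.mem_compl_iff, Set.mem_ofPred_eq]
  refine not_congr ⟨fun h => ⟨x, h, rfl⟩, ?_⟩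
  rintro ⟨y, hy, hxy⟩
  rw [Nat.pow_right_injective le_rfl hxy]; exact hy
end

end PartC4

section PartC5
/-! ### Part C : the minimal pair requirements -/
section
variable {ev : ℕ → Option (Str × ℕ)} {D : ℕ → Str} {Ac : ℕ → ℕ}

theorem TTP.eventually (b : Bool) (j : ℕ) : ∃ s0, ∀ s, s0 ≤ s → TTP Ac b j s → ∀ u, TTP Ac b j u := by
  by_cases h : ∀ u, TTP Ac b j u
  · exact ⟨0, fun _ _ _ => h⟩
  · push Not at h
    obtain ⟨u, hu⟩ := h
    exact ⟨u, fun s hs h' => absurd (fun t ht => h' t (by omega)) hu⟩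

/-- bounded quantifiers commute with eventually -/
theorem eventually_bdd {P : ℕ → ℕ → Prop} (h : ∀ j, ∃ s0, ∀ s, s0 ≤ s → P j s) (L : ℕ) :
    ∃ s0, ∀ s, s0 ≤ s → ∀ j ≤ L, P j s := by
  induction L with
  | zero =>
    obtain ⟨s0, h0⟩ := h 0
    exact ⟨s0, fun s hs j hj => by rw [Nat.le_zero.1 hj]; exact h0 s hs⟩
  | succ L ih =>
    obtain ⟨s0, h0⟩ := ih
    obtain ⟨s1, h1⟩ := h (L + 1)
    refine ⟨max s0 s1, fun s hs j hj => ?_⟩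
    rcases Nat.le_succ_iff.1 hj with hj | rfl
    · exact h0 s (by omega) j hj
    · exact h1 s (by omega)

theorem test_eventually {e : ℕ}
    (hgood : ∀ b j, (∀ s, TTP Ac b j s) → ∃ s0, ∀ s, s0 ≤ s → cgd ev e j s = true)
    (hle : ∀ b j, (∀ s, TTP Ac b j s) → prJ e < j → ∀ s, cver ev e j s ≤ prV e b)
    (hinf : ∀ b N, ∃ j, N < j ∧ (∀ s, TTP Ac b j s) ∧ ∃ s, ∀ t, s ≤ t → cver ev e j t = prV e b) (τ : ℕ) :
    ∃ s0, ∀ s, s0 ≤ s → (∀ t < s, Vis e (D t) (D s) → t < τ) → TestP ev D Ac e s := by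
  choose jj h1 h2 ss h3 using fun b => hinf b (max τ (prJ e))
  let L := max (jj true) (jj false)
  have hL : ∀ b, jj b ≤ L := by intro b; cases b <;> simp [L]
  have key : ∀ b, ∃ s0, ∀ s, s0 ≤ s → ∀ j ≤ L, prJ e < j → TTP Ac b j s →
      cgd ev e j s = true ∧ cver ev e j s ≤ prV e b := by
    intro b
    refine eventually_bdd (P := fun j s => prJ e < j → TTP Ac b j s →
      cgd ev e j s = true ∧ cver ev e j s ≤ prV e b) (fun j => ?_) L
    obtain ⟨s0, hs0⟩ := TTP.eventually (Ac := Ac) b j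
    by_cases hj : ∀ u, TTP Ac b j u
    · obtain ⟨s1, hs1⟩ := hgood b j hj
      exact ⟨s1, fun s hs hlt _ => ⟨hs1 s hs, hle b j hj hlt s⟩⟩
    · exact ⟨s0, fun s hs _ ht => absurd (hs0 s hs ht) hj⟩
  choose s0 hs0 using key
  refine ⟨L + s0 true + s0 false + ss true + ss false, fun s hs hv => ⟨L, by omega, fun b => ⟨?_, ?_⟩⟩⟩
  · have hb : ss b ≤ s := by cases b <;> omega
    have := h1 b
    exact ⟨jj b, hL b, by omega, fun t ht hvt => by have := hv t ht hvt; omega, h2 b s, h3 b s hb⟩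
  · exact hs0 b s (by cases b <;> omega)

theorem trichotomy {α δ : Str} {n : ℕ} (hα : n ≤ α.length) (hδ : n ≤ δ.length) :
    Agr n δ α ∨ Lft n δ α ∨ Lft n α δ := by
  by_cases h : Agr n δ α
  · exact Or.inl h
  · right
    unfold Agr at h
    push Not at h
    obtain ⟨hj, hne⟩ := Nat.find_spec h
    have hag : Agr (Nat.find h) δ α := by
      intro i hi
      have := Nat.find_min h hi
      push Not at this
      exact this (by omega)
    generalize Nat.find h = j at hj hne hag
    have h1 : j < α.length := by omega
    have h2 : j < δ.length := by omega
    rw [List.getElem?_eq_getElem h1, List.getElem?_eq_getElem h2] at hne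
    have h3 := List.getElem?_eq_getElem h1
    have h4 := List.getElem?_eq_getElem h2
    cases ha : α[j] <;> cases hb : δ[j] <;> rw [ha] at hne h3 <;> rw [hb] at hne h4
    · exact absurd rfl hne
    · exact Or.inr ⟨j, hj, hag.symm, h3, h4⟩
    · exact Or.inl ⟨j, hj, hag, h4, h3⟩
    · exact absurd rfl hne

/-- between consecutive expansionary stages the approximation persists -/
theorem CSpec.step_agree (S : CSpec ev D Ac) {e : ℕ} {α : Str} (hl : α.length = e) {N : ℕ}
    (hN : ∀ s, N ≤ s → ¬ Lft e (D s) α) (hB : ∀ s y, Ac s = y + 1 → col y < e → s < N)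
    {t s s' : ℕ} (hNs : N ≤ s) (hts : t < s) (hss : s < s') (ht : Vis e (D t) α) (hs : Vis e (D s) α) (hs' : Vis e (D s') α)
    (hbet : ∀ u, s < u → u < s' → ¬ Vis e (D u) α) {x : ℕ} (hx : x < t) :
    wn (prI e) s' x = wn (prI e) s x := by
  have hact : ∀ u, s < u → u < s' → ∀ y, Ac u = y + 1 → s < y := by
    intro u h1 h2 y hy
    have hel := S.a1 u y hy
    have hcol : e ≤ col y := by
      by_contra hc
      have := hB u y hy (by omega)
      omega
    refine hel.2.2.2 s h1 ?_
    have hlen : e + 1 ≤ (D u).length := by rw [S.d_len]; have := hel.2.1; omega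
    have hα : (α ++ [false]).length = e + 1 := by simp [hl]
    have hAe : ∀ n ≤ e, ∀ δ : Str, Agr n δ (α ++ [false]) ↔ Agr n δ α := by
      intro n hn δ
      refine forall₂_congr fun j hj => ?_
      rw [List.getElem?_append_left (by omega)]
    have hlast : (α ++ [false])[e]? = Option.some false := by
      rw [List.getElem?_append_right (by omega)]; simp [hl]
    rcases trichotomy (α := α ++ [false]) (δ := D u) (n := e + 1) (by omega) hlen with h | h | h
    · exfalso
      apply hbet u h1 h2
      exact ⟨(hAe e le_rfl _).1 (h.mono (by omega)), by rw [h e (by omega), hlast]⟩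
    · exfalso
      obtain ⟨k, hk, g1, g2, g3⟩ := h
      rcases Nat.lt_succ_iff_lt_or_eq.1 hk with hk | rfl
      · rw [List.getElem?_append_left (by omega)] at g3
        exact hN u (by omega) ⟨k, hk, (hAe k hk.le _).1 g1, g2, g3⟩
      · rw [hlast] at g3; simp at g3
    · obtain ⟨k, hk, g1, g2, g3⟩ := h
      have hDs : Agr (e + 1) (D s) (α ++ [false]) := by
        intro j hj
        rcases Nat.lt_succ_iff_lt_or_eq.1 hj with hj | rfl
        · exact (hAe e le_rfl _).2 hs.1 j hj
        · rw [hs.2, hlast]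
      exact ⟨k, by omega, (hDs.mono (by omega)).trans g1, by rw [hDs k hk]; exact g2, g3⟩
  obtain ⟨L, hL, hT⟩ := ((S.d_spec s e).1 hs.2).2
  obtain ⟨L', hL', hT'⟩ := ((S.d_spec s' e).1 hs'.2).2
  obtain ⟨b, hb⟩ : ∃ b, ∀ y, Ac s = y + 1 → typ y ≠ b := by
    rcases h : Ac s with _ | z
    · exact ⟨true, fun y hy => by omega⟩
    · refine ⟨!(typ z), fun y hy => ?_⟩
      have : y = z := by omega
      rw [this]; simp
  obtain ⟨⟨j, hj1, hj2, hj3, hj4, hj5⟩, -⟩ := hT b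
  obtain ⟨⟨j', hj1', hj2', hj3', hj4', hj5'⟩, hall⟩ := hT' b
  have htj : t < j := hj3 t hts ((Vis.congr hs.1).2 ht)
  have hsj' : s < j' := hj3' s hss ((Vis.congr hs'.1).2 hs)
  have hTT : TTP Ac b j s' := by
    intro u hu hju y hy hty
    rcases lt_trichotomy u s with h | h | h
    · exact hj4 u h hju y hy hty
    · rw [h] at hy; exact absurd hty (hb y hy)
    · have := hact u h hu y hy; omega
  obtain ⟨g1, g2⟩ := hall j (by omega) hj2 hTT
  refine ver_same (ev := ev) (c := prC e) (j := j) hss.le ?_ g1 x ((hx.trans htj).trans Nat.lt_two_pow_self)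
  have : cver ev e j s' ≤ cver ev e j s := by rw [hj5]; exact g2
  exact this

theorem last_vis {P : ℕ → Prop} {s s' : ℕ} (hs : P s) (h : s < s') :
    ∃ u, s ≤ u ∧ u < s' ∧ P u ∧ ∀ v, u < v → v < s' → ¬ P v := by
  induction s' with
  | zero => omega
  | succ n ih =>
    by_cases hn : P n
    · exact ⟨n, by omega, by omega, hn, fun v h1 h2 => by omega⟩
    · obtain ⟨u, h1, h2, h3, h4⟩ := ih (by
        rcases Nat.lt_succ_iff_lt_or_eq.1 h with h | rfl
        · exact h
        · exact absurd hs hn)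
      refine ⟨u, h1, by omega, h3, fun v hv1 hv2 => ?_⟩
      rcases Nat.lt_succ_iff_lt_or_eq.1 hv2 with h | rfl
      · exact h4 v hv1 h
      · exact hn

theorem CSpec.agree (S : CSpec ev D Ac) {e : ℕ} {α : Str} (hl : α.length = e) {N : ℕ}
    (hN : ∀ s, N ≤ s → ¬ Lft e (D s) α) (hB : ∀ s y, Ac s = y + 1 → col y < e → s < N)
    {t s : ℕ} (hNt : N ≤ t) (hts : t < s) (ht : Vis e (D t) α) (hs : Vis e (D s) α) {x : ℕ} (hx : x < t) (s' : ℕ)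
    (hss : s ≤ s') (hs' : Vis e (D s') α) : wn (prI e) s' x = wn (prI e) s x := by
  induction s' using Nat.strong_induction_on with
  | _ s' ih =>
    rcases hss.eq_or_lt with rfl | h
    · rfl
    · obtain ⟨u, h1, h2, h3, h4⟩ := last_vis (P := fun u => Vis e (D u) α) hs h
      rw [← ih u h2 h1 h3]
      exact S.step_agree hl hN hB (by omega) (by omega) h2 ht h3 hs' h4 hx

theorem CSpec.compl_ce (S : CSpec ev D Ac) {e : ℕ} {α : Str} (hl : α.length = e)
    (hinf : ∀ N, ∃ s, N ≤ s ∧ Vis e (D s) α) (hfin : ∃ N, ∀ s, N ≤ s → ¬ Lft e (D s) α)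
    {X : Set ℕ} (hX : ∀ x, x ∈ X ↔ ∃ s, wn (prI e) s x = true) : CESet Xᶜ := by
  obtain ⟨N0, hN0⟩ := hfin
  obtain ⟨B, hB⟩ := S.bdd e
  let N := max N0 B
  have hN : ∀ s, N ≤ s → ¬ Lft e (D s) α := fun s hs => hN0 s (le_trans (le_max_left _ _) hs)
  have hB' : ∀ s y, Ac s = y + 1 → col y < e → s < N := fun s y h1 h2 => lt_of_lt_of_le (hB s y h1 h2) (le_max_right _ _)
  let vq : ℕ → Bool := fun s => agr e (D s) α && decide ((D s)[e]? = Option.some false)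
  have hvq : Primrec vq := by
    have := S.hD
    simp only [vq]; fun_prop
  have hvq' : ∀ s, vq s = true ↔ Vis e (D s) α := by
    intro s; simp [vq, Vis, agr_iff]
  let a : ℕ → ℕ → Bool := fun m x => decide (N ≤ m.unpair.1) && decide (x < m.unpair.1) &&
    decide (m.unpair.1 < m.unpair.2) && vq m.unpair.1 && vq m.unpair.2 && !(wn (prI e) m.unpair.2 x)
  have ha : Primrec fun p : ℕ × ℕ => a p.1 p.2 := by
    simp only [a]; fun_prop
  have : Xᶜ = {x | ∃ m, a m x = true} := by
    ext x
    simp only [Set.mem_compl_iff, Set.mem_ofPred_eq, a, Bool.and_eq_true, decide_eq_true_eq, Bool.not_eq_true', hvq']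
    constructor
    · intro hx
      obtain ⟨t, h1, h2⟩ := hinf (max N (x + 1))
      obtain ⟨s, h3, h4⟩ := hinf (t + 1)
      refine ⟨Nat.pair t s, ?_⟩
      simp only [Nat.unpair_pair]
      refine ⟨⟨⟨⟨⟨by omega, by omega⟩, by omega⟩, h2⟩, h4⟩, ?_⟩
      rw [← Bool.not_eq_true]
      exact fun hc => hx ((hX x).2 ⟨s, hc⟩)
    · rintro ⟨m, ⟨⟨⟨⟨h1, h2⟩, h3⟩, h4⟩, h5⟩, h6⟩ hx
      obtain ⟨s1, hs1⟩ := (hX x).1 hx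
      obtain ⟨s', hs', hv⟩ := hinf (max s1 m.unpair.2)
      have := S.agree hl hN hB' h1 h3 h4 h5 h2 s' (by omega) hv
      rw [h6, wn_mono (prI e) s1 s' x (by omega) hs1] at this
      exact absurd this (by simp)
  rw [this]
  exact ce_of_enum ha

theorem CSpec.negative {V : Str →. Str} {d : ℕ → Str} (S : CSpec ev D Ac)
    (hd : ∀ i σ ℓ, ev i = Option.some (σ, ℓ) → (d i).length = ℓ ∧ σ ∈ V (d i) ∧ σ.length ≤ i)
    {X : Set ℕ} {i c : ℕ} (hX : ∀ x, x ∈ X ↔ ∃ s, wn i s x = true)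
    (hgood : ∀ b j, (∀ s, TTP Ac b j s) → ∃ s0, ∀ s, s0 ≤ s → gd ev i c s j = true) : CESet Xᶜ := by
  choose v j0 h1 h2 using fun b => ver_choice (V := V) hd i c (fun j => ∀ s, TTP Ac b j s)
    (fun N => by obtain ⟨j, hj, h⟩ := S.settled N; exact ⟨j, hj, h b⟩)
  let e := Nat.pair i (Nat.pair c (Nat.pair (max (j0 true) (j0 false)) (Nat.pair (v true) (v false))))
  have hI : prI e = i := by simp [prI, e]
  have hC : prC e = c := by simp [prC, e]
  have hJ : prJ e = max (j0 true) (j0 false) := by simp [prJ, e]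
  have hV : ∀ b, prV e b = v b := by intro b; cases b <;> simp [prV, e]
  have hJ' : ∀ b, j0 b ≤ prJ e := by intro b; rw [hJ]; cases b <;> simp
  have hcv : ∀ j s, cver ev e j s = ver ev i c j s := by intro j s; unfold cver; rw [hI, hC]
  have hcg : ∀ j s, cgd ev e j s = gd ev i c s j := by intro j s; unfold cgd; rw [hI, hC]
  generalize e = e' at *
  obtain ⟨α, hl, hinf, hfin⟩ := S.truepath e'
  refine S.compl_ce hl ?_ hfin (by rw [hI]; exact hX)
  by_contra hc
  push Not at hc
  obtain ⟨N, hN⟩ := hc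
  obtain ⟨s0, hs0⟩ := test_eventually (ev := ev) (D := D) (Ac := Ac) (e := e')
    (by simpa only [hcg] using hgood)
    (fun b j hj hlt s => by rw [hcv, hV]; exact h1 b j hj (lt_of_le_of_lt (hJ' b) hlt) s)
    (fun b M => by simpa only [hcv, hV] using h2 b M) N
  obtain ⟨s, hs, hag⟩ := hinf (max s0 (max N (e' + 1)))
  apply hN s (by omega)
  refine ⟨hag, (S.d_spec s e').2 ⟨by omega, hs0 s (by omega) fun t ht hv => ?_⟩⟩
  by_contra hc
  exact hN t (by omega) ((Vis.congr hag).1 hv)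

theorem ctrivial_of_computable {V : Str →. Str} (hV : OptimalPlain V) {X : Set ℕ} (h1 : CESet X) (h2 : CESet Xᶜ) :
    CTrivialSet V X := by
  obtain ⟨a, ha, hma, hXa⟩ := ce_enum h1
  obtain ⟨b, hb, hmb, hXb⟩ := ce_enum h2
  -- settled at stage s below n
  let f : ℕ → ℕ → Option Str := fun n s =>
    bif (List.range n).all (fun x => a s x || b s x) then Option.some (rs (a s) n) else Option.none
  have hrs := rs_pr ha
  have hall : Primrec fun p : ℕ × ℕ => (List.range p.1).all (fun x => a p.2 x || b p.2 x) := by fun_prop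
  have hf : Primrec fun p : ℕ × ℕ => f p.1 p.2 :=
    Primrec.cond hall (Primrec.option_some.comp (hrs.comp (Primrec.pair Primrec.snd Primrec.fst))) (Primrec.const _)
  have hsound : ∀ n s σ, f n s = Option.some σ → σ = restrSet X n := by
    intro n s σ h
    simp only [f] at h
    cases hc : (List.range n).all (fun x => a s x || b s x) with
    | false => rw [hc] at h; simp at h
    | true =>
      rw [hc] at h
      simp only [cond_true, Option.some.injEq] at h
      rw [← h, restrSet_eq_rs, rs_eq_iff]
      intro x hx
      simp only [List.all_eq_true, List.mem_range, Bool.or_eq_true] at hc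
      rw [Bool.eq_iff_iff, decide_eq_true_iff, hXa]
      constructor
      · exact fun h => ⟨s, h⟩
      · rintro ⟨s', hs'⟩
        rcases hc x hx with h | h
        · exact h
        · exact absurd ((hXa x).2 ⟨s', hs'⟩) ((hXb x).2 ⟨s, h⟩)
  have hcomplete : ∀ n, ∃ s σ, σ ∈ f n s := by
    intro n
    obtain ⟨s1, h1⟩ := exists_stage hma hXa n
    obtain ⟨s2, h2⟩ := exists_stage hmb hXb n
    refine ⟨max s1 s2, rs (a (max s1 s2)) n, ?_⟩
    have : (List.range n).all (fun x => a (max s1 s2) x || b (max s1 s2) x) = true := by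
      simp only [List.all_eq_true, List.mem_range, Bool.or_eq_true]
      intro x hx
      rw [h1 _ (le_max_left _ _) x hx, h2 _ (le_max_right _ _) x hx]
      by_cases hxX : x ∈ X <;> simp [hxX]
    simp only [f, this, cond_true]
    rfl
  have hf2 : Computable₂ f := Primrec.to_comp hf
  have hg : Partrec fun n => Nat.rfindOpt (f n) := Partrec.rfindOpt hf2
  have hM : Partrec fun ρ : Str => (V ρ).bind fun σ => Nat.rfindOpt (f σ.length) :=
    Partrec.bind hV.1 (hg.comp (Primrec.list_length.to_comp.comp Computable.snd))
  obtain ⟨c, hc⟩ := hV.2 _ hM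
  refine ⟨c, fun n => (hc _).trans ?_⟩
  gcongr
  refine le_iInf fun ρ => ?_
  apply KC_le_of_mem
  refine Part.mem_bind ρ.2 ?_
  have hlen : (zeroStr n).length = n := by simp [zeroStr]
  rw [hlen]
  have hdom : (Nat.rfindOpt (f n)).Dom := Nat.rfindOpt_dom.2 (hcomplete n)
  obtain ⟨m, hm⟩ := Nat.rfindOpt_spec (Part.get_mem hdom)
  rw [← hsound n m _ hm]
  exact Part.get_mem hdom

theorem partC {V : Str →. Str} (hV : OptimalPlain V) : ∃ A D : Set ℕ, CESet A ∧ CESet D ∧ ¬ CTrivialSet V A ∧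
    ¬ CTrivialSet V D ∧ ∀ X : Set ℕ, CESet X → CLeSet V X A → CLeSet V X D → CTrivialSet V X := by
  obtain ⟨ev, d, hev, hd, he, -⟩ := events hV.1
  have S := cspec hev
  refine ⟨Ahat (AA ev) true, Ahat (AA ev) false, S.ce _, S.ce _, S.nontrivial hV hev hd he _,
    S.nontrivial hV hev hd he _, fun X hX hA hB => ?_⟩
  obtain ⟨i, hi⟩ := ce_index hX
  have hle : ∀ b, CLeSet V X (Ahat (AA ev) b) := by intro b; cases b <;> assumption
  choose c hc using hle
  choose c' hc' using fun b => hat_complexity hV S.hA b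
  refine ctrivial_of_computable hV hX (S.negative (V := V) hd (c := c true + c false + c' true + c' false) hi
    fun b j hj => gd_of_KC he hi fun n h1 h2 => ?_)
  refine (hc b n).trans ?_
  calc KC V (restrSet (Ahat (AA ev) b) n) + c b ≤ ((j + c' b : ℕ) : ℕ∞) + c b := by
        gcongr; exact hc' b j hj n h1 h2
    _ = ((j + c' b + c b : ℕ) : ℕ∞) := by push_cast; ring
    _ ≤ _ := by
      have : j + c' b + c b ≤ j + (c true + c false + c' true + c' false) := by cases b <;> omega
      exact_mod_cast this
end

end PartC5

/-- The `C`-degrees of c.e. sets and the `K`-degrees of c.e. sets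
are not elementarily equivalent: the former contain a minimal pair, the latter do not. -/
theorem stmt10 (V : Str →. Str) (hV : OptimalPlain V) (U : Str →. Str) (hU : OptimalPF U) :
    (∃ A D : Set ℕ, CESet A ∧ CESet D ∧ ¬ CTrivialSet V A ∧ ¬ CTrivialSet V D ∧
        ∀ X : Set ℕ, CESet X → CLeSet V X A → CLeSet V X D → CTrivialSet V X) ∧
    ¬ (∃ A D : Set ℕ, CESet A ∧ CESet D ∧ ¬ KTrivialSet U A ∧ ¬ KTrivialSet U D ∧
        ∀ X : Set ℕ, CESet X → KLeSet U X A → KLeSet U X D → KTrivialSet U X) := by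
  exact ⟨partC hV, partK hU⟩

end KPaper
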